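/- Let n ≥ 2, p ≥ 2, let Ω ⊆ ℝⁿ be open, and let u : Ω → ℝ^p be an energy minimizing map into the unit sphere S^{p−1}. Then the (n−2)-dimensional Hausdorff measure of the singular set vanishes: H^{n−2}(sing(u)) = 0. In particular, if n = 2 then sing(u) = ∅. -/

import Mathlib

open MeasureTheory Metric Filter Set

noncomputable section

/-- The pointwise energy density `|Du|²(x) = ∑_{i,j} ((g(x)eᵢ)_j)²` associated to a
(weak) gradient `g`. -/
def energyDensity (n p : ℕ)
    (g : EuclideanSpace ℝ (Fin n) →
      (EuclideanSpace ℝ (Fin n) →L[ℝ] EuclideanSpace ℝ (Fin p)))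
    (x : EuclideanSpace ℝ (Fin n)) : ℝ :=
  ∑ i : Fin n, ∑ j : Fin p, (g x (EuclideanSpace.single i 1) j) ^ 2

/-- `u` has weak gradient `g` on `Ω`: both are locally integrable on `Ω` and the
integration-by-parts identity holds against every smooth compactly supported test
function with support in `Ω`. -/
def HasWeakGradient (n p : ℕ) (Ω : Set (EuclideanSpace ℝ (Fin n)))
    (u : EuclideanSpace ℝ (Fin n) → EuclideanSpace ℝ (Fin p))
    (g : EuclideanSpace ℝ (Fin n) →
      (EuclideanSpace ℝ (Fin n) →L[ℝ] EuclideanSpace ℝ (Fin p))) : Prop :=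
  LocallyIntegrableOn u Ω volume ∧ LocallyIntegrableOn g Ω volume ∧
  ∀ φ : EuclideanSpace ℝ (Fin n) → ℝ, ContDiff ℝ (⊤ : ℕ∞) φ → HasCompactSupport φ →
    tsupport φ ⊆ Ω → ∀ i : Fin n, ∀ j : Fin p,
      ∫ x in Ω, u x j * fderiv ℝ φ x (EuclideanSpace.single i 1) =
        - ∫ x in Ω, φ x * g x (EuclideanSpace.single i 1) j

/-- `u : Ω → ℝᵖ` is an energy minimizing map into the unit sphere `S^(p-1)` with weak
gradient `g`: `u` has weak gradient `g` with locally integrable energy density,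
`‖u‖ = 1` a.e. on `Ω`, and `u` minimizes energy in every ball `B_ρ(y)` with closure in
`Ω` among sphere-valued competitors `w` agreeing with `u` a.e. outside a smaller
concentric ball. -/
def IsEnergyMinimizingToSphere (n p : ℕ) (Ω : Set (EuclideanSpace ℝ (Fin n)))
    (u : EuclideanSpace ℝ (Fin n) → EuclideanSpace ℝ (Fin p))
    (g : EuclideanSpace ℝ (Fin n) →
      (EuclideanSpace ℝ (Fin n) →L[ℝ] EuclideanSpace ℝ (Fin p))) : Prop :=
  HasWeakGradient n p Ω u g ∧
  LocallyIntegrableOn (energyDensity n p g) Ω volume ∧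
  (∀ᵐ x ∂volume.restrict Ω, ‖u x‖ = 1) ∧
  ∀ (y : EuclideanSpace ℝ (Fin n)) (ρ : ℝ), 0 < ρ → closedBall y ρ ⊆ Ω →
    ∀ (w : EuclideanSpace ℝ (Fin n) → EuclideanSpace ℝ (Fin p))
      (h : EuclideanSpace ℝ (Fin n) →
        (EuclideanSpace ℝ (Fin n) →L[ℝ] EuclideanSpace ℝ (Fin p))),
      HasWeakGradient n p Ω w h →
      LocallyIntegrableOn (energyDensity n p h) Ω volume →
      (∀ᵐ x ∂volume.restrict Ω, ‖w x‖ = 1) →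
      (∃ σ : ℝ, σ < ρ ∧ ∀ᵐ x ∂volume.restrict (Ω \ ball y σ), w x = u x) →
      ∫ x in ball y ρ, energyDensity n p g x ≤ ∫ x in ball y ρ, energyDensity n p h x

/-- The regular set of `u`: points of `Ω` having an open neighborhood (inside `Ω`) on
which `u` agrees almost everywhere with a `C^∞` map. -/
def regSet (n p : ℕ) (Ω : Set (EuclideanSpace ℝ (Fin n)))
    (u : EuclideanSpace ℝ (Fin n) → EuclideanSpace ℝ (Fin p)) :
    Set (EuclideanSpace ℝ (Fin n)) :=
  {x | x ∈ Ω ∧ ∃ V : Set (EuclideanSpace ℝ (Fin n)), IsOpen V ∧ x ∈ V ∧ V ⊆ Ω ∧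
    ∃ v : EuclideanSpace ℝ (Fin n) → EuclideanSpace ℝ (Fin p),
      ContDiffOn ℝ (⊤ : ℕ∞) v V ∧ ∀ᵐ z ∂volume.restrict V, u z = v z}

noncomputable section

/-- Laplacian of a scalar function. -/
def lap {n : ℕ} (φ : EuclideanSpace ℝ (Fin n) → ℝ) (x : EuclideanSpace ℝ (Fin n)) : ℝ :=
  ∑ i : Fin n, fderiv ℝ (fun y => fderiv ℝ φ y (EuclideanSpace.single i 1)) x
    (EuclideanSpace.single i 1)

lemma smooth_rpow_mul (a c : ℝ) (hc : 0 < c) (f : ℝ → ℝ) (hf : ContDiff ℝ (⊤ : ℕ∞) f)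
    (h0 : ∀ t ≤ c, f t = 0) : ContDiff ℝ (⊤ : ℕ∞) (fun t : ℝ => t ^ a * f t) := by
  rw [contDiff_iff_contDiffAt]
  intro t
  rcases lt_or_ge t c with h | h
  · have : (fun t : ℝ => t ^ a * f t) =ᶠ[nhds t] fun _ => 0 := by
      filter_upwards [Iio_mem_nhds h] with s hs
      simp [h0 s (le_of_lt hs)]
    exact contDiffAt_const.congr_of_eventuallyEq this
  · have ht : t ≠ 0 := by linarith
    exact (Real.contDiffAt_rpow_const_of_ne ht).mul hf.contDiffAt

/-- cutoff on the line -/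
def kap (t : ℝ) : ℝ := Real.smoothTransition (2 * t - 1)

lemma kap_smooth : ContDiff ℝ (⊤ : ℕ∞) kap :=
  Real.smoothTransition.contDiff.comp (by fun_prop)
lemma kap_zero {t : ℝ} (h : t ≤ 1 / 2) : kap t = 0 :=
  Real.smoothTransition.zero_of_nonpos (by linarith)
lemma kap_one {t : ℝ} (h : 1 ≤ t) : kap t = 1 :=
  Real.smoothTransition.one_of_one_le (by linarith)
lemma kap_mono : Monotone kap := fun a b h =>
  Real.smoothTransition.monotone (by linarith)
lemma kap'_smooth : ContDiff ℝ (⊤ : ℕ∞) (deriv kap) :=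
  (contDiff_infty_iff_deriv.1 kap_smooth).2
lemma kap'_nonneg (t : ℝ) : 0 ≤ deriv kap t := kap_mono.deriv_nonneg
lemma kap'_zero_left {t : ℝ} (h : t ≤ 1 / 2) : deriv kap t = 0 := by
  have hc : IsClosed {t | deriv kap t = 0} := isClosed_eq kap'_smooth.continuous continuous_const
  have : Iio (1/2 : ℝ) ⊆ {t | deriv kap t = 0} := fun s hs => by
    have : kap =ᶠ[nhds s] fun _ => 0 := by
      filter_upwards [Iio_mem_nhds hs] with r hr using kap_zero (le_of_lt hr)
    simp [this.deriv_eq]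
  have h2 := hc.closure_subset_iff.2 this
  rw [closure_Iio] at h2
  exact h2 h
lemma kap'_zero_right {t : ℝ} (h : 1 ≤ t) : deriv kap t = 0 := by
  have hc : IsClosed {t | deriv kap t = 0} := isClosed_eq kap'_smooth.continuous continuous_const
  have : Ioi (1 : ℝ) ⊆ {t | deriv kap t = 0} := fun s hs => by
    have : kap =ᶠ[nhds s] fun _ => 1 := by
      filter_upwards [Ioi_mem_nhds hs] with r hr using kap_one (le_of_lt hr)
    simp [this.deriv_eq]
  have h2 := hc.closure_subset_iff.2 this
  rw [closure_Ioi] at h2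
  exact h2 h

lemma kernel_exists (n : ℕ) (hn : 1 ≤ n) : ∃ ψ Γ : EuclideanSpace ℝ (Fin n) → ℝ,
    ContDiff ℝ (⊤ : ℕ∞) ψ ∧ ContDiff ℝ (⊤ : ℕ∞) Γ ∧
    (∀ z, 1 ≤ ‖z‖ → ψ z = 0) ∧ (∀ z, 1 ≤ ‖z‖ → Γ z = 0) ∧ (∀ z, 0 ≤ ψ z) ∧
    (∫ z, ψ z = 1) ∧ (∀ z, lap Γ z = 2 ^ n * ψ ((2 : ℝ) • z) - ψ z) := by
  set m : ℝ → ℝ := fun t => kap (4 * t) - kap t with hm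
  have hms : ContDiff ℝ (⊤ : ℕ∞) m :=
    (kap_smooth.comp (by fun_prop : ContDiff ℝ (⊤ : ℕ∞) fun t : ℝ => 4 * t)).sub kap_smooth
  have hm0 : ∀ t ≤ 1 / 8, m t = 0 := fun t ht => by
    simp only [hm]; rw [kap_zero (by linarith), kap_zero (by linarith)]; simp
  set q : ℝ → ℝ := fun t => t ^ (-(n : ℝ) / 2) * m t with hq
  have hqs : ContDiff ℝ (⊤ : ℕ∞) q := smooth_rpow_mul _ (1/8) (by norm_num) m hms hm0
  set γ : ℝ → ℝ := fun t => ∫ s in (1 : ℝ)..t, q s with hγ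
  have hγd : ∀ t, HasDerivAt γ (q t) t := fun t =>
    intervalIntegral.integral_hasDerivAt_right (hqs.continuous.intervalIntegrable _ _)
      (hqs.continuous.stronglyMeasurableAtFilter _ _) hqs.continuous.continuousAt
  have hγs : ContDiff ℝ (⊤ : ℕ∞) γ := by
    rw [contDiff_infty_iff_deriv]
    refine ⟨fun t => (hγd t).differentiableAt, ?_⟩
    have : deriv γ = q := funext fun t => (hγd t).deriv
    rw [this]; exact hqs
  have hγ0 : ∀ t, 1 ≤ t → γ t = 0 := fun t ht => by
    simp only [hγ]
    rw [intervalIntegral.integral_congr (g := fun _ => 0)]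
    · simp
    · intro s hs
      rw [uIcc_of_le ht] at hs
      simp only [hq, hm]; rw [kap_one hs.1, kap_one (by linarith [hs.1])]; simp
  set j : ℝ → ℝ := fun t => t ^ (1 - (n : ℝ) / 2) * (4 * deriv kap t) with hj
  have hjs : ContDiff ℝ (⊤ : ℕ∞) j := smooth_rpow_mul _ (1/2) (by norm_num) _
    (contDiff_const.mul kap'_smooth) (fun t ht => by simp [kap'_zero_left ht])
  have hns : ContDiff ℝ (⊤ : ℕ∞) (fun z : EuclideanSpace ℝ (Fin n) => ‖z‖ ^ 2) :=
    contDiff_norm_sq ℝ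
  set ψ0 : EuclideanSpace ℝ (Fin n) → ℝ := fun z => j (‖z‖ ^ 2) with hψ0
  have hψs : ContDiff ℝ (⊤ : ℕ∞) ψ0 := hjs.comp hns
  have hψnn : ∀ z, 0 ≤ ψ0 z := fun z => by
    have := kap'_nonneg (‖z‖ ^ 2)
    simp only [hψ0, hj]; positivity
  have hψ0' : ∀ z, 1 ≤ ‖z‖ → ψ0 z = 0 := fun z hz => by
    simp only [hψ0, hj]; rw [kap'_zero_right (by nlinarith)]; simp
  have hcs : HasCompactSupport ψ0 := by
    apply HasCompactSupport.of_support_subset_isCompact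
      (isCompact_closedBall (0 : EuclideanSpace ℝ (Fin n)) 1)
    intro z hz
    by_contra h
    exact hz (hψ0' z (by simp at h; linarith))
  have hpos : 0 < ∫ z, ψ0 z := by
    obtain ⟨t, ht, ht'⟩ := exists_deriv_eq_slope kap (by norm_num : (1/2 : ℝ) < 1)
      kap_smooth.continuous.continuousOn ((kap_smooth.differentiable (by simp)).differentiableOn)
    have : deriv kap t = 2 := by
      rw [ht', kap_one le_rfl, kap_zero le_rfl]; norm_num
    refine hψs.continuous.integral_pos_of_hasCompactSupport_nonneg_nonzero hcs hψnn
      (x := EuclideanSpace.single (⟨0, hn⟩ : Fin n) (Real.sqrt t)) ?_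
    have h0 : 0 < t := by linarith [ht.1]
    simp only [hψ0, hj, EuclideanSpace.norm_single, Real.norm_eq_abs, sq_abs,
      Real.sq_sqrt h0.le, this]
    positivity
  set c := ∫ z, ψ0 z with hc
  have hΓd : ∀ z : EuclideanSpace ℝ (Fin n), HasFDerivAt (fun z => c⁻¹ * γ (‖z‖ ^ 2))
      (c⁻¹ • (q (‖z‖ ^ 2) • (2 • innerSL ℝ z))) z := fun z => by
    have := (hγd (‖z‖ ^ 2)).comp_hasFDerivAt z (hasStrictFDerivAt_norm_sq z).hasFDerivAt
    exact this.const_mul c⁻¹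
  refine ⟨fun z => c⁻¹ * ψ0 z, fun z => c⁻¹ * γ (‖z‖ ^ 2), contDiff_const.mul hψs,
    contDiff_const.mul (hγs.comp hns), fun z hz => by simp [hψ0' z hz],
    fun z hz => by simp only []; rw [hγ0 _ (by nlinarith)]; simp, fun z => mul_nonneg (by positivity) (hψnn z),
    by rw [integral_const_mul]; field_simp; rfl, fun z => ?_⟩
  have h1 : ∀ i : Fin n, (fun y => fderiv ℝ (fun z => c⁻¹ * γ (‖z‖ ^ 2)) y
      (EuclideanSpace.single i 1)) = fun y => c⁻¹ * (q (‖y‖ ^ 2) * (2 * y i)) := fun i => by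
    funext y
    rw [(hΓd y).fderiv]
    simp [EuclideanSpace.inner_single_right]
  have h2 : ∀ i : Fin n, fderiv ℝ (fun y : EuclideanSpace ℝ (Fin n) =>
      c⁻¹ * (q (‖y‖ ^ 2) * (2 * y i))) z (EuclideanSpace.single i 1) =
      c⁻¹ * (4 * deriv q (‖z‖ ^ 2) * (z i) ^ 2 + 2 * q (‖z‖ ^ 2)) := fun i => by
    have hd := ((hqs.differentiable (by simp)) (‖z‖ ^ 2)).hasDerivAt.comp_hasFDerivAt z
      (hasStrictFDerivAt_norm_sq z).hasFDerivAt
    have hl : HasFDerivAt (fun y : EuclideanSpace ℝ (Fin n) => 2 * y i)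
        ((2 : ℝ) • (EuclideanSpace.proj i : EuclideanSpace ℝ (Fin n) →L[ℝ] ℝ)) z :=
      ((EuclideanSpace.proj i : EuclideanSpace ℝ (Fin n) →L[ℝ] ℝ).hasFDerivAt).const_mul 2
    have := (hd.mul hl).const_mul c⁻¹
    erw [this.fderiv]
    simp [EuclideanSpace.inner_single_right]
    ring_nf
  have h3 : lap (fun z => c⁻¹ * γ (‖z‖ ^ 2)) z =
      c⁻¹ * (4 * ‖z‖ ^ 2 * deriv q (‖z‖ ^ 2) + 2 * n * q (‖z‖ ^ 2)) := by
    simp only [lap]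
    simp_rw [h1, h2]
    rw [← Finset.mul_sum, Finset.sum_add_distrib, ← Finset.mul_sum, ← EuclideanSpace.real_norm_sq_eq]
    simp
    ring_nf
    simp
  rw [h3]
  simp only [hψ0]
  rw [norm_smul, Real.norm_eq_abs, abs_of_pos (by norm_num : (0 : ℝ) < 2), mul_pow]
  have ht : 0 ≤ ‖z‖ ^ 2 := by positivity
  generalize ‖z‖ ^ 2 = t at ht
  have key : 4 * t * deriv q t + 2 * n * q t = 2 ^ n * j (2 ^ 2 * t) - j t := by
    rcases ht.eq_or_lt with h | h
    · subst h
      simp [hq, hj, kap'_zero_left, hm0 0 (by norm_num)]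
    · have hdm : HasDerivAt m (4 * deriv kap (4 * t) - deriv kap t) t := by
        have ha := ((kap_smooth.differentiable (by simp)) (4 * t)).hasDerivAt
        have hb : HasDerivAt (fun t : ℝ => 4 * t) 4 t := by
          simpa using (hasDerivAt_id t).const_mul 4
        have := (ha.comp t hb).sub ((kap_smooth.differentiable (by simp)) t).hasDerivAt
        exact this.congr_deriv (by ring)
      have hdq := ((Real.hasDerivAt_rpow_const (x := t) (p := -(n : ℝ) / 2) (Or.inl h.ne'))).mul hdm
      have hdq' : deriv q t = _ := hdq.deriv
      rw [hdq']
      simp only [hq, hj]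
      have e1 : t ^ (1 - (n : ℝ) / 2) = t * t ^ (-(n : ℝ) / 2) := by
        rw [sub_eq_add_neg, Real.rpow_add h, Real.rpow_one, neg_div]
      have e2 : t ^ (-(n : ℝ) / 2) = t * t ^ (-(n : ℝ) / 2 - 1) := by
        rw [Real.rpow_sub_one h.ne']; field_simp
      have e3 : ((2 : ℝ) ^ 2 * t) ^ (1 - (n : ℝ) / 2) = 4 * (2 ^ n)⁻¹ * t ^ (1 - (n : ℝ) / 2) := by
        rw [Real.mul_rpow (by norm_num) h.le]
        congr 1
        rw [← Real.rpow_natCast 2 2, ← Real.rpow_mul (by norm_num)]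
        have : ((2 : ℕ) : ℝ) * (1 - (n : ℝ) / 2) = 2 - n := by push_cast; ring
        rw [this, Real.rpow_sub (by norm_num), Real.rpow_natCast]
        norm_num
        rfl
      rw [e3, e1]
      have e4 : (2 : ℝ) ^ 2 = 4 := by norm_num
      have e5 : (2 : ℝ) ^ n * (2 ^ n)⁻¹ = 1 := by field_simp
      rw [e4]
      have e6 : t ^ (-(n : ℝ) / 2 - 1) * t = t ^ (-(n : ℝ) / 2) := by rw [e2]; ring
      linear_combination (-2 * n * m t) * e6 -
        16 * t * t ^ (-(n : ℝ) / 2) * deriv kap (4 * t) * e5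
  rw [key]; ring
end

noncomputable section

/-- Kernel pair. -/
structure KerPair (n : ℕ) (ψ Γ : EuclideanSpace ℝ (Fin n) → ℝ) : Prop where
  sψ : ContDiff ℝ (⊤ : ℕ∞) ψ
  sΓ : ContDiff ℝ (⊤ : ℕ∞) Γ
  zψ : ∀ z, 1 ≤ ‖z‖ → ψ z = 0
  zΓ : ∀ z, 1 ≤ ‖z‖ → Γ z = 0
  pos : ∀ z, 0 ≤ ψ z
  one : ∫ z, ψ z = 1
  lapΓ : ∀ z, lap Γ z = 2 ^ n * ψ ((2 : ℝ) • z) - ψ z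

section
variable {n : ℕ}
local notation "E" => EuclideanSpace ℝ (Fin n)
variable {V : Type*} [NormedAddCommGroup V] [NormedSpace ℝ V]

lemma hcs_of_zero {W : Type*} [Zero W] {f : E → W} (h : ∀ z, 1 ≤ ‖z‖ → f z = 0) :
    HasCompactSupport f := by
  refine HasCompactSupport.intro' (isCompact_closedBall (0 : E) 1) isClosed_closedBall ?_
  intro z hz
  simp at hz
  exact h z hz.le

lemma vol_preimage_le (F : E → E) (hF : AntilipschitzWith 2 F) (s : Set E) :
    volume (F ⁻¹' s) ≤ 2 ^ n * volume s := by
  have h := hF.hausdorffMeasure_preimage_le (d := (n : ℝ)) (by positivity) s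
  have hH : (μH[(n : ℝ)] : Measure E).IsAddHaarMeasure := by
    have : (μH[(Module.finrank ℝ E : ℝ)] : Measure E).IsAddHaarMeasure :=
      MeasureTheory.isAddHaarMeasure_hausdorffMeasure
    simpa using this
  have hv : (volume : Measure E) =
      (volume : Measure E).addHaarScalarFactor (μH[(n : ℝ)] : Measure E) • μH[(n : ℝ)] :=
    Measure.isAddLeftInvariant_eq_smul _ _
  rw [hv]
  simp only [Measure.smul_apply]
  refine (mul_le_mul_right h _).trans_eq ?_
  simp only [ENNReal.smul_def, smul_eq_mul, ENNReal.rpow_natCast, ENNReal.coe_ofNat]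
  ring

lemma map_le (F : E → E) (hc : Measurable F) (hF : AntilipschitzWith 2 F) :
    Measure.map F volume ≤ (2 ^ n : ENNReal) • (volume : Measure E) := by
  refine Measure.le_iff.2 fun s hs => ?_
  rw [Measure.map_apply hc hs]
  exact vol_preimage_le F hF s

lemma lintegral_comp_le (F : E → E) (hc : Measurable F) (hF : AntilipschitzWith 2 F)
    (k : E → ENNReal) (hk : AEMeasurable k) : ∫⁻ x, k (F x) ≤ 2 ^ n * ∫⁻ x, k x := by
  have hac : Measure.map F volume ≪ (volume : Measure E) :=
    (Measure.absolutelyContinuous_of_le (map_le F hc hF)).trans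
      Measure.smul_absolutelyContinuous
  rw [← lintegral_map' (hk.mono_ac hac) hc.aemeasurable]
  refine (lintegral_mono' (map_le F hc hF) le_rfl).trans_eq ?_
  simp

lemma qmp_of_anti (F : E → E) (hc : Measurable F) (hF : AntilipschitzWith 2 F) :
    Measure.QuasiMeasurePreserving F volume volume :=
  ⟨hc, (Measure.absolutelyContinuous_of_le (map_le F hc hF)).trans
      Measure.smul_absolutelyContinuous⟩

lemma integrable_comp_anti {F : E → E} (hc : Measurable F) (hF : AntilipschitzWith 2 F)
    {u : E → V} (hu : Integrable u) :
    Integrable (fun x => u (F x)) ∧ ∫ x, ‖u (F x)‖ ≤ 2 ^ n * ∫ x, ‖u x‖ := by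
  have hq := qmp_of_anti F hc hF
  have hm : AEStronglyMeasurable (fun x => u (F x)) :=
    hu.1.comp_quasiMeasurePreserving hq
  have hl := lintegral_comp_le F hc hF (fun x => ‖u x‖ₑ) hu.1.enorm
  have hfin : ∫⁻ x, ‖u x‖ₑ < ⊤ := hu.2
  refine ⟨⟨hm, lt_of_le_of_lt hl (ENNReal.mul_lt_top (by simp) hfin)⟩, ?_⟩
  rw [integral_norm_eq_lintegral_enorm hm, integral_norm_eq_lintegral_enorm hu.1]
  have h2 : (2 : ℝ) ^ n = ((2 : ENNReal) ^ n).toReal := by simp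
  rw [h2, ← ENNReal.toReal_mul]
  exact ENNReal.toReal_mono (ENNReal.mul_lt_top (by simp) hfin).ne hl

/-- variable scale mollification -/
def vmol (ψ : E → ℝ) (τ : E → ℝ) (u : E → V) (x : E) : V := ∫ z, ψ z • u (x - τ x • z)

lemma anti_of_lip {τ : E → ℝ} (hτ : LipschitzWith (1/2) τ) {z : E} (hz : ‖z‖ ≤ 1) :
    AntilipschitzWith 2 (fun x => x - τ x • z) := by
  refine AntilipschitzWith.of_le_mul_dist fun x y => ?_
  have h1 := hτ.dist_le_mul x y
  rw [dist_eq_norm, dist_eq_norm] at *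
  have e : x - y = (x - τ x • z - (y - τ y • z)) + (τ x - τ y) • z := by
    rw [sub_smul]; abel
  have h2 : ‖x - y‖ ≤ ‖x - τ x • z - (y - τ y • z)‖ + ‖(τ x - τ y) • z‖ := by
    conv_lhs => rw [e]
    exact norm_add_le _ _
  rw [norm_smul] at h2
  have h3 : ‖τ x - τ y‖ * ‖z‖ ≤ ‖τ x - τ y‖ * 1 := by gcongr
  have : ((1/2 : NNReal) : ℝ) = 1/2 := by norm_num
  rw [this] at h1
  have h4 : ((2 : NNReal) : ℝ) = 2 := by norm_num
  rw [h4]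
  linarith

lemma vmol_qmp {τ : E → ℝ} (hτ : LipschitzWith (1/2) τ) :
    Measure.QuasiMeasurePreserving (fun q : E × E => q.1 - τ q.1 • q.2)
      ((volume : Measure E).prod (volume.restrict (ball (0 : E) 1))) volume := by
  have hc : Continuous (fun q : E × E => q.1 - τ q.1 • q.2) := by
    have := hτ.continuous; fun_prop
  refine ⟨hc.measurable, Measure.AbsolutelyContinuous.mk fun s hs h0 => ?_⟩
  rw [Measure.map_apply hc.measurable hs, Measure.prod_apply_symm (hc.measurable hs)]
  rw [lintegral_eq_zero_iff' (measurable_measure_prodMk_right (hc.measurable hs)).aemeasurable]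
  filter_upwards [ae_restrict_mem measurableSet_ball] with z hz
  have := vol_preimage_le _ (anti_of_lip hτ (z := z) (by simpa using (mem_ball_zero_iff.1 hz).le)) s
  rw [h0, mul_zero] at this
  exact nonpos_iff_eq_zero.1 this

lemma vmol_prod {ψ τ : E → ℝ} (hψ : Continuous ψ) (hψ0 : ∀ z, 1 ≤ ‖z‖ → ψ z = 0)
    (hτ : LipschitzWith (1/2) τ) {u : E → V} (hu : Integrable u) :
    Integrable (fun q : E × E => ψ q.2 • u (q.1 - τ q.1 • q.2))
      ((volume : Measure E).prod volume) ∧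
    ∫ x, ∫ z, ‖ψ z • u (x - τ x • z)‖ ≤ (∫ z, ‖ψ z‖) * (2 ^ n * ∫ x, ‖u x‖) := by
  have hψi : Integrable ψ := hψ.integrable_of_hasCompactSupport (hcs_of_zero hψ0)
  have hm : AEStronglyMeasurable (fun q : E × E => ψ q.2 • u (q.1 - τ q.1 • q.2))
      ((volume : Measure E).prod volume) := by
    have h1 : AEStronglyMeasurable (fun q : E × E => ψ q.2 • u (q.1 - τ q.1 • q.2))
      ((volume : Measure E).prod (volume.restrict (ball (0 : E) 1))) :=
      (hψ.comp continuous_snd).aestronglyMeasurable.smul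
        (hu.1.comp_quasiMeasurePreserving (vmol_qmp hτ))
    have e : (volume : Measure E).prod (volume.restrict (ball (0 : E) 1)) =
        ((volume : Measure E).prod volume).restrict (univ ×ˢ ball (0 : E) 1) := by
      rw [← Measure.prod_restrict, Measure.restrict_univ]
    rw [e] at h1
    have hms : MeasurableSet ((univ : Set E) ×ˢ ball (0 : E) 1) :=
      MeasurableSet.univ.prod measurableSet_ball
    have h2 := (aestronglyMeasurable_indicator_iff hms).2 h1
    convert h2 using 1
    funext q
    by_cases hq : q ∈ (univ : Set E) ×ˢ ball (0 : E) 1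
    · simp [indicator_of_mem hq]
    · rw [indicator_of_notMem hq]
      rw [hψ0 q.2 (by simpa using hq), zero_smul]
  have hz : ∀ z, Integrable (fun x => ψ z • u (x - τ x • z)) ∧
      ∫ x, ‖ψ z • u (x - τ x • z)‖ ≤ ‖ψ z‖ * (2 ^ n * ∫ x, ‖u x‖) := fun z => by
    by_cases h : 1 ≤ ‖z‖
    · simp [hψ0 z h]
    · have hc : Continuous (fun x => x - τ x • z) := by have := hτ.continuous; fun_prop
      have := integrable_comp_anti hc.measurable (anti_of_lip hτ (z := z) (by linarith)) hu
      refine ⟨this.1.smul _, ?_⟩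
      simp_rw [norm_smul]
      rw [integral_const_mul]
      gcongr
      exact this.2
  have hint : Integrable (fun q : E × E => ψ q.2 • u (q.1 - τ q.1 • q.2))
      ((volume : Measure E).prod volume) := by
    rw [integrable_prod_iff' hm]
    refine ⟨Eventually.of_forall fun z => (hz z).1, ?_⟩
    refine (hψi.norm.mul_const (2 ^ n * ∫ x, ‖u x‖)).mono' hm.norm.prod_swap.integral_prod_right' ?_
    refine Eventually.of_forall fun z => ?_
    rw [Real.norm_of_nonneg (by positivity)]
    exact (hz z).2
  refine ⟨hint, ?_⟩
  have := integral_integral_swap (f := fun x z => ‖ψ z • u (x - τ x • z)‖) hint.norm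
  rw [this, ← integral_mul_const]
  exact integral_mono hint.norm.integral_prod_right (hψi.norm.mul_const _) fun z => (hz z).2

lemma vmol_integrable {ψ τ : E → ℝ} (hψ : Continuous ψ) (hψ0 : ∀ z, 1 ≤ ‖z‖ → ψ z = 0)
    (hτ : LipschitzWith (1/2) τ) {u : E → V} (hu : Integrable u) :
    Integrable (vmol ψ τ u) ∧
    ∫ x, ‖vmol ψ τ u x‖ ≤ (∫ z, ‖ψ z‖) * (2 ^ n * ∫ x, ‖u x‖) := by
  have h := vmol_prod hψ hψ0 hτ hu
  refine ⟨h.1.integral_prod_left, le_trans ?_ h.2⟩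
  exact integral_mono h.1.integral_prod_left.norm h.1.norm.integral_prod_left fun x =>
    norm_integral_le_integral_norm _

/-- constant scale mollification -/
abbrev mol (ψ : E → ℝ) (s : ℝ) (u : E → V) (x : E) : V := vmol ψ (fun _ => s) u x

lemma lipc (s : ℝ) : LipschitzWith (1/2) (fun _ : E => s) := LipschitzWith.const' s

lemma KerPair.int {ψ Γ : E → ℝ} (K : KerPair n ψ Γ) : Integrable ψ :=
  K.sψ.continuous.integrable_of_hasCompactSupport (hcs_of_zero K.zψ)

lemma KerPair.one' {ψ Γ : E → ℝ} (K : KerPair n ψ Γ) : ∫ z, ‖ψ z‖ = 1 := by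
  rw [← K.one]; congr 1; funext z; exact Real.norm_of_nonneg (K.pos z)

lemma mol_sub_le [CompleteSpace V] {ψ Γ : E → ℝ} (K : KerPair n ψ Γ) {u : E → V} {s ε : ℝ} (x : E)
    (hs : 0 ≤ s) (hc : Continuous u)
    (h : ∀ y, dist y x ≤ s → ‖u y - u x‖ ≤ ε) : ‖mol ψ s u x - u x‖ ≤ ε := by
  have e1 : u x = ∫ z, ψ z • u x := by rw [integral_smul_const, K.one, one_smul]
  have e2 : mol ψ s u x - u x = ∫ z, ψ z • (u (x - s • z) - u x) := by
    conv_lhs => rw [e1]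
    rw [mol, vmol, ← integral_sub]
    · simp_rw [smul_sub]
    · have : Continuous (fun z => ψ z • u (x - s • z)) := by
        have := K.sψ.continuous; fun_prop
      exact this.integrable_of_hasCompactSupport
        (HasCompactSupport.smul_right (hcs_of_zero K.zψ))
    · exact K.int.smul_const _
  rw [e2]
  refine (norm_integral_le_of_norm_le (K.int.mul_const ε) (Eventually.of_forall fun z => ?_)).trans_eq ?_
  · rw [norm_smul, Real.norm_of_nonneg (K.pos z)]
    by_cases hz : 1 ≤ ‖z‖
    · simp [K.zψ z hz]
    · refine mul_le_mul_of_nonneg_left (h _ ?_) (K.pos z)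
      rw [dist_eq_norm, sub_sub_cancel_left, norm_neg, norm_smul, Real.norm_of_nonneg hs]
      push Not at hz
      nlinarith
  · rw [integral_mul_const, K.one, one_mul]

lemma mol_tendsto [CompleteSpace V] {ψ Γ : E → ℝ} (K : KerPair n ψ Γ) {u : E → V} (hu : Integrable u)
    {ε : ℝ} (hε : 0 < ε) :
    ∃ δ > 0, ∀ s, 0 < s → s < δ → ∫ x, ‖mol ψ s u x - u x‖ ≤ ε := by
  set c : ℝ := 2 ^ n + 2 with hc
  have hcp : 0 < c := by positivity
  obtain ⟨h, hcs, hh, hcont, hint⟩ :=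
    hu.exists_hasCompactSupport_integral_sub_le (ε := ε / c) (by positivity)
  set S := cthickening 1 (tsupport h) with hS
  have hSc : IsCompact S := hcs.isCompact.cthickening
  set M := volume.real S with hM
  obtain ⟨δ, hδ, hδ'⟩ := Metric.uniformContinuous_iff.1
    (hcont.uniformContinuous_of_tendsto_cocompact hcs.is_zero_at_infty) (ε / c / (M + 1)) (by positivity)
  refine ⟨min δ 1, by positivity, fun s hs hsδ => ?_⟩
  have hs1 : s < 1 := hsδ.trans_le (min_le_right _ _)
  have hsd : s < δ := hsδ.trans_le (min_le_left _ _)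
  have hb : ∀ x, ‖mol ψ s h x - h x‖ ≤ S.indicator (fun _ => ε / c / (M + 1)) x := fun x => by
    by_cases hx : x ∈ S
    · rw [indicator_of_mem hx]
      refine mol_sub_le K x hs.le hcont fun y hy => ?_
      have := hδ' (a := y) (b := x) (by linarith)
      rw [dist_eq_norm] at this; exact this.le
    · rw [indicator_of_notMem hx]
      refine mol_sub_le K x hs.le hcont fun y hy => ?_
      have h0 : ∀ y, dist y x ≤ s → h y = 0 := fun y hy => by
        by_contra hne
        exact hx (mem_cthickening_of_dist_le x y 1 _ (subset_tsupport _ hne)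
          (by rw [dist_comm]; linarith))
      rw [h0 y hy, h0 x (by simp [hs.le])]; simp
  have hfh : Integrable (fun x => u x - h x) := hu.sub hint
  have hm : mol ψ s (fun x => u x - h x) =ᵐ[volume] fun x => mol ψ s u x - mol ψ s h x := by
    have h1 := (vmol_prod K.sψ.continuous K.zψ (lipc s) hu).1.prod_right_ae
    have h2 := (vmol_prod K.sψ.continuous K.zψ (lipc s) hint).1.prod_right_ae
    filter_upwards [h1, h2] with x h1 h2
    rw [mol, vmol, mol, vmol, mol, vmol, ← integral_sub h1 h2]
    simp_rw [smul_sub]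
  have I1 := vmol_integrable K.sψ.continuous K.zψ (lipc s) hfh
  have I2 := vmol_integrable K.sψ.continuous K.zψ (lipc s) hint
  rw [K.one', one_mul] at I1
  have i2 : Integrable (S.indicator (fun _ => ε / c / (M + 1))) :=
    (integrable_indicator_iff hSc.measurableSet).2
      (integrableOn_const hSc.measure_lt_top.ne)
  calc ∫ x, ‖mol ψ s u x - u x‖
      ≤ ∫ x, (‖mol ψ s (fun x => u x - h x) x‖ + S.indicator (fun _ => ε / c / (M + 1)) x
          + ‖u x - h x‖) := by
        refine integral_mono_ae ((vmol_integrable K.sψ.continuous K.zψ (lipc s) hu).1.sub hu).norm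
          ((I1.1.norm.add i2).add hfh.norm) ?_
        filter_upwards [hm] with x hx
        have := hb x
        have e : mol ψ s u x - u x = mol ψ s (fun x => u x - h x) x + (mol ψ s h x - h x)
            - (u x - h x) := by rw [hx]; abel
        rw [e]
        refine (norm_sub_le _ _).trans ?_
        gcongr
        exact (norm_add_le _ _).trans (by gcongr)
    _ = (∫ x, ‖mol ψ s (fun x => u x - h x) x‖) + M * (ε / c / (M + 1)) + ∫ x, ‖u x - h x‖ := by
        have i3 : Integrable (fun x => ‖mol ψ s (fun x => u x - h x) x‖ +
            S.indicator (fun _ => ε / c / (M + 1)) x) := I1.1.norm.add i2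
        rw [integral_add i3 hfh.norm, integral_add I1.1.norm i2,
          integral_indicator hSc.measurableSet, setIntegral_const, smul_eq_mul]
    _ ≤ 2 ^ n * (ε / c) + ε / c + ε / c := by
        have h1 : M * (ε / c / (M + 1)) ≤ ε / c := by
          rw [mul_div_assoc']
          rw [div_le_iff₀ (by positivity)]
          have : 0 ≤ ε / c := by positivity
          nlinarith
        have h2 := I1.2
        have h3 : (2 : ℝ) ^ n * ∫ x, ‖u x - h x‖ ≤ 2 ^ n * (ε / c) := by gcongr
        linarith
    _ = ε := by rw [hc]; field_simp; ring
end
end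

noncomputable section
section
variable {n : ℕ}
local notation "E" => EuclideanSpace ℝ (Fin n)
variable {V W X : Type*} [NormedAddCommGroup V] [NormedSpace ℝ V] [NormedAddCommGroup W]
  [NormedSpace ℝ W] [NormedAddCommGroup X] [NormedSpace ℝ X]

/-- mollification with general kernel -/
def gmol (B : W →L[ℝ] V →L[ℝ] X) (K : E → W) (s : ℝ) (u : E → V) (x : E) : X :=
  ∫ z, B (K z) (u (x - s • z))

lemma integral_affine (Φ : E → X) (x : E) {s : ℝ} (hs : 0 < s) :
    ∫ z, Φ (x - s • z) = (s ^ n)⁻¹ • ∫ y, Φ y := by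
  have h := Measure.integral_comp_smul (volume : Measure E) (fun y => Φ (x - y)) s
  rw [integral_sub_left_eq_self] at h
  rw [h, finrank_euclideanSpace_fin, abs_of_pos (by positivity)]

lemma gmol_eq (B : W →L[ℝ] V →L[ℝ] X) (K : E → W) {s : ℝ} (hs : 0 < s) (u : E → V) (x : E) :
    gmol B K s u x = (s ^ n)⁻¹ • ∫ y, B (K (s⁻¹ • (x - y))) (u y) := by
  rw [← integral_affine _ x hs, gmol]
  congr 1; funext z
  rw [sub_sub_cancel, inv_smul_smul₀ hs.ne']

lemma gmol_conv (B : W →L[ℝ] V →L[ℝ] X) (K : E → W) {s : ℝ} (hs : 0 < s) (u : E → V) :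
    gmol B K s u = fun x => (s ^ n)⁻¹ • (convolution (fun z => K (s⁻¹ • z)) u B volume) x := by
  funext x
  rw [convolution_eq_swap, gmol_eq B K hs]

lemma gmol_hasFDerivAt (B : W →L[ℝ] V →L[ℝ] X) {K : E → W} (hK : ContDiff ℝ 1 K)
    (hK0 : ∀ z, 1 ≤ ‖z‖ → K z = 0) {s : ℝ} (hs : 0 < s) {u : E → V}
    (hu : LocallyIntegrable u) (x : E) :
    HasFDerivAt (gmol B K s u) (s⁻¹ • gmol (B.precompL E) (fderiv ℝ K) s u x) x := by
  have hc : HasCompactSupport (fun z => K (s⁻¹ • z)) :=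
    (hcs_of_zero hK0).comp_smul (inv_ne_zero hs.ne')
  have hd : ContDiff ℝ 1 (fun z => K (s⁻¹ • z)) := hK.comp (contDiff_const_smul _)
  have h := (hc.hasFDerivAt_convolution_left B hd hu x).const_smul ((s ^ n)⁻¹)
  rw [gmol_conv B K hs, gmol_conv _ _ hs]
  refine HasFDerivAt.congr_fderiv h ?_
  have : fderiv ℝ (fun z => K (s⁻¹ • z)) = fun z => s⁻¹ • fderiv ℝ K (s⁻¹ • z) := by
    funext z
    exact fderiv_comp_smul ..
  rw [this, smul_comm]
  congr 1
  exact congrFun (smul_convolution (f := fun z => fderiv ℝ K (s⁻¹ • z)) (y := s⁻¹)) x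

lemma fderiv_zero_of {K : E → W} (hK : ContDiff ℝ 1 K)
    (hK0 : ∀ z, 1 ≤ ‖z‖ → K z = 0) (z : E) (hz : 1 ≤ ‖z‖) : fderiv ℝ K z = 0 := by
  have h1 : ∀ z : E, 1 < ‖z‖ → fderiv ℝ K z = 0 := fun z hz => by
    have : K =ᶠ[nhds z] fun _ => 0 := by
      filter_upwards [(isOpen_lt continuous_const continuous_norm).mem_nhds hz] with y hy
      exact hK0 y (le_of_lt hy)
    rw [this.fderiv_eq]; simp
  have hcl : IsClosed {z : E | fderiv ℝ K z = 0} :=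
    isClosed_eq (hK.continuous_fderiv one_ne_zero) continuous_const
  have hz' : z ∈ closure {y : E | 1 < ‖y‖} := by
    have ht : Tendsto (fun t : ℝ => (1 + t) • z) (nhdsWithin 0 (Ioi 0)) (nhds z) := by
      have : Continuous (fun t : ℝ => (1 + t) • z) := by fun_prop
      have h := this.tendsto 0
      simp only [add_zero, one_smul] at h
      exact h.mono_left nhdsWithin_le_nhds
    refine mem_closure_of_tendsto ht ?_
    filter_upwards [self_mem_nhdsWithin] with t (ht : 0 < t)
    change 1 < _
    rw [norm_smul, Real.norm_of_nonneg (by positivity)]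
    nlinarith
  exact hcl.closure_subset_iff.2 (fun y hy => h1 y hy) hz'

lemma gmol_bound (B : W →L[ℝ] V →L[ℝ] X) {K : E → W} {M : ℝ} (hM : ∀ z, ‖K z‖ ≤ M)
    (hK0 : ∀ z, 1 ≤ ‖z‖ → K z = 0) {s : ℝ} (hs : 0 < s) {u : E → V} (x : E)
    (hu : IntegrableOn u (closedBall x s)) :
    ‖gmol B K s u x‖ ≤ ‖B‖ * M * ((s ^ n)⁻¹ * ∫ y in closedBall x s, ‖u y‖) := by
  rw [gmol_eq B K hs, norm_smul, Real.norm_of_nonneg (by positivity)]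
  have hM0 : 0 ≤ M := (norm_nonneg _).trans (hM 0)
  have : ‖∫ y, B (K (s⁻¹ • (x - y))) (u y)‖ ≤ ‖B‖ * M * ∫ y in closedBall x s, ‖u y‖ := by
    rw [← integral_indicator measurableSet_closedBall, ← integral_const_mul]
    refine norm_integral_le_of_norm_le
      (((integrable_indicator_iff measurableSet_closedBall).2 hu.norm).const_mul _)
      (Eventually.of_forall fun y => ?_)
    by_cases hy : y ∈ closedBall x s
    · rw [indicator_of_mem hy]
      refine ((B _).le_opNorm _).trans ?_
      gcongr
      exact (B.le_opNorm _).trans (by gcongr; exact hM _)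
    · rw [indicator_of_notMem hy, hK0]
      · simp
      · rw [norm_smul, Real.norm_of_nonneg (by positivity), ← div_eq_inv_mul, le_div_iff₀ hs]
        rw [mem_closedBall, dist_comm, dist_eq_norm] at hy
        linarith
  calc _ ≤ (s ^ n)⁻¹ * (‖B‖ * M * ∫ y in closedBall x s, ‖u y‖) := by gcongr
    _ = _ := by ring

lemma bdd_of_zero {K : E → W} (hK : Continuous K) (hK0 : ∀ z, 1 ≤ ‖z‖ → K z = 0) :
    ∃ M, 0 ≤ M ∧ ∀ z, ‖K z‖ ≤ M := by
  obtain ⟨M, hM⟩ := (hcs_of_zero hK0).exists_bound_of_continuous hK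
  exact ⟨M, (norm_nonneg _).trans (hM 0), hM⟩

lemma int_ker (B : W →L[ℝ] V →L[ℝ] X) {K : E → W} (hK : Continuous K)
    (hK0 : ∀ z, 1 ≤ ‖z‖ → K z = 0) {s : ℝ} (x : E) {u : E → V} (hu : Integrable u) :
    Integrable (fun y => B (K (s⁻¹ • (x - y))) (u y)) := by
  obtain ⟨M, hM0, hM⟩ := bdd_of_zero hK hK0
  have hcc : Continuous (fun y => K (s⁻¹ • (x - y))) := hK.comp (by fun_prop)
  refine (hu.norm.const_mul (‖B‖ * M)).mono'
    (ContinuousLinearMap.aestronglyMeasurable_comp₂ _ hcc.aestronglyMeasurable hu.1)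
    (Eventually.of_forall fun y => ?_)
  refine (ContinuousLinearMap.le_opNorm₂ _ _ _).trans ?_
  gcongr
  exact hM _

lemma mol_gmol (ψ : E → ℝ) (s : ℝ) (u : E → V) :
    mol ψ s u = gmol (ContinuousLinearMap.lsmul ℝ ℝ) ψ s u := by
  funext x; simp [vmol, gmol]

/-- Global Sobolev functions. -/
structure W1 (u : E → V) (g : E → E →L[ℝ] V) : Prop where
  iu : Integrable u
  ig : Integrable g
  ibp : ∀ φ : E → ℝ, ContDiff ℝ (⊤ : ℕ∞) φ → HasCompactSupport φ → ∀ w : E,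
    ∫ x, fderiv ℝ φ x w • u x = - ∫ x, φ x • g x w

lemma int_smul {φ : E → ℝ} (hφ : Continuous φ) (hc : HasCompactSupport φ) {u : E → V}
    (hu : Integrable u) : Integrable (fun x => φ x • u x) := by
  obtain ⟨M, hM⟩ := hc.exists_bound_of_continuous hφ
  exact hu.bdd_smul M hφ.aestronglyMeasurable (Eventually.of_forall hM)

lemma int_app {g : E → E →L[ℝ] V} (hg : Integrable g) (w : E) : Integrable (fun x => g x w) :=
  (ContinuousLinearMap.apply ℝ V w).integrable_comp hg

lemma fd_cont {φ : E → ℝ} (hφ : ContDiff ℝ (⊤ : ℕ∞) φ) (hc : HasCompactSupport φ) (w : E) :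
    ContDiff ℝ (⊤ : ℕ∞) (fun x => fderiv ℝ φ x w) ∧ HasCompactSupport (fun x => fderiv ℝ φ x w) :=
  ⟨(hφ.fderiv_right (m := (⊤ : ℕ∞)) (by simp)).clm_apply contDiff_const, hc.fderiv_apply ℝ w⟩

lemma int_add {f g : E → V} (hf : Integrable f) (hg : Integrable g) :
    Integrable (fun x => f x + g x) := hf.add hg

lemma int_sub {f g : E → V} (hf : Integrable f) (hg : Integrable g) :
    Integrable (fun x => f x - g x) := hf.sub hg

lemma W1.add {u v : E → V} {g h : E → E →L[ℝ] V} (a : W1 u g) (b : W1 v h) :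
    W1 (fun x => u x + v x) (fun x => g x + h x) := by
  refine ⟨int_add a.iu b.iu, int_add a.ig b.ig, fun φ hφ hc w => ?_⟩
  have hd := fd_cont hφ hc w
  simp only [smul_add, add_apply]
  rw [integral_add (int_smul hd.1.continuous hd.2 a.iu) (int_smul hd.1.continuous hd.2 b.iu),
    integral_add (int_smul hφ.continuous hc (int_app a.ig w))
      (int_smul hφ.continuous hc (int_app b.ig w)), a.ibp φ hφ hc, b.ibp φ hφ hc]
  abel

lemma W1.smul {u : E → V} {g : E → E →L[ℝ] V} (a : W1 u g) (c : ℝ) :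
    W1 (fun x => c • u x) (fun x => c • g x) := by
  refine ⟨a.iu.smul c, a.ig.smul c, fun φ hφ hc w => ?_⟩
  simp only [smul_apply]
  simp_rw [smul_comm _ c]
  rw [integral_smul, integral_smul, a.ibp φ hφ hc, smul_neg]

lemma W1.sub {u v : E → V} {g h : E → E →L[ℝ] V} (a : W1 u g) (b : W1 v h) :
    W1 (fun x => u x - v x) (fun x => g x - h x) := by
  have := a.add (b.smul (-1))
  simpa only [neg_smul, one_smul, ← sub_eq_add_neg] using this

lemma W1.of_C1 {v : E → V} [CompleteSpace V] (hv : ContDiff ℝ 1 v) (iv : Integrable v)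
    (ig : Integrable (fderiv ℝ v)) : W1 v (fderiv ℝ v) := by
  refine ⟨iv, ig, fun φ hφ hc w => ?_⟩
  have hd := fd_cont hφ hc w
  have h := integral_bilinear_hasLineDerivAt_right_eq_neg_left_of_integrable
    (μ := (volume : Measure E)) (f := φ) (f' := fun x => fderiv ℝ φ x w) (g := v)
    (g' := fun x => fderiv ℝ v x w) (v := w) (B := ContinuousLinearMap.lsmul ℝ ℝ)
    (int_smul hd.1.continuous hd.2 iv) (int_smul hφ.continuous hc (int_app ig w))
    (int_smul hφ.continuous hc iv)
    (fun x _ => ((hφ.differentiable (by simp) x).hasFDerivAt.hasLineDerivAt w))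
    (fun x _ => ((hv.differentiable (by simp) x).hasFDerivAt.hasLineDerivAt w))
  simp only [ContinuousLinearMap.lsmul_apply] at h
  rw [h, neg_neg]

lemma norm_int_smul_sub_le {φ : E → ℝ} (hφ : Continuous φ) (hc : HasCompactSupport φ) {M : ℝ}
    (hM : ∀ x, ‖φ x‖ ≤ M) {u v : E → V} (hu : Integrable u) (hv : Integrable v) :
    ‖(∫ x, φ x • u x) - ∫ x, φ x • v x‖ ≤ M * ∫ x, ‖u x - v x‖ := by
  rw [← integral_sub (int_smul hφ hc hu) (int_smul hφ hc hv), ← integral_const_mul]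
  refine norm_integral_le_of_norm_le ((hu.sub hv).norm.const_mul M)
    (Eventually.of_forall fun x => ?_)
  rw [← smul_sub, norm_smul]
  exact mul_le_mul_of_nonneg_right (hM x) (norm_nonneg _)

lemma W1.of_approx {u : E → V} {g : E → E →L[ℝ] V} (iu : Integrable u) (ig : Integrable g)
    (h : ∀ ε > 0, ∃ v k, W1 v k ∧ ∫ x, ‖v x - u x‖ ≤ ε ∧ ∫ x, ‖k x - g x‖ ≤ ε) : W1 u g := by
  refine ⟨iu, ig, fun φ hφ hc w => ?_⟩
  have hd := fd_cont hφ hc w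
  obtain ⟨M, hM⟩ := hc.exists_bound_of_continuous hφ.continuous
  obtain ⟨M', hM'⟩ := hd.2.exists_bound_of_continuous hd.1.continuous
  have hM0 : 0 ≤ M := (norm_nonneg _).trans (hM 0)
  have hM0' : 0 ≤ M' := (norm_nonneg _).trans (hM' 0)
  rw [← sub_eq_zero, ← norm_le_zero_iff]
  refine le_of_forall_pos_le_add fun ε hε => ?_
  obtain ⟨v, k, hw, h1, h2⟩ := h (ε / (M' + M * ‖w‖ + 1)) (by positivity)
  have e1 := norm_int_smul_sub_le hd.1.continuous hd.2 hM' hw.iu iu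
  have e2 := norm_int_smul_sub_le hφ.continuous hc hM (int_app hw.ig w) (int_app ig w)
  have e3 : ∫ x, ‖k x w - g x w‖ ≤ ‖w‖ * ∫ x, ‖k x - g x‖ := by
    rw [← integral_const_mul]
    refine integral_mono ((int_app hw.ig w).sub (int_app ig w)).norm
      ((hw.ig.sub ig).norm.const_mul _) fun x => ?_
    rw [mul_comm]
    exact (k x - g x).le_opNorm w
  have e4 := hw.ibp φ hφ hc w
  rw [sub_neg_eq_add, zero_add]
  set A := ∫ x, fderiv ℝ φ x w • u x
  set A' := ∫ x, fderiv ℝ φ x w • v x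
  set C := ∫ x, φ x • g x w
  set C' := ∫ x, φ x • k x w
  have : A + C = -(A' - A) - (C' - C) := by rw [e4]; abel
  rw [this]
  refine (norm_sub_le _ _).trans ?_
  rw [norm_neg]
  calc ‖A' - A‖ + ‖C' - C‖ ≤ M' * (ε / (M' + M * ‖w‖ + 1)) +
        M * (‖w‖ * (ε / (M' + M * ‖w‖ + 1))) := by
        refine add_le_add (e1.trans (by gcongr)) (e2.trans ?_)
        gcongr
        exact e3.trans (by gcongr)
    _ = ε * ((M' + M * ‖w‖) / (M' + M * ‖w‖ + 1)) := by ring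
    _ ≤ ε * 1 := by gcongr; rw [div_le_one (by positivity)]; linarith
    _ = ε := mul_one _

lemma W1.mol_hasFDerivAt [CompleteSpace V] {u : E → V} {g : E → E →L[ℝ] V} (a : W1 u g) {K : E → ℝ}
    (hK : ContDiff ℝ (⊤ : ℕ∞) K) (hK0 : ∀ z, 1 ≤ ‖z‖ → K z = 0) {s : ℝ} (hs : 0 < s) (x : E) :
    HasFDerivAt (mol K s u) (mol K s g x) x := by
  have hK1 : ContDiff ℝ 1 K := hK.of_le (by simp)
  have h := gmol_hasFDerivAt (ContinuousLinearMap.lsmul ℝ ℝ : ℝ →L[ℝ] V →L[ℝ] V) hK1 hK0 hs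
    a.iu.locallyIntegrable x
  rw [← mol_gmol] at h
  refine HasFDerivAt.congr_fderiv h (ContinuousLinearMap.ext fun w => Eq.symm ?_)
  set φ : E → ℝ := fun y => K (s⁻¹ • (x - y)) with hφd
  have hφ : ContDiff ℝ (⊤ : ℕ∞) φ := hK.comp (by fun_prop)
  have hz : ∀ y, y ∉ closedBall x s → 1 ≤ ‖s⁻¹ • (x - y)‖ := fun y hy => by
    rw [norm_smul, Real.norm_of_nonneg (by positivity), ← div_eq_inv_mul, le_div_iff₀ hs]
    rw [mem_closedBall, dist_comm, dist_eq_norm] at hy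
    linarith
  have hc : HasCompactSupport φ :=
    HasCompactSupport.intro (isCompact_closedBall x s) fun y hy => hK0 _ (hz y hy)
  have hib := a.ibp φ hφ hc w
  have hf : ∀ y, fderiv ℝ φ y w = - (s⁻¹ * fderiv ℝ K (s⁻¹ • (x - y)) w) := fun y => by
    have h1 : HasFDerivAt (fun y : E => s⁻¹ • (x - y)) (s⁻¹ • (-ContinuousLinearMap.id ℝ E)) y :=
      ((hasFDerivAt_id y).const_sub x).const_smul s⁻¹
    have := ((hK1.differentiable (by simp) (s⁻¹ • (x - y))).hasFDerivAt.comp y h1).fderiv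
    have h2 : fderiv ℝ φ y = (fderiv ℝ K (s⁻¹ • (x - y))).comp
      (s⁻¹ • (-ContinuousLinearMap.id ℝ E)) := this
    rw [h2]; simp
  have ig2 : Integrable (fun y => φ y • g y) := int_smul hφ.continuous hc a.ig
  have hdK0 := fderiv_zero_of hK1 hK0
  have ig3 : Integrable (fun y =>
      ((ContinuousLinearMap.lsmul ℝ ℝ : ℝ →L[ℝ] V →L[ℝ] V).precompL E)
        (fderiv ℝ K (s⁻¹ • (x - y))) (u y)) :=
    int_ker _ (hK1.continuous_fderiv one_ne_zero) hdK0 x a.iu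
  rw [mol_gmol, gmol_eq _ _ hs, gmol_eq _ _ hs]
  simp only [ContinuousLinearMap.lsmul_apply, smul_apply]
  rw [ContinuousLinearMap.integral_apply ig2, ContinuousLinearMap.integral_apply ig3]
  simp only [smul_apply, ContinuousLinearMap.precompL_apply,
    ContinuousLinearMap.lsmul_apply]
  rw [smul_comm]
  congr 1
  simp_rw [hf, neg_smul, mul_smul] at hib
  rw [integral_neg, integral_smul, neg_inj] at hib
  exact hib.symm
end
end

noncomputable section
section
variable {n : ℕ}
local notation "E" => EuclideanSpace ℝ (Fin n)
variable {V W X : Type*} [NormedAddCommGroup V] [NormedSpace ℝ V] [NormedAddCommGroup W]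
  [NormedSpace ℝ W] [NormedAddCommGroup X] [NormedSpace ℝ X]

lemma W1.approx [CompleteSpace V] {ψ Γ : E → ℝ} (K : KerPair n ψ Γ) {u : E → V} {g : E → E →L[ℝ] V}
    (a : W1 u g) {ε : ℝ} (hε : 0 < ε) : ∃ v : E → V, ContDiff ℝ 1 v ∧ Integrable v ∧
      Integrable (fderiv ℝ v) ∧ ∫ x, ‖v x - u x‖ ≤ ε ∧ ∫ x, ‖fderiv ℝ v x - g x‖ ≤ ε := by
  obtain ⟨δ, hδ, h1⟩ := mol_tendsto K a.iu hε
  obtain ⟨δ', hδ', h2⟩ := mol_tendsto K a.ig hε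
  set s := min δ δ' / 2 with hs
  have hm : 0 < min δ δ' := lt_min hδ hδ'
  have hs0 : 0 < s := by positivity
  have hs1 : s < min δ δ' := by rw [hs]; linarith
  have hd := fun x => a.mol_hasFDerivAt K.sψ K.zψ hs0 x
  have hfd : fderiv ℝ (mol ψ s u) = mol ψ s g := funext fun x => (hd x).fderiv
  have hcont : Continuous (mol ψ s g) := by
    rw [mol_gmol]
    exact continuous_iff_continuousAt.2 fun x => (gmol_hasFDerivAt _
      (K.sψ.of_le (by simp)) K.zψ hs0 a.ig.locallyIntegrable x).continuousAt
  refine ⟨mol ψ s u, ?_, (vmol_integrable K.sψ.continuous K.zψ (lipc s) a.iu).1, ?_,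
    h1 s hs0 (hs1.trans_le (min_le_left _ _)), ?_⟩
  · rw [contDiff_one_iff_fderiv, hfd]
    exact ⟨fun x => (hd x).differentiableAt, hcont⟩
  · rw [hfd]; exact (vmol_integrable K.sψ.continuous K.zψ (lipc s) a.ig).1
  · rw [hfd]; exact h2 s hs0 (hs1.trans_le (min_le_right _ _))

lemma int_comp_clm {g : E → V →L[ℝ] W} (hg : Integrable g) {D : E → X →L[ℝ] V}
    (hD : AEStronglyMeasurable D) {M : ℝ} (hM : ∀ x, ‖D x‖ ≤ M) :
    Integrable (fun x => (g x).comp (D x)) ∧ ∫ x, ‖(g x).comp (D x)‖ ≤ M * ∫ x, ‖g x‖ := by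
  have hb : ∀ x, ‖(g x).comp (D x)‖ ≤ M * ‖g x‖ := fun x => by
    refine ((g x).opNorm_comp_le _).trans ?_
    rw [mul_comm]
    exact mul_le_mul_of_nonneg_right (hM x) (norm_nonneg _)
  have hi : Integrable (fun x => (g x).comp (D x)) :=
    (hg.norm.const_mul M).mono' (((ContinuousLinearMap.compL ℝ X V W).aestronglyMeasurable_comp₂
      hg.1 hD)) (Eventually.of_forall hb)
  refine ⟨hi, ?_⟩
  rw [← integral_const_mul]
  exact integral_mono hi.norm (hg.norm.const_mul M) hb

lemma W1.comp [CompleteSpace V] {ψ Γ : E → ℝ} (K : KerPair n ψ Γ) {u : E → V} {g : E → E →L[ℝ] V}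
    (a : W1 u g) {F : E → E} (hF : ContDiff ℝ 1 F) (hA : AntilipschitzWith 2 F) {M : ℝ}
    (hM : ∀ x, ‖fderiv ℝ F x‖ ≤ M) :
    W1 (fun x => u (F x)) (fun x => (g (F x)).comp (fderiv ℝ F x)) := by
  have hm := hF.continuous.measurable
  have hdm : AEStronglyMeasurable (fderiv ℝ F) :=
    (hF.continuous_fderiv one_ne_zero).aestronglyMeasurable
  have hM0 : 0 ≤ M := (norm_nonneg _).trans (hM 0)
  refine W1.of_approx (integrable_comp_anti hm hA a.iu).1
    (int_comp_clm (integrable_comp_anti hm hA a.ig).1 hdm hM).1 fun ε hε => ?_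
  obtain ⟨v, hv, iv, idv, h1, h2⟩ := a.approx K (ε := ε / ((M + 1) * 2 ^ n)) (by positivity)
  have hfd : fderiv ℝ (fun x => v (F x)) = fun x => (fderiv ℝ v (F x)).comp (fderiv ℝ F x) :=
    funext fun x => fderiv_comp x (hv.differentiable one_ne_zero _)
      (hF.differentiable one_ne_zero _)
  refine ⟨fun x => v (F x), _, W1.of_C1 (hv.comp hF) (integrable_comp_anti hm hA iv).1 ?_, ?_, ?_⟩
  · rw [hfd]
    exact (int_comp_clm (integrable_comp_anti hm hA idv).1 hdm hM).1
  · refine (integrable_comp_anti hm hA (int_sub iv a.iu)).2.trans ?_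
    calc _ ≤ 2 ^ n * (ε / ((M + 1) * 2 ^ n)) := by gcongr
      _ = ε / (M + 1) := by field_simp
      _ ≤ ε := div_le_self hε.le (by linarith)
  · have h3 := (integrable_comp_anti hm hA (int_sub idv a.ig))
    have h4 := (int_comp_clm h3.1 hdm hM).2
    rw [hfd]
    simp_rw [← ContinuousLinearMap.sub_comp]
    refine h4.trans ?_
    calc _ ≤ M * (2 ^ n * (ε / ((M + 1) * 2 ^ n))) := by
          gcongr
          exact h3.2.trans (by gcongr)
      _ = ε * (M / (M + 1)) := by field_simp
      _ ≤ ε * 1 := by gcongr; rw [div_le_one (by positivity)]; linarith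
      _ = ε := mul_one _

lemma W1.chain [CompleteSpace V] [CompleteSpace W] {ψ Γ : E → ℝ} (K : KerPair n ψ Γ)
    {u : E → V} {g : E → E →L[ℝ] V}
    (a : W1 u g) {P : V → W} (hP : ContDiff ℝ 1 P) (h0 : P 0 = 0) {M : ℝ}
    (hM : ∀ x, ‖fderiv ℝ P x‖ ≤ M) :
    W1 (fun x => P (u x)) (fun x => (fderiv ℝ P (u x)).comp (g x)) := by
  have hM0 : 0 ≤ M := (norm_nonneg _).trans (hM 0)
  have hdc := hP.continuous_fderiv one_ne_zero
  have hlip : ∀ x y, ‖P x - P y‖ ≤ M * ‖x - y‖ := fun x y =>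
    Convex.norm_image_sub_le_of_norm_fderiv_le (fun z _ => hP.differentiable one_ne_zero z)
      (fun z _ => hM z) convex_univ (mem_univ _) (mem_univ _)
  have hint : ∀ {v : E → V}, Integrable v → Integrable (fun x => P (v x)) := fun {v} hv =>
    (hv.norm.const_mul M).mono' (hP.continuous.comp_aestronglyMeasurable hv.1)
      (Eventually.of_forall fun x => by simpa [h0] using hlip (v x) 0)
  have hint2 : ∀ {v : E → V} {k : E → E →L[ℝ] V}, Integrable v → Integrable k →
      Integrable (fun x => (fderiv ℝ P (v x)).comp (k x)) := fun {v k} hv hk => by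
    refine (hk.norm.const_mul M).mono' ((ContinuousLinearMap.compL ℝ E V W).aestronglyMeasurable_comp₂
      (hdc.comp_aestronglyMeasurable hv.1) hk.1) (Eventually.of_forall fun x => ?_)
    exact (ContinuousLinearMap.opNorm_comp_le _ _).trans (by gcongr; exact hM _)
  refine W1.of_approx (hint a.iu) (hint2 a.iu a.ig) fun ε hε => ?_
  choose v hv iv idv h1 h2 using fun k : ℕ => a.approx K (ε := 1 / ((k : ℝ) + 1)) (by positivity)
  have ht0 : Tendsto (fun k : ℕ => 1 / ((k : ℝ) + 1)) atTop (nhds 0) :=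
    tendsto_one_div_add_atTop_nhds_zero_nat
  have hL : Tendsto (fun k => eLpNorm (v k - u) 1 volume) atTop (nhds 0) := by
    have : ∀ k, eLpNorm (v k - u) 1 volume ≤ ENNReal.ofReal (1 / ((k : ℝ) + 1)) := fun k => by
      rw [eLpNorm_one_eq_lintegral_enorm, ← ofReal_integral_norm_eq_lintegral_enorm
        ((iv k).sub a.iu)]
      exact ENNReal.ofReal_le_ofReal (h1 k)
    refine tendsto_of_tendsto_of_tendsto_of_le_of_le tendsto_const_nhds ?_ (fun _ => zero_le) this
    simpa using ENNReal.tendsto_ofReal ht0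
  obtain ⟨ns, hns, hae⟩ := (tendstoInMeasure_of_tendsto_eLpNorm one_ne_zero
    (fun k => (iv k).1) a.iu.1 hL).exists_seq_tendsto_ae
  have hD : Tendsto (fun k => ∫ x, ‖fderiv ℝ P (v (ns k) x) - fderiv ℝ P (u x)‖ * ‖g x‖) atTop
      (nhds 0) := by
    have := tendsto_integral_of_dominated_convergence
      (F := fun k x => ‖fderiv ℝ P (v (ns k) x) - fderiv ℝ P (u x)‖ * ‖g x‖) (f := fun _ => (0 : ℝ))
      (μ := (volume : Measure E)) (fun x => (M + M) * ‖g x‖)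
      (fun k => (((hdc.comp_aestronglyMeasurable (iv (ns k)).1).sub
        (hdc.comp_aestronglyMeasurable a.iu.1)).norm.mul a.ig.1.norm)) (a.ig.norm.const_mul _)
      (fun k => Eventually.of_forall fun x => by
        rw [Real.norm_of_nonneg (by positivity)]
        gcongr
        exact (norm_sub_le _ _).trans (add_le_add (hM _) (hM _))) (by
        filter_upwards [hae] with x hx
        have := (((hdc.tendsto _).comp hx).sub_const (fderiv ℝ P (u x))).norm.mul_const ‖g x‖
        simpa using this)
    simpa using this
  have h3 : Tendsto (fun k => M * (1 / ((ns k : ℝ) + 1)) +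
      ∫ x, ‖fderiv ℝ P (v (ns k) x) - fderiv ℝ P (u x)‖ * ‖g x‖) atTop (nhds 0) := by
    simpa using ((ht0.comp hns.tendsto_atTop).const_mul M).add hD
  obtain ⟨k, hk⟩ := ((tendsto_order.1 h3).2 ε hε).exists
  have hD0 : 0 ≤ ∫ x, ‖fderiv ℝ P (v (ns k) x) - fderiv ℝ P (u x)‖ * ‖g x‖ := by positivity
  set w := v (ns k) with hw
  have hfd : fderiv ℝ (fun x => P (w x)) = fun x => (fderiv ℝ P (w x)).comp (fderiv ℝ w x) :=
    funext fun x => fderiv_comp x (hP.differentiable one_ne_zero _)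
      ((hv _).differentiable one_ne_zero _)
  refine ⟨fun x => P (w x), _, W1.of_C1 (hP.comp (hv _)) (hint (iv _)) ?_, ?_, ?_⟩
  · rw [hfd]; exact hint2 (iv _) (idv _)
  · calc ∫ x, ‖P (w x) - P (u x)‖ ≤ ∫ x, M * ‖w x - u x‖ :=
          integral_mono (int_sub (hint (iv _)) (hint a.iu)).norm
            ((int_sub (iv _) a.iu).norm.const_mul M) fun x => hlip _ _
      _ ≤ M * (1 / ((ns k : ℝ) + 1)) := by
          rw [integral_const_mul]; gcongr; exact h1 _
      _ ≤ ε := by linarith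
  · have i1 : Integrable (fun x => M * ‖fderiv ℝ w x - g x‖) :=
      (int_sub (idv _) a.ig).norm.const_mul M
    have i2 : Integrable (fun x => ‖fderiv ℝ P (w x) - fderiv ℝ P (u x)‖ * ‖g x‖) := by
      refine (a.ig.norm.const_mul (M + M)).mono' (((hdc.comp_aestronglyMeasurable (iv (ns k)).1).sub
        (hdc.comp_aestronglyMeasurable a.iu.1)).norm.mul a.ig.1.norm) (Eventually.of_forall fun x => ?_)
      rw [Real.norm_of_nonneg (by positivity)]
      gcongr
      exact (norm_sub_le _ _).trans (add_le_add (hM _) (hM _))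
    rw [hfd]
    calc _ ≤ ∫ x, (M * ‖fderiv ℝ w x - g x‖ + ‖fderiv ℝ P (w x) - fderiv ℝ P (u x)‖ * ‖g x‖) := by
          refine integral_mono (int_sub (hint2 (iv _) (idv _)) (hint2 a.iu a.ig)).norm
            (int_add i1 i2) fun x => ?_
          have e : (fderiv ℝ P (w x)).comp (fderiv ℝ w x) - (fderiv ℝ P (u x)).comp (g x) =
            (fderiv ℝ P (w x)).comp (fderiv ℝ w x - g x) +
              (fderiv ℝ P (w x) - fderiv ℝ P (u x)).comp (g x) := by
            ext z; simp
          simp only [e]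
          refine (norm_add_le _ _).trans (add_le_add ?_ (ContinuousLinearMap.opNorm_comp_le _ _))
          exact (ContinuousLinearMap.opNorm_comp_le _ _).trans (by gcongr; exact hM _)
      _ ≤ M * (1 / ((ns k : ℝ) + 1)) + ∫ x, ‖fderiv ℝ P (w x) - fderiv ℝ P (u x)‖ * ‖g x‖ := by
          rw [integral_add i1 i2, integral_const_mul]
          gcongr
          exact h2 _
      _ ≤ ε := hk.le
end
end

noncomputable section
section
variable {n : ℕ}
local notation "E" => EuclideanSpace ℝ (Fin n)
variable {V W X : Type*} [NormedAddCommGroup V] [NormedSpace ℝ V] [NormedAddCommGroup W]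
  [NormedSpace ℝ W] [NormedAddCommGroup X] [NormedSpace ℝ X]

/-- derivative of `x - τ x • z` -/
def dF (τ : E → ℝ) (x z : E) : E →L[ℝ] E :=
  ContinuousLinearMap.id ℝ E - (fderiv ℝ τ x).smulRight z

/-- gradient of the variable scale mollification -/
def vgrad (ψ τ : E → ℝ) (g : E → E →L[ℝ] V) (x : E) : E →L[ℝ] V :=
  ∫ z, ψ z • (g (x - τ x • z)).comp (dF τ x z)

lemma dF_norm {τ : E → ℝ} (hτ : LipschitzWith (1/2) τ) (x : E) {z : E} (hz : ‖z‖ ≤ 1) :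
    ‖dF τ x z‖ ≤ 2 := by
  have h1 : ‖fderiv ℝ τ x‖ ≤ 1/2 := by
    have := norm_fderiv_le_of_lipschitz ℝ (x₀ := x) hτ
    simpa using this
  refine (norm_sub_le _ _).trans ?_
  rw [ContinuousLinearMap.norm_smulRight_apply]
  have : ‖ContinuousLinearMap.id ℝ E‖ ≤ 1 := ContinuousLinearMap.norm_id_le
  have : ‖fderiv ℝ τ x‖ * ‖z‖ ≤ 1/2 * 1 := by gcongr
  linarith

lemma vgrad_prod {ψ τ : E → ℝ} (hψ : Continuous ψ) (hψ0 : ∀ z, 1 ≤ ‖z‖ → ψ z = 0)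
    (hτ : LipschitzWith (1/2) τ) (hτ1 : ContDiff ℝ 1 τ) {g : E → E →L[ℝ] V} (hg : Integrable g) :
    Integrable (fun q : E × E => ψ q.2 • (g (q.1 - τ q.1 • q.2)).comp (dF τ q.1 q.2))
      ((volume : Measure E).prod volume) := by
  have h := (vmol_prod hψ hψ0 hτ hg).1
  have hc : Continuous (fun q : E × E => dF τ q.1 q.2) := by
    have := hτ1.continuous_fderiv one_ne_zero
    unfold dF; fun_prop
  refine (h.norm.const_mul 2).mono' ?_ (Eventually.of_forall fun q => ?_)
  · have := (ContinuousLinearMap.compL ℝ E E V).aestronglyMeasurable_comp₂ h.1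
      hc.aestronglyMeasurable
    simpa using this
  · by_cases hz : 1 ≤ ‖q.2‖
    · simp [hψ0 _ hz]
    · rw [← ContinuousLinearMap.smul_comp, mul_comm]
      refine (ContinuousLinearMap.opNorm_comp_le _ _).trans ?_
      gcongr
      exact dF_norm hτ _ (by linarith)

lemma W1.vmol [CompleteSpace V] {ψ Γ : E → ℝ} (K : KerPair n ψ Γ) {u : E → V} {g : E → E →L[ℝ] V}
    (a : W1 u g) {τ : E → ℝ} (hτ : LipschitzWith (1/2) τ) (hτ1 : ContDiff ℝ 1 τ) :
    W1 (vmol ψ τ u) (vgrad ψ τ g) := by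
  have h1 := (vmol_prod K.sψ.continuous K.zψ hτ a.iu).1
  have h2 := vgrad_prod K.sψ.continuous K.zψ hτ hτ1 a.ig
  refine ⟨(vmol_integrable K.sψ.continuous K.zψ hτ a.iu).1, h2.integral_prod_left,
    fun φ hφ hc w => ?_⟩
  have hd := fd_cont hφ hc w
  obtain ⟨M, hM⟩ := hc.exists_bound_of_continuous hφ.continuous
  obtain ⟨M', hM'⟩ := hd.2.exists_bound_of_continuous hd.1.continuous
  have i1 : Integrable (fun q : E × E => fderiv ℝ φ q.1 w • ψ q.2 • u (q.1 - τ q.1 • q.2))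
      ((volume : Measure E).prod volume) :=
    h1.bdd_smul M' (hd.1.continuous.comp continuous_fst).aestronglyMeasurable
      (Eventually.of_forall fun q => hM' q.1)
  have i2 : Integrable (fun q : E × E => φ q.1 • (ψ q.2 • (g (q.1 - τ q.1 • q.2)).comp
      (dF τ q.1 q.2)) w) ((volume : Measure E).prod volume) :=
    ((ContinuousLinearMap.apply ℝ V w).integrable_comp h2).bdd_smul M
      (hφ.continuous.comp continuous_fst).aestronglyMeasurable
      (Eventually.of_forall fun q => hM q.1)
  have e1 : ∫ x, fderiv ℝ φ x w • _root_.vmol ψ τ u x =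
      ∫ z, ∫ x, fderiv ℝ φ x w • ψ z • u (x - τ x • z) := by
    rw [← integral_integral_swap i1]
    simp_rw [integral_smul]; rfl
  have e2 : ∫ x, φ x • vgrad ψ τ g x w =
      ∫ z, ∫ x, φ x • (ψ z • (g (x - τ x • z)).comp (dF τ x z)) w := by
    rw [← integral_integral_swap i2]
    simp_rw [integral_smul]
    refine integral_congr_ae ?_
    filter_upwards [h2.prod_right_ae] with x hx
    simp only [vgrad]
    rw [ContinuousLinearMap.integral_apply hx]
  rw [e1, e2, ← integral_neg]
  congr 1; funext z
  by_cases hz : 1 ≤ ‖z‖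
  · simp [K.zψ z hz]
  · have hF : ContDiff ℝ 1 (fun x => x - τ x • z) := by fun_prop
    have hfd : ∀ x, fderiv ℝ (fun x => x - τ x • z) x = dF τ x z := fun x =>
      ((hasFDerivAt_id x).sub
        ((hτ1.differentiable one_ne_zero x).hasFDerivAt.smul_const z)).fderiv
    have := (a.comp K hF (anti_of_lip hτ (z := z) (by linarith)) (M := 2) fun x => by
      rw [hfd]; exact dF_norm hτ _ (by linarith)).ibp φ hφ hc w
    simp_rw [hfd] at this
    simp_rw [smul_apply, smul_comm _ (ψ z), integral_smul]
    rw [this, smul_neg]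

lemma sum_single (v : E) : v = ∑ i, v i • EuclideanSpace.single i (1 : ℝ) := by
  ext j; simp [Finset.sum_apply, Pi.single_apply]

lemma W1.zero_on [CompleteSpace V] {f : E → V} {k : E → E →L[ℝ] V} (a : W1 f k) {O : Set E}
    (hO : IsOpen O) (h : ∀ᵐ x, x ∈ O → f x = 0) : ∀ᵐ x, x ∈ O → k x = 0 := by
  have hi : ∀ i : Fin n, ∀ᵐ x, x ∈ O → k x (EuclideanSpace.single i 1) = 0 := fun i => by
    refine hO.ae_eq_zero_of_integral_contDiff_smul_eq_zero
      ((int_app a.ig _).locallyIntegrable.locallyIntegrableOn _) fun φ hφ hc hs => ?_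
    have := a.ibp φ hφ hc (EuclideanSpace.single i 1)
    rw [eq_comm, neg_eq_iff_eq_neg] at this
    rw [this, neg_eq_zero]
    refine integral_eq_zero_of_ae ?_
    filter_upwards [h] with x hx
    by_cases hxO : x ∈ O
    · simp [hx hxO]
    · have : fderiv ℝ φ x = 0 := by
        have := fun h => hxO (hs (tsupport_fderiv_subset ℝ (f := φ) (subset_tsupport _ h)))
        simpa [Function.mem_support] using this
      simp [this]
  filter_upwards [ae_all_iff.2 hi] with x hx hxO
  ext v
  rw [sum_single v, map_sum]
  simp [hx _ hxO]

lemma transl_C1 {v : E → V} [CompleteSpace V] (hv : ContDiff ℝ 1 v) (x h : E) (r : ℝ) :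
    ∫ a in closedBall x r, ‖v (a + h) - v a‖ ≤
      ‖h‖ * ∫ a in closedBall x (r + ‖h‖), ‖fderiv ℝ v a‖ := by
  have hdc := hv.continuous_fderiv one_ne_zero
  have hc : Continuous (fun q : E × ℝ => ‖fderiv ℝ v (q.1 + q.2 • h)‖) := by fun_prop
  have hint : Integrable (fun q : E × ℝ => ‖fderiv ℝ v (q.1 + q.2 • h)‖)
      ((volume.restrict (closedBall x r)).prod (volume.restrict (Ioc (0 : ℝ) 1))) := by
    rw [Measure.prod_restrict]
    exact (hc.continuousOn.integrableOn_compact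
      ((isCompact_closedBall x r).prod (isCompact_Icc (a := (0 : ℝ)) (b := 1)))).mono_set
      (prod_mono le_rfl Ioc_subset_Icc_self)
  have hpt : ∀ a, ‖v (a + h) - v a‖ ≤ ‖h‖ * ∫ t in Ioc (0 : ℝ) 1, ‖fderiv ℝ v (a + t • h)‖ := by
    intro a
    have hd : ∀ t ∈ uIcc (0 : ℝ) 1, HasDerivAt (fun t : ℝ => v (a + t • h))
        (fderiv ℝ v (a + t • h) h) t := fun t _ => by
      have h1 : HasDerivAt (fun t : ℝ => a + t • h) h t := by
        simpa using ((hasDerivAt_id t).smul_const h).const_add a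
      exact (hv.differentiable one_ne_zero _).hasFDerivAt.comp_hasDerivAt t h1
    have hcc : Continuous (fun t : ℝ => fderiv ℝ v (a + t • h) h) := by fun_prop
    have := intervalIntegral.integral_eq_sub_of_hasDerivAt hd (hcc.intervalIntegrable _ _)
    simp only [one_smul, zero_smul, add_zero] at this
    rw [← this, intervalIntegral.integral_of_le zero_le_one, ← integral_const_mul]
    have hcn : Continuous (fun t : ℝ => ‖h‖ * ‖fderiv ℝ v (a + t • h)‖) := by fun_prop
    refine norm_integral_le_of_norm_le ((hcn.continuousOn.integrableOn_compact
      isCompact_Icc).mono_set Ioc_subset_Icc_self) (Eventually.of_forall fun t => ?_)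
    rw [mul_comm]
    exact ContinuousLinearMap.le_opNorm _ _
  calc ∫ a in closedBall x r, ‖v (a + h) - v a‖
      ≤ ∫ a in closedBall x r, ‖h‖ * ∫ t in Ioc (0 : ℝ) 1, ‖fderiv ℝ v (a + t • h)‖ := by
        refine integral_mono ?_ (hint.integral_prod_left.const_mul _) hpt
        have : Continuous (fun a => ‖v (a + h) - v a‖) := by
          have := hv.continuous; fun_prop
        exact this.continuousOn.integrableOn_compact (isCompact_closedBall x r)
    _ = ‖h‖ * ∫ t in Ioc (0 : ℝ) 1, ∫ a in closedBall x r, ‖fderiv ℝ v (a + t • h)‖ := by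
        rw [integral_const_mul, integral_integral_swap hint]
    _ ≤ ‖h‖ * ∫ t in Ioc (0 : ℝ) 1, ∫ a in closedBall x (r + ‖h‖), ‖fderiv ℝ v a‖ := by
        gcongr ‖h‖ * ?_
        refine setIntegral_mono_on hint.integral_prod_right (integrable_const _) measurableSet_Ioc
          fun t ht => ?_
        rw [← (measurePreserving_add_right volume (t • h)).setIntegral_preimage_emb
          (measurableEmbedding_addRight _) (fun a => ‖fderiv ℝ v a‖)]
        refine setIntegral_mono_set ?_ (Eventually.of_forall fun _ => norm_nonneg _)
          (Eventually.of_forall fun a ha => ?_)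
        · have hcn : Continuous (fun a => ‖fderiv ℝ v (a + t • h)‖) := by fun_prop
          refine hcn.continuousOn.integrableOn_compact ?_
          exact (Homeomorph.addRight (t • h)).isCompact_preimage.2 (isCompact_closedBall _ _)
        · change dist (a + t • h) x ≤ r + ‖h‖
          have h1 : dist a x ≤ r := ha
          have h2 : dist (a + t • h) a ≤ ‖h‖ := by
            rw [dist_eq_norm, add_sub_cancel_left, norm_smul, Real.norm_of_nonneg ht.1.le]
            exact mul_le_of_le_one_left (norm_nonneg _) ht.2
          linarith [dist_triangle (a + t • h) a x]
    _ = _ := by simp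

lemma W1.transl [CompleteSpace V] {ψ Γ : E → ℝ} (K : KerPair n ψ Γ) {u : E → V} {g : E → E →L[ℝ] V}
    (a : W1 u g) (x h : E) (r : ℝ) : ∫ a in closedBall x r, ‖u (a + h) - u a‖ ≤
      ‖h‖ * ∫ a in closedBall x (r + ‖h‖), ‖g a‖ := by
  refine le_of_forall_pos_le_add fun ε hε => ?_
  obtain ⟨v, hv, iv, idv, h1, h2⟩ := a.approx K (ε := ε / (2 + ‖h‖)) (by positivity)
  have h0 := transl_C1 hv x h r
  have iuv := int_sub iv a.iu
  have igv := int_sub idv a.ig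
  have iuvh : Integrable (fun a => ‖v (a + h) - u (a + h)‖) := (iuv.comp_add_right h).norm
  have h3 : ∫ a in closedBall x r, ‖u (a + h) - u a‖ ≤
      (∫ a in closedBall x r, ‖v (a + h) - v a‖) + (ε / (2 + ‖h‖) + ε / (2 + ‖h‖)) := by
    have i1 : Integrable (fun a => ‖v (a + h) - v a‖) := (int_sub (iv.comp_add_right h) iv).norm
    calc _ ≤ ∫ a in closedBall x r, (‖v (a + h) - v a‖ + (‖v (a + h) - u (a + h)‖ +
            ‖v a - u a‖)) := by
          refine integral_mono (int_sub (a.iu.comp_add_right h) a.iu).norm.integrableOn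
            (int_add i1 (int_add iuvh iuv.norm)).integrableOn fun b => ?_
          have e : u (b + h) - u b = (v (b + h) - v b) - (v (b + h) - u (b + h)) + (v b - u b) := by
            abel
          simp only [e]
          refine (norm_add_le _ _).trans ?_
          rw [← add_assoc]
          gcongr
          exact norm_sub_le _ _
      _ = (∫ a in closedBall x r, ‖v (a + h) - v a‖) +
            ((∫ a in closedBall x r, ‖v (a + h) - u (a + h)‖) +
              ∫ a in closedBall x r, ‖v a - u a‖) := by
          rw [integral_add i1.integrableOn (int_add iuvh iuv.norm).integrableOn,
            integral_add iuvh.integrableOn iuv.norm.integrableOn]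
      _ ≤ _ := by
          gcongr
          · refine (setIntegral_le_integral iuvh (Eventually.of_forall fun _ => norm_nonneg _)).trans ?_
            rwa [integral_add_right_eq_self (fun a => ‖v a - u a‖)]
          · exact (setIntegral_le_integral iuv.norm
              (Eventually.of_forall fun _ => norm_nonneg _)).trans h1
  have h4 : ∫ a in closedBall x (r + ‖h‖), ‖fderiv ℝ v a‖ ≤
      (∫ a in closedBall x (r + ‖h‖), ‖g a‖) + ε / (2 + ‖h‖) := by
    calc _ ≤ ∫ a in closedBall x (r + ‖h‖), (‖g a‖ + ‖fderiv ℝ v a - g a‖) := by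
          refine integral_mono idv.norm.integrableOn (int_add a.ig.norm igv.norm).integrableOn
            fun b => ?_
          have := norm_add_le (g b) (fderiv ℝ v b - g b)
          simpa using this
      _ = (∫ a in closedBall x (r + ‖h‖), ‖g a‖) +
          ∫ a in closedBall x (r + ‖h‖), ‖fderiv ℝ v a - g a‖ :=
        integral_add a.ig.norm.integrableOn igv.norm.integrableOn
      _ ≤ _ := by
          gcongr
          exact (setIntegral_le_integral igv.norm
              (Eventually.of_forall fun _ => norm_nonneg _)).trans h2
  have h5 := mul_le_mul_of_nonneg_left h4 (norm_nonneg h)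
  have h6 : ε / (2 + ‖h‖) * (2 + ‖h‖) = ε := by field_simp
  linarith
end
end

noncomputable section
section
variable {n : ℕ}
local notation "E" => EuclideanSpace ℝ (Fin n)
variable {V W X : Type*} [NormedAddCommGroup V] [NormedSpace ℝ V] [NormedAddCommGroup W]
  [NormedSpace ℝ W] [NormedAddCommGroup X] [NormedSpace ℝ X]

lemma vball (x : E) {r : ℝ} (hr : 0 ≤ r) :
    volume.real (closedBall x r) = r ^ n * volume.real (ball (0 : E) 1) := by
  have := Measure.addHaar_real_closedBall (volume : Measure E) x hr
  rwa [finrank_euclideanSpace_fin] at this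

lemma vball_pos : 0 < volume.real (ball (0 : E) 1) :=
  ENNReal.toReal_pos (measure_ball_pos _ _ one_pos).ne' measure_ball_lt_top.ne

lemma osc_le [CompleteSpace V] {ψ Γ : E → ℝ} (K : KerPair n ψ Γ) {u : E → V} {g : E → E →L[ℝ] V}
    (a : W1 u g) (x : E) {τ : ℝ} (hτ : 0 < τ) :
    ∫ b in closedBall x τ, ∫ c in closedBall x τ, ‖u c - u b‖ ≤
      volume.real (closedBall x (2 * τ)) * (2 * τ * ∫ c in closedBall x (3 * τ), ‖g c‖) := by
  set B := closedBall x τ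
  set D := closedBall (0 : E) (2 * τ)
  have hfin : IsFiniteMeasure (volume.restrict D) :=
    ⟨by rw [Measure.restrict_apply_univ]; exact measure_closedBall_lt_top⟩
  have hfin' : IsFiniteMeasure (volume.restrict B) :=
    ⟨by rw [Measure.restrict_apply_univ]; exact measure_closedBall_lt_top⟩
  have i1 : Integrable (fun q : E × E => ‖u (q.1 + q.2) - u q.1‖)
      ((volume.restrict B).prod (volume.restrict D)) := by
    have h2 : Integrable (fun q : E × E => u q.1)
        ((volume.restrict B).prod (volume.restrict D)) := a.iu.integrableOn.comp_fst _
    have h1 : Integrable (fun q : E × E => u (q.1 + q.2))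
        ((volume.restrict B).prod (volume.restrict D)) := by
      have h3 : Integrable (fun q : E × E => u q.1) (volume.prod (volume.restrict D)) :=
        a.iu.comp_fst _
      have h5 := (measurePreserving_add_prod (volume : Measure E)
        (volume.restrict D)).integrable_comp_of_integrable h3
      exact Integrable.mono_measure h5 (Measure.prod_mono Measure.restrict_le_self le_rfl)
    exact (h1.sub h2).norm
  have hsw := integral_integral_swap (f := fun b h => ‖u (b + h) - u b‖) i1
  have h1 : ∫ b in B, ∫ c in B, ‖u c - u b‖ ≤ ∫ b in B, ∫ h in D, ‖u (b + h) - u b‖ := by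
    refine setIntegral_mono_on ?_ i1.integral_prod_left measurableSet_closedBall fun b hb => ?_
    · exact Integrable.integral_prod_left (f := fun q : E × E => ‖u q.2 - u q.1‖)
        ((a.iu.integrableOn.comp_snd _).sub (a.iu.integrableOn.comp_fst _)).norm
    · rw [← (measurePreserving_add_left volume b).setIntegral_preimage_emb
          (measurableEmbedding_addLeft _) (fun c => ‖u c - u b‖)]
      refine setIntegral_mono_set ?_ (Eventually.of_forall fun _ => norm_nonneg _)
          (Eventually.of_forall fun h hh => ?_)
      · exact ((a.iu.comp_add_left b).integrableOn.sub (integrable_const _)).norm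
      · change dist (b + h) x ≤ τ at hh
        change dist b x ≤ τ at hb
        change dist h 0 ≤ 2 * τ
        have := dist_triangle_right (b + h) b x
        rw [dist_eq_norm, add_sub_cancel_left] at this
        rw [dist_zero_right]; linarith
  refine h1.trans (hsw.le.trans ?_)
  rw [vball x (by positivity), ← vball 0 (by positivity), ← smul_eq_mul, ← setIntegral_const]
  refine setIntegral_mono_on i1.integral_prod_right (integrableOn_const measure_closedBall_lt_top.ne)
    measurableSet_closedBall fun h hh => ?_
  have hh' : ‖h‖ ≤ 2 * τ := mem_closedBall_zero_iff.1 hh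
  refine (a.transl K x h τ).trans ?_
  gcongr
  · exact Eventually.of_forall fun _ => norm_nonneg _
  · exact a.ig.norm.integrableOn
  · linarith

lemma mol_lower [CompleteSpace V] {ψ Γ : E → ℝ} (K : KerPair n ψ Γ) : ∃ C, 0 ≤ C ∧
    ∀ (u : E → V) (g : E → E →L[ℝ] V), W1 u g → ∀ (x : E) (τ : ℝ), 0 < τ →
    (∀ᵐ b, b ∈ closedBall x τ → ‖u b‖ = 1) →
    1 - ‖mol ψ τ u x‖ ≤ C * ((τ ^ n)⁻¹ * (τ * ∫ c in closedBall x (3 * τ), ‖g c‖)) := by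
  obtain ⟨M, hM0, hM⟩ := bdd_of_zero K.sψ.continuous K.zψ
  refine ⟨M * 2 ^ n * 2, by positivity, fun u g a x τ hτ h1 => ?_⟩
  set B := closedBall x τ with hB
  have hBf : volume B ≠ ⊤ := measure_closedBall_lt_top.ne
  have hb : ∀ b, ‖u b‖ = 1 → 1 - ‖mol ψ τ u x‖ ≤ M * ((τ ^ n)⁻¹ * ∫ c in B, ‖u c - u b‖) := by
    intro b hb
    have e : mol ψ τ u x - u b =
        gmol (ContinuousLinearMap.lsmul ℝ ℝ) ψ τ (fun c => u c - u b) x := by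
      have i1 := int_ker (ContinuousLinearMap.lsmul ℝ ℝ : ℝ →L[ℝ] V →L[ℝ] V) K.sψ.continuous K.zψ
        (s := τ) x a.iu
      simp only [ContinuousLinearMap.lsmul_apply] at i1
      have i1' := (i1.comp_sub_left x).comp_smul hτ.ne'
      simp only [sub_sub_cancel, inv_smul_smul₀ hτ.ne'] at i1'
      rw [gmol]
      simp only [ContinuousLinearMap.lsmul_apply, smul_sub]
      rw [integral_sub i1' (K.int.smul_const _), integral_smul_const, K.one, one_smul]
      rfl
    have h2 := gmol_bound (ContinuousLinearMap.lsmul ℝ ℝ : ℝ →L[ℝ] V →L[ℝ] V) hM K.zψ hτ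
      (u := fun c => u c - u b) x (a.iu.integrableOn.sub (integrableOn_const hBf))
    rw [← e] at h2
    have h3 := norm_sub_norm_le (u b) (mol ψ τ u x)
    rw [norm_sub_rev, hb] at h3
    refine h3.trans (h2.trans ?_)
    have : ‖(ContinuousLinearMap.lsmul ℝ ℝ : ℝ →L[ℝ] V →L[ℝ] V)‖ ≤ 1 :=
      ContinuousLinearMap.opNorm_lsmul_le
    gcongr
    exact mul_le_of_le_one_left hM0 this
  have hfin : IsFiniteMeasure (volume.restrict B) :=
    ⟨by rw [Measure.restrict_apply_univ]; exact measure_closedBall_lt_top⟩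
  have i2 : IntegrableOn (fun b => ∫ c in B, ‖u c - u b‖) B :=
    Integrable.integral_prod_left (f := fun q : E × E => ‖u q.2 - u q.1‖)
        ((a.iu.integrableOn.comp_snd _).sub (a.iu.integrableOn.comp_fst _)).norm
  have h3 : volume.real B * (1 - ‖mol ψ τ u x‖) ≤
      M * ((τ ^ n)⁻¹ * ∫ b in B, ∫ c in B, ‖u c - u b‖) := by
    rw [← smul_eq_mul, ← setIntegral_const, ← integral_const_mul, ← integral_const_mul]
    refine setIntegral_mono_on_ae (integrableOn_const hBf) ((i2.const_mul _).const_mul _)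
      measurableSet_closedBall ?_
    filter_upwards [h1] with b hb1 hbB using hb b (hb1 hbB)
  have h4 := osc_le K a x hτ
  rw [vball x (by positivity)] at h4 h3
  have hp := vball_pos (n := n)
  set ω := volume.real (ball (0 : E) 1)
  set G := ∫ c in closedBall x (3 * τ), ‖g c‖
  have h5 : τ ^ n * ω * (1 - ‖mol ψ τ u x‖) ≤
      τ ^ n * ω * (M * 2 ^ n * 2 * ((τ ^ n)⁻¹ * (τ * G))) := by
    refine h3.trans ?_
    calc _ ≤ M * ((τ ^ n)⁻¹ * ((2 * τ) ^ n * ω * (2 * τ * G))) := by gcongr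
      _ = _ := by rw [mul_pow]; ring
  exact le_of_mul_le_mul_left h5 (by positivity)

/-- Hilbert-Schmidt square -/
def hs (A : E →L[ℝ] V) : ℝ := ∑ i, ‖A (EuclideanSpace.single i 1)‖ ^ 2

lemma hs_nonneg (A : E →L[ℝ] V) : 0 ≤ hs A := Finset.sum_nonneg fun _ _ => by positivity

lemma hs_cont : Continuous (hs : (E →L[ℝ] V) → ℝ) := by unfold hs; fun_prop

lemma hs_ge (A : E →L[ℝ] V) : ‖A‖ ^ 2 ≤ hs A := by
  refine Real.le_sqrt (norm_nonneg _) (hs_nonneg A) |>.1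
    (A.opNorm_le_bound (Real.sqrt_nonneg _) fun v => ?_)
  have h1 : ‖A v‖ ≤ ∑ i, |v i| * ‖A (EuclideanSpace.single i 1)‖ := by
    conv_lhs => rw [sum_single v, map_sum]
    refine (norm_sum_le _ _).trans (Finset.sum_le_sum fun i _ => ?_)
    rw [map_smul, norm_smul, Real.norm_eq_abs]
  refine h1.trans ((Real.sum_mul_le_sqrt_mul_sqrt _ _ _).trans_eq ?_)
  simp only [sq_abs]
  rw [mul_comm, EuclideanSpace.norm_eq]
  simp [hs]

lemma hs_le (A : E →L[ℝ] V) : hs A ≤ n * ‖A‖ ^ 2 := by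
  unfold hs
  refine (Finset.sum_le_card_nsmul _ _ (‖A‖ ^ 2) fun i _ => ?_).trans_eq (by simp)
  gcongr
  simpa using A.le_opNorm (EuclideanSpace.single i 1)

lemma hs_add_le (A B : E →L[ℝ] V) : hs (A + B) ≤ 2 * hs A + 2 * hs B := by
  simp only [hs, Finset.mul_sum, ← Finset.sum_add_distrib]
  refine Finset.sum_le_sum fun i _ => ?_
  rw [add_apply]
  have := norm_add_le (A (EuclideanSpace.single i 1)) (B (EuclideanSpace.single i 1))
  nlinarith [sq_nonneg (‖A (EuclideanSpace.single i 1)‖ - ‖B (EuclideanSpace.single i 1)‖),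
    norm_nonneg (A (EuclideanSpace.single i 1) + B (EuclideanSpace.single i 1))]

lemma hs_post_le (L : V →L[ℝ] W) {c : ℝ} (A : E →L[ℝ] V) (hL : ∀ v, ‖L v‖ ≤ c * ‖v‖) :
    hs (L.comp A) ≤ c ^ 2 * hs A := by
  simp only [hs, Finset.mul_sum, ← mul_pow]
  exact Finset.sum_le_sum fun i _ => by
    gcongr
    exact hL _

lemma hs_fun (l : E →L[ℝ] ℝ) : ∑ i, (l (EuclideanSpace.single i 1)) ^ 2 = ‖l‖ ^ 2 := by
  set v := (InnerProductSpace.toDual ℝ E).symm l with hv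
  have h1 : ∀ w, l w = inner ℝ v w := fun w => by simp [hv]
  have h2 : ‖l‖ = ‖v‖ := by simp [hv]
  rw [h2, EuclideanSpace.norm_sq_eq]
  congr 1; funext i
  rw [h1]; simp [EuclideanSpace.inner_single_right]

lemma hs_pre_le {p : ℕ} (A : E →L[ℝ] EuclideanSpace ℝ (Fin p)) (B : E →L[ℝ] E) :
    hs (A.comp B) ≤ ‖B‖ ^ 2 * hs A := by
  have key : ∀ A : E →L[ℝ] EuclideanSpace ℝ (Fin p),
      hs A = ∑ j, ‖(EuclideanSpace.proj j : EuclideanSpace ℝ (Fin p) →L[ℝ] ℝ).comp A‖ ^ 2 := by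
    intro A
    simp_rw [← hs_fun, hs, EuclideanSpace.norm_sq_eq]
    rw [Finset.sum_comm]
    simp
  rw [key, key, Finset.mul_sum]
  refine Finset.sum_le_sum fun j _ => ?_
  rw [← mul_pow, mul_comm, ← ContinuousLinearMap.comp_assoc]
  gcongr
  exact ContinuousLinearMap.opNorm_comp_le _ _

lemma energy_eq {p : ℕ} (g : E → E →L[ℝ] EuclideanSpace ℝ (Fin p)) (x : E) :
    energyDensity n p g x = hs (g x) := by
  simp [energyDensity, hs, EuclideanSpace.norm_sq_eq]
end
end

noncomputable section
section
variable {n p : ℕ}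
local notation "E" => EuclideanSpace ℝ (Fin n)
local notation "F" => EuclideanSpace ℝ (Fin p)

def pbump : ContDiffBump (0 : F) := ⟨1/4, 1/3, by norm_num, by norm_num⟩

def prj (v : F) : F := (1 - pbump v) • (‖v‖⁻¹ • v)

lemma prj_zero : prj (0 : F) = 0 := by simp [prj]

lemma pbump_z {v : F} (hv : 1/3 < ‖v‖) : pbump v = 0 := by
  apply ContDiffBump.zero_of_le_dist
  simpa [pbump] using hv.le

lemma prj_eq {v : F} (hv : 1/3 < ‖v‖) : prj v = ‖v‖⁻¹ • v := by
  rw [prj, pbump_z hv]; simp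

lemma prj_norm {v : F} (hv : 1/3 < ‖v‖) : ‖prj v‖ = 1 := by
  have : ‖v‖ ≠ 0 := by linarith
  rw [prj_eq hv, norm_smul, norm_inv, norm_norm, inv_mul_cancel₀ this]

lemma prj_self {v : F} (hv : ‖v‖ = 1) : prj v = v := by
  rw [prj_eq (by rw [hv]; norm_num), hv]; simp

lemma prj_smooth : ContDiff ℝ 1 (prj : F → F) := by
  rw [contDiff_iff_contDiffAt]
  intro v
  by_cases hv : v = 0
  · subst hv
    refine contDiffAt_const (c := 0) |>.congr_of_eventuallyEq ?_
    filter_upwards [closedBall_mem_nhds (0 : F) (show (0:ℝ) < 1/4 by norm_num)] with w hw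
    have : pbump w = 1 := ContDiffBump.one_of_mem_closedBall _ hw
    simp [prj, this]
  · refine ContDiffAt.smul (contDiffAt_const.sub pbump.contDiffAt) ?_
    exact ((contDiffAt_norm ℝ hv).inv (by simpa using hv)).smul contDiffAt_id

lemma prj_fderiv {v : F} (hv : 1/3 < ‖v‖) (w : F) : ‖fderiv ℝ prj v w‖ ≤ ‖v‖⁻¹ * ‖w‖ := by
  have hn : 0 < ‖v‖ := by linarith
  have hv0 : v ≠ 0 := norm_pos_iff.1 hn
  have hop : ∀ᶠ x : F in nhds v, 1/3 < ‖x‖ := continuous_norm.continuousAt.eventually (lt_mem_nhds hv)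
  have h1 : HasFDerivAt prj (fderiv ℝ prj v) v :=
    (prj_smooth.differentiable (by norm_num)).differentiableAt.hasFDerivAt
  have h2 := (((contDiffAt_norm ℝ hv0).differentiableAt (by norm_num : (1 : WithTop ℕ∞) ≠ 0))).hasFDerivAt
  have h3 : HasFDerivAt (fun x : F => x) (ContinuousLinearMap.id ℝ F) v := hasFDerivAt_id v
  have h4 := (h2.smul h1).unique (h3.congr_of_eventuallyEq (by
    filter_upwards [hop] with x hx
    simp only [Pi.smul_apply', prj_eq hx]
    rw [smul_smul, mul_inv_cancel₀ (by linarith), one_smul]))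
  have h5 := h1.norm_sq.unique ((hasFDerivAt_const (1:ℝ) v).congr_of_eventuallyEq (by
    filter_upwards [hop] with x hx
    simp only [prj_norm hx]; norm_num))
  have h6 := DFunLike.congr_fun h4 w
  have h7 := DFunLike.congr_fun h5 w
  simp at h6 h7
  set Q := fderiv ℝ prj v w
  set a := fderiv ℝ norm v w
  have h8 : ‖w‖ ^ 2 = a ^ 2 + ‖v‖ ^ 2 * ‖Q‖ ^ 2 := by
    rw [← h6, norm_add_sq_real, norm_smul, norm_smul, inner_smul_left, inner_smul_right,
      real_inner_comm, h7, prj_norm hv]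
    simp; ring
  rw [inv_mul_eq_div, le_div_iff₀ hn, mul_comm]
  refine abs_le_of_sq_le_sq' ?_ (norm_nonneg w) |>.2
  rw [mul_pow, h8]; nlinarith [sq_nonneg a]

lemma prj_bdd : ∃ M, 0 ≤ M ∧ ∀ v : F, ‖fderiv ℝ prj v‖ ≤ M := by
  obtain ⟨M, hM⟩ := (isCompact_closedBall (0 : F) (1/3)).exists_bound_of_continuousOn
    (prj_smooth.continuous_fderiv (by norm_num)).continuousOn
  refine ⟨max M 3, by positivity, fun v => ?_⟩
  by_cases hv : ‖v‖ ≤ 1/3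
  · exact (hM v (by simpa using hv)).trans (le_max_left _ _)
  · push Not at hv
    refine ContinuousLinearMap.opNorm_le_bound _ (by positivity) fun w => (prj_fderiv hv w).trans ?_
    gcongr
    refine le_trans ?_ (le_max_right _ _)
    rw [inv_le_comm₀ (by linarith) (by norm_num)]; linarith

/-- local weak gradient, vector form -/
structure WL (Ω : Set E) (u : E → F) (g : E → E →L[ℝ] F) : Prop where
  iu : LocallyIntegrableOn u Ω
  ig : LocallyIntegrableOn g Ω
  ibp : ∀ φ : E → ℝ, ContDiff ℝ (⊤ : ℕ∞) φ → HasCompactSupport φ → tsupport φ ⊆ Ω →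
    ∀ i, ∫ x, fderiv ℝ φ x (EuclideanSpace.single i 1) • u x
      = - ∫ x, φ x • g x (EuclideanSpace.single i 1)

lemma int_of_supp {V : Type*} [NormedAddCommGroup V] {s : Set E} {f : E → V}
    (h : IntegrableOn f s) (hs : ∀ x, x ∉ s → f x = 0) : Integrable f := by
  rwa [integrableOn_iff_integrable_of_support_subset] at h
  exact fun x hx => by_contra fun h => hx (hs x h)

lemma int_loc {V : Type*} [NormedAddCommGroup V] [NormedSpace ℝ V] {Ω : Set E} {u : E → V}
    (hu : LocallyIntegrableOn u Ω) {φ : E → ℝ}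
    (hφ : Continuous φ) (hc : HasCompactSupport φ) (hs : tsupport φ ⊆ Ω) :
    Integrable (fun x => φ x • u x) := by
  have h1 := hu.integrableOn_compact_subset hs hc
  have h2 : IntegrableOn (fun x => φ x • u x) (tsupport φ) :=
    IntegrableOn.continuousOn_smul h1 hφ.continuousOn hc
  exact int_of_supp h2 fun x hx => by rw [image_eq_zero_of_notMem_tsupport hx, zero_smul]

lemma fd_supp {φ : E → ℝ} {Ω : Set E} (hs : tsupport φ ⊆ Ω) (w : E) :
    tsupport (fun x => fderiv ℝ φ x w) ⊆ Ω :=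
  (tsupport_fderiv_apply_subset ℝ w).trans hs

lemma setInt_eq {V : Type*} [NormedAddCommGroup V] [NormedSpace ℝ V] {φ : E → ℝ} {Ω : Set E}
    (hs : tsupport φ ⊆ Ω) (u : E → V) : ∫ x in Ω, φ x • u x = ∫ x, φ x • u x := by
  apply setIntegral_eq_integral_of_forall_compl_eq_zero
  intro x hx
  rw [image_eq_zero_of_notMem_tsupport (fun h => hx (hs h)), zero_smul]

lemma int_coord {f : E → F} (hf : Integrable f)
    (j : Fin p) : (∫ x, f x) j = ∫ x, f x j :=
  ((EuclideanSpace.proj (𝕜 := ℝ) j : F →L[ℝ] ℝ).integral_comp_comm hf).symm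

lemma wl_iff {Ω : Set E} {u : E → F} {g : E → E →L[ℝ] F} :
    HasWeakGradient n p Ω u g ↔ WL Ω u g := by
  have key : ∀ (_ : LocallyIntegrableOn u Ω) (_ : LocallyIntegrableOn g Ω),
      ∀ φ : E → ℝ, ContDiff ℝ (⊤ : ℕ∞) φ → HasCompactSupport φ → tsupport φ ⊆ Ω → ∀ i (j : Fin p),
      (∫ x in Ω, u x j * fderiv ℝ φ x (EuclideanSpace.single i 1) =
        (∫ x, fderiv ℝ φ x (EuclideanSpace.single i 1) • u x) j) ∧
      (∫ x in Ω, φ x * g x (EuclideanSpace.single i 1) j =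
        (∫ x, φ x • g x (EuclideanSpace.single i 1)) j) := by
    intro iu ig φ hφ hc hs i j
    have hfd := fd_cont hφ hc (EuclideanSpace.single i 1)
    have ig' : LocallyIntegrableOn (fun x => g x (EuclideanSpace.single i 1)) Ω := by
      intro x hx
      obtain ⟨s, hs, h⟩ := ig x hx
      exact ⟨s, hs, h.apply_continuousLinearMap _⟩
    constructor
    · rw [int_coord (int_loc iu hfd.1.continuous hfd.2 (fd_supp hs _))]
      refine Eq.trans ?_ (setInt_eq (fd_supp hs (EuclideanSpace.single i 1)) (fun x => u x j))
      simp only [smul_eq_mul, mul_comm]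
    · rw [int_coord (int_loc ig' hφ.continuous hc hs)]
      exact setInt_eq hs (fun x => g x (EuclideanSpace.single i 1) j)
  constructor
  · rintro ⟨iu, ig, h⟩
    refine ⟨iu, ig, fun φ hφ hc hs i => ?_⟩
    ext j
    have := h φ hφ hc hs i j
    rw [(key iu ig φ hφ hc hs i j).1, (key iu ig φ hφ hc hs i j).2] at this
    simpa using this
  · rintro ⟨iu, ig, h⟩
    refine ⟨iu, ig, fun φ hφ hc hs i j => ?_⟩
    rw [(key iu ig φ hφ hc hs i j).1, (key iu ig φ hφ hc hs i j).2, h φ hφ hc hs i]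
    simp

lemma w1_basis {u : E → F} {g : E → E →L[ℝ] F} (iu : Integrable u) (ig : Integrable g)
    (h : ∀ φ : E → ℝ, ContDiff ℝ (⊤ : ℕ∞) φ → HasCompactSupport φ → ∀ i,
      ∫ x, fderiv ℝ φ x (EuclideanSpace.single i 1) • u x
      = - ∫ x, φ x • g x (EuclideanSpace.single i 1)) : W1 u g := by
  refine ⟨iu, ig, fun φ hφ hc w => ?_⟩
  have e1 : ∀ x, fderiv ℝ φ x w • u x =
      ∑ i, w i • (fderiv ℝ φ x (EuclideanSpace.single i 1) • u x) := fun x => by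
    conv_lhs => rw [sum_single w, map_sum, Finset.sum_smul]
    simp only [map_smul, smul_assoc]
  have e2 : ∀ x, φ x • g x w =
      ∑ i, w i • (φ x • g x (EuclideanSpace.single i 1)) := fun x => by
    conv_lhs => rw [sum_single w, map_sum, Finset.smul_sum]
    simp only [map_smul, smul_comm (φ x)]
  simp_rw [e1, e2]
  rw [integral_finsetSum, integral_finsetSum, ← Finset.sum_neg_distrib]
  · refine Finset.sum_congr rfl fun i _ => ?_
    rw [integral_smul, integral_smul, h φ hφ hc i, smul_neg]
  · exact fun i _ => Integrable.smul (w i) (int_smul hφ.continuous hc (int_app ig (EuclideanSpace.single i 1)))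
  · exact fun i _ => Integrable.smul (w i) (int_smul (fd_cont hφ hc (EuclideanSpace.single i 1)).1.continuous (fd_cont hφ hc (EuclideanSpace.single i 1)).2 iu)

lemma WL.app {Ω : Set E} {g : E → E →L[ℝ] F} (ig : LocallyIntegrableOn g Ω) (w : E) :
    LocallyIntegrableOn (fun x => g x w) Ω := by
  intro x hx
  obtain ⟨s, hs, h⟩ := ig x hx
  exact ⟨s, hs, h.apply_continuousLinearMap _⟩

lemma int_smulRight {V : Type*} [NormedAddCommGroup V] [NormedSpace ℝ V] {Ω : Set E} {u : E → V}
    (hu : LocallyIntegrableOn u Ω) {L : E → E →L[ℝ] ℝ}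
    (hφ : Continuous L) (hc : HasCompactSupport L) (hs : tsupport L ⊆ Ω) :
    Integrable (fun x => (L x).smulRight (u x)) := by
  have h1 := hu.integrableOn_compact_subset hs hc
  obtain ⟨M, hM⟩ := hφ.bounded_above_of_compact_support hc
  have h2 : IntegrableOn (fun x => (L x).smulRight (u x)) (tsupport L) := by
    refine (h1.norm.const_mul M).mono' ?_ (Eventually.of_forall fun x => ?_)
    · exact ((ContinuousLinearMap.smulRightL ℝ E V).continuous₂).comp_aestronglyMeasurable₂
        hφ.aestronglyMeasurable h1.aestronglyMeasurable
    · rw [ContinuousLinearMap.norm_smulRight_apply]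
      gcongr; exact hM x
  exact int_of_supp h2 fun x hx => by rw [image_eq_zero_of_notMem_tsupport hx]; ext; simp

lemma WL.cutoff {Ω : Set E} {u : E → F} {g : E → E →L[ℝ] F} (a : WL Ω u g) {ζ : E → ℝ}
    (hζ : ContDiff ℝ (⊤ : ℕ∞) ζ) (hc : HasCompactSupport ζ) (hs : tsupport ζ ⊆ Ω) :
    W1 (fun x => ζ x • u x) (fun x => ζ x • g x + (fderiv ℝ ζ x).smulRight (u x)) := by
  have i1 := int_loc a.ig hζ.continuous hc hs
  have i2 := int_smulRight a.iu (hζ.continuous_fderiv (by simp)) (hc.fderiv (𝕜 := ℝ))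
      ((tsupport_fderiv_subset ℝ).trans hs)
  refine w1_basis (int_loc a.iu hζ.continuous hc hs) (int_add i1 i2) fun φ hφ hcφ i => ?_
  set e : E := EuclideanSpace.single i 1
  have hm := a.ibp (fun x => φ x * ζ x) (hφ.mul hζ) hcφ.mul_right
    ((closure_mono (fun x hx => by
      have := hx; simp only [Function.mem_support] at *; exact right_ne_zero_of_mul this)).trans hs) i
  have hfd : ∀ x, fderiv ℝ (fun x => φ x * ζ x) x e = fderiv ℝ φ x e * ζ x + φ x * fderiv ℝ ζ x e := by
    intro x
    rw [fderiv_fun_mul (hφ.differentiable (by simp) x) (hζ.differentiable (by simp) x)]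
    simp; ring
  have j1 : Integrable (fun x => fderiv ℝ φ x e • (ζ x • u x)) :=
    int_smul (fd_cont hφ hcφ e).1.continuous (fd_cont hφ hcφ e).2 (int_loc a.iu hζ.continuous hc hs)
  have j2 : Integrable (fun x => φ x • (fderiv ℝ ζ x e • u x)) :=
    int_smul hφ.continuous hcφ (int_loc a.iu (fd_cont hζ hc e).1.continuous (fd_cont hζ hc e).2
      (fd_supp hs e))
  have j3 : Integrable (fun x => φ x • (ζ x • g x e)) :=
    int_smul hφ.continuous hcφ (int_loc (WL.app a.ig e) hζ.continuous hc hs)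
  have k1 : ∫ x, fderiv ℝ (fun x => φ x * ζ x) x e • u x =
      (∫ x, fderiv ℝ φ x e • (ζ x • u x)) + ∫ x, φ x • (fderiv ℝ ζ x e • u x) := by
    rw [← integral_add j1 j2]
    refine integral_congr_ae (Eventually.of_forall fun x => ?_)
    simp only [hfd, add_smul, smul_smul]
  have k2 : ∫ x, φ x • (ζ x • g x + (fderiv ℝ ζ x).smulRight (u x)) e =
      (∫ x, (φ x * ζ x) • g x e) + ∫ x, φ x • (fderiv ℝ ζ x e • u x) := by
    simp only [mul_smul]
    rw [← integral_add j3 j2]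
    refine integral_congr_ae (Eventually.of_forall fun x => ?_)
    simp
  rw [k1] at hm
  rw [k2, eq_sub_of_add_eq hm]
  abel
end
end

noncomputable section
section
variable {n p : ℕ}
local notation "E" => EuclideanSpace ℝ (Fin n)
local notation "F" => EuclideanSpace ℝ (Fin p)

structure LMin (y : E) (R : ℝ) (u : E → F) (g : E → E →L[ℝ] F) : Prop where
  w : W1 u g
  ie : Integrable (fun x => hs (g x))
  bd : ∀ᵐ x, ‖u x‖ ≤ 1
  one : ∀ᵐ x, x ∈ ball y R → ‖u x‖ = 1
  mini : ∀ v h σ, σ < R → W1 v h → Integrable (fun x => hs (h x)) →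
    (∀ᵐ x, x ∉ closedBall y σ → v x = u x) → (∀ᵐ x, x ∈ ball y R → 1/2 ≤ ‖v x‖) →
    ∫ x in ball y R, hs (g x) ≤ ∫ x in ball y R, hs (h x) / ‖v x‖ ^ 2

lemma hs_smul (c : ℝ) (A : E →L[ℝ] F) : hs (c • A) = c ^ 2 * hs A := by
  simp [hs, norm_smul, mul_pow, Finset.mul_sum]

lemma hs_smulRight (l : E →L[ℝ] ℝ) (v : F) : hs (l.smulRight v) = ‖l‖ ^ 2 * ‖v‖ ^ 2 := by
  rw [← hs_fun]
  simp [hs, norm_smul, mul_pow, Finset.sum_mul]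

lemma hs_meas {g : E → E →L[ℝ] F} {μ : Measure E} (hg : AEStronglyMeasurable g μ) :
    AEStronglyMeasurable (fun x => hs (g x)) μ := hs_cont.comp_aestronglyMeasurable hg

lemma int_addm {V : Type*} [NormedAddCommGroup V] {μ : Measure E} {f g : E → V}
    (hf : Integrable f μ) (hg : Integrable g μ) : Integrable (fun x => f x + g x) μ := hf.add hg

lemma int_sq {V : Type*} [NormedAddCommGroup V] {L : E → V} (h : Continuous L)
    (hc : HasCompactSupport L) : Integrable (fun x => ‖L x‖ ^ 2) := by
  have h1 : Continuous (fun x => ‖L x‖ ^ 2) := by fun_prop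
  have h2 : HasCompactSupport (fun x => ‖L x‖ ^ 2) := hc.mono fun x hx h0 => hx (by
    simp only [h0, norm_zero]; norm_num)
  exact h1.integrable_of_hasCompactSupport h2

lemma hs_int_add {g h : E → E →L[ℝ] F} {μ : Measure E} (mg : AEStronglyMeasurable g μ)
    (mh : AEStronglyMeasurable h μ) (ig : Integrable (fun x => hs (g x)) μ)
    (ih : Integrable (fun x => hs (h x)) μ) : Integrable (fun x => hs (g x + h x)) μ := by
  refine ((ig.const_mul 2).add (ih.const_mul 2)).mono' (hs_meas (mg.add mh))
    (Eventually.of_forall fun x => ?_)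
  rw [Real.norm_of_nonneg (hs_nonneg _)]
  exact hs_add_le _ _

lemma hs_loc_add {g h : E → E →L[ℝ] F} {Ω : Set E} (mg : LocallyIntegrableOn g Ω)
    (mh : Integrable h) (ig : LocallyIntegrableOn (fun x => hs (g x)) Ω)
    (ih : Integrable (fun x => hs (h x))) : LocallyIntegrableOn (fun x => hs (g x + h x)) Ω := by
  intro x hx
  obtain ⟨s, hs1, h1⟩ := mg x hx
  obtain ⟨t, ht1, h2⟩ := ig x hx
  exact ⟨s ∩ t, inter_mem hs1 ht1, hs_int_add (h1.mono_set inter_subset_left).aestronglyMeasurable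
    mh.aestronglyMeasurable.restrict (h2.mono_set inter_subset_right) ih.integrableOn⟩

lemma hs_int_post {h : E → E →L[ℝ] F} {v : E → F} (mv : AEStronglyMeasurable v)
    (mh : AEStronglyMeasurable h)
    (ih : Integrable (fun x => hs (h x))) :
    Integrable (fun x => hs ((fderiv ℝ prj (v x)).comp (h x))) := by
  obtain ⟨M, hM0, hM⟩ := prj_bdd (p := p)
  refine (ih.const_mul (M ^ 2)).mono' (hs_meas ?_) (Eventually.of_forall fun x => ?_)
  · exact (isBoundedBilinearMap_comp.continuous).comp_aestronglyMeasurable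
      (((prj_smooth.continuous_fderiv (by norm_num)).comp_aestronglyMeasurable mv).prodMk mh)
  · rw [Real.norm_of_nonneg (hs_nonneg _)]
    exact hs_post_le _ _ fun w => (ContinuousLinearMap.le_opNorm _ _).trans (by gcongr; exact hM _)

lemma WL.addW1 {Ω : Set E} {u f : E → F} {g k : E → E →L[ℝ] F} (a : WL Ω u g) (b : W1 f k) :
    WL Ω (fun x => u x + f x) (fun x => g x + k x) := by
  refine ⟨a.iu.add (b.iu.locallyIntegrable.locallyIntegrableOn _), ?_, fun φ hφ hc hs i => ?_⟩
  · intro x hx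
    obtain ⟨s, hs1, h1⟩ := a.ig x hx
    exact ⟨s, hs1, int_addm h1 b.ig.integrableOn⟩
  · have hfd := fd_cont hφ hc (EuclideanSpace.single i 1)
    simp only [smul_add, ContinuousLinearMap.add_apply]
    rw [integral_add (int_loc a.iu hfd.1.continuous hfd.2 (fd_supp hs _))
      (int_smul hfd.1.continuous hfd.2 b.iu), integral_add (int_loc (WL.app a.ig _) hφ.continuous hc hs)
      (int_smul hφ.continuous hc (int_app b.ig _)), a.ibp φ hφ hc hs, b.ibp φ hφ hc, neg_add]

set_option maxHeartbeats 600000 in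
lemma lmin_of {ψ Γ : E → ℝ} (K : KerPair n ψ Γ) {Ω : Set E} (hΩ : IsOpen Ω) {u : E → F}
    {g : E → E →L[ℝ] F} (hu : IsEnergyMinimizingToSphere n p Ω u g) {y : E} {R : ℝ} (hR : 0 < R)
    (hB : closedBall y R ⊆ Ω) : ∃ u' g', LMin y R u' g' ∧ (∀ x ∈ closedBall y R, u' x = u x) ∧
      ∀ x ∈ ball y R, g' x = g x := by
  obtain ⟨hw, he, h1, hmin⟩ := hu
  rw [wl_iff] at hw
  rw [ae_restrict_iff' hΩ.measurableSet] at h1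
  have he' : energyDensity n p g = fun x => hs (g x) := funext fun x => energy_eq g x
  rw [he'] at he
  obtain ⟨δ, hδ, hδΩ⟩ := (isCompact_closedBall y R).exists_cthickening_subset_open hΩ hB
  rw [cthickening_closedBall hδ.le hR.le] at hδΩ
  let ζ : ContDiffBump y := ⟨R, δ + R, hR, by linarith⟩
  have hζs : tsupport ζ ⊆ Ω := by rw [ζ.tsupport_eq]; exact hδΩ
  have hζ1 : ∀ x ∈ closedBall y R, ζ x = 1 := fun x hx => ζ.one_of_mem_closedBall hx
  have hζd : ∀ x ∈ ball y R, fderiv ℝ ζ x = 0 := fun x hx => by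
    have : (ζ : E → ℝ) =ᶠ[nhds x] fun _ => 1 := by
      filter_upwards [isOpen_ball.mem_nhds hx] with z hz using hζ1 z (ball_subset_closedBall hz)
    rw [this.fderiv_eq]; simp
  set u' : E → F := fun x => ζ x • u x with hu'
  set g' : E → E →L[ℝ] F := fun x => ζ x • g x + (fderiv ℝ ζ x).smulRight (u x) with hg'
  have eu : ∀ x ∈ closedBall y R, u' x = u x := fun x hx => by simp [u', hζ1 x hx]
  have eg : ∀ x ∈ ball y R, g' x = g x := fun x hx => by
    simp [g', hζ1 x (ball_subset_closedBall hx), hζd x hx]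
  have w' : W1 u' g' := hw.cutoff ζ.contDiff ζ.hasCompactSupport hζs
  have ie' : Integrable (fun x => hs (g' x)) := by
    refine hs_int_add ?_ ?_ ?_ ?_
    · exact (int_loc hw.ig ζ.continuous ζ.hasCompactSupport hζs).aestronglyMeasurable
    · exact (int_smulRight hw.iu (ζ.contDiff.continuous_fderiv (n := 1) (by simp))
        (ζ.hasCompactSupport.fderiv (𝕜 := ℝ))
        ((tsupport_fderiv_subset ℝ).trans hζs)).aestronglyMeasurable
    · simp only [hs_smul]
      have := int_loc he (φ := fun x => ζ x ^ 2) (ζ.continuous.pow 2)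
        (ζ.hasCompactSupport.comp_left (g := fun t => t ^ 2) (by simp))
        ((closure_mono fun x hx => by
          simp only [Function.mem_support] at *; exact fun h => hx (by simp [h])).trans hζs)
      simpa using this
    · have hc1 : Continuous (fderiv ℝ ζ) := ζ.contDiff.continuous_fderiv (n := 1) (by simp)
      have hi : Integrable (fun x => ‖fderiv ℝ ζ x‖ ^ 2) :=
        int_sq hc1 (ζ.hasCompactSupport.fderiv (𝕜 := ℝ))
      refine hi.congr ?_
      filter_upwards [h1] with x hx
      rw [hs_smulRight]
      by_cases hxΩ : x ∈ Ω
      · rw [hx hxΩ]; simp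
      · have : fderiv ℝ ζ x = 0 := image_eq_zero_of_notMem_tsupport
          (fun h => hxΩ (((tsupport_fderiv_subset ℝ).trans hζs) h))
        simp [this]
  have hone : ∀ᵐ x, x ∈ ball y R → ‖u' x‖ = 1 := by
    filter_upwards [h1] with x hx hxb
    rw [eu x (ball_subset_closedBall hxb)]; exact hx (hB (ball_subset_closedBall hxb))
  refine ⟨u', g', ⟨w', ie', ?_, hone, ?_⟩, eu, eg⟩
  · filter_upwards [h1] with x hx
    by_cases hxΩ : x ∈ Ω
    · simp only [u', norm_smul, hx hxΩ, mul_one, Real.norm_of_nonneg ζ.nonneg]; exact ζ.le_one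
    · have : ζ x = 0 := image_eq_zero_of_notMem_tsupport (fun h => hxΩ (hζs h))
      simp [u', this]
  intro v h σ hσ wv ih hvu hv2
  obtain ⟨M, hM0, hM⟩ := prj_bdd (p := p)
  have wP := wv.chain K prj_smooth prj_zero hM
  have wQ := w'.chain K prj_smooth prj_zero hM
  have wD := wP.sub wQ
  have hz := (w'.sub wQ).zero_on isOpen_ball (O := ball y R) (by
    filter_upwards [hone] with x hx hxb
    rw [prj_self (hx hxb), sub_self])
  have hcmp := hmin y R hR hB _ _ (wl_iff.2 (hw.addW1 wD)) ?_ ?_ ?_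
  · simp only [energy_eq] at hcmp
    have e1 : ∫ x in ball y R, hs (g' x) = ∫ x in ball y R, hs (g x) :=
      setIntegral_congr_fun measurableSet_ball fun x hx => by simp only [eg x hx]
    rw [e1]
    refine hcmp.trans ?_
    refine integral_mono_of_nonneg (Eventually.of_forall fun x => hs_nonneg _) ?_ ?_
    · have hm : AEStronglyMeasurable (fun x => hs (h x) / ‖v x‖ ^ 2) (volume.restrict (ball y R)) :=
        (((hs_meas wv.ig.aestronglyMeasurable).aemeasurable.div
          (wv.iu.aestronglyMeasurable.norm.aemeasurable.pow_const 2))).aestronglyMeasurable.restrict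
      refine (ih.integrableOn.const_mul 4).mono' hm ?_
      rw [ae_restrict_iff' measurableSet_ball]
      filter_upwards [hv2] with x hx hxb
      have h2 := hx hxb
      rw [Real.norm_of_nonneg (div_nonneg (hs_nonneg _) (by positivity)),
        div_le_iff₀ (by positivity)]
      nlinarith [hs_nonneg (h x), mul_nonneg (hs_nonneg (h x)) (show 0 ≤ 4 * ‖v x‖ ^ 2 - 1 by nlinarith)]
    · rw [EventuallyLE, ae_restrict_iff' measurableSet_ball]
      filter_upwards [hv2, hz] with x hx hzx hxb
      have h2 := hx hxb
      have h3 := sub_eq_zero.1 (hzx hxb)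
      rw [← h3, eg x hxb, add_sub_cancel]
      refine (hs_post_le _ _ fun w => prj_fderiv (by linarith) w).trans_eq ?_
      rw [inv_pow, inv_mul_eq_div]
  · have hB1 := hs_int_post wv.iu.aestronglyMeasurable wv.ig.aestronglyMeasurable ih
    have hB2 := hs_int_post w'.iu.aestronglyMeasurable w'.ig.aestronglyMeasurable ie'
    have hB2' : Integrable (fun x => hs (-(fderiv ℝ prj (u' x)).comp (g' x))) := by
      simpa [hs] using hB2
    rw [funext (energy_eq _)]
    refine hs_loc_add hw.ig wD.ig he ?_
    simp only [sub_eq_add_neg]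
    exact hs_int_add wP.ig.aestronglyMeasurable wQ.ig.aestronglyMeasurable.neg hB1 hB2'
  · rw [ae_restrict_iff' hΩ.measurableSet]
    filter_upwards [h1, hone, hvu, hv2] with x h1 h2 h3 h4 hxΩ
    by_cases hxb : x ∈ ball y R
    · rw [prj_self (h2 hxb), eu x (ball_subset_closedBall hxb), add_sub_cancel]
      exact prj_norm (by linarith [h4 hxb])
    · have : x ∉ closedBall y σ := fun h => hxb (closedBall_subset_ball hσ h)
      rw [h3 this, sub_self, add_zero]; exact h1 hxΩ
  · obtain ⟨σ', h1, h2⟩ := exists_between hσ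
    refine ⟨σ', h2, ?_⟩
    refine ae_restrict_of_ae_restrict_of_subset (t := (ball y σ')ᶜ) (fun x hx => hx.2) ?_
    rw [ae_restrict_iff' measurableSet_ball.compl]
    filter_upwards [hvu] with x hx hxb
    rw [hx (fun h => hxb (closedBall_subset_ball h1 h)), sub_self, add_zero]
end
end

noncomputable section
section
variable {n p : ℕ}
local notation "E" => EuclideanSpace ℝ (Fin n)
local notation "F" => EuclideanSpace ℝ (Fin p)

lemma el_real {e b d m k t m0 k0 s : ℝ} (he : 0 ≤ e) (hd : 0 ≤ d) (hm : |m| ≤ m0) (hk : 0 ≤ k)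
    (hk0 : k ≤ k0) (ht : 0 < t) (ht1 : t ≤ 1) (hs : s = 1 + 2 * t * m + t ^ 2 * k) (hs4 : 1/4 ≤ s) :
    (e + 2 * t * b + t ^ 2 * d) / s ≤ e + t * (2 * b - 2 * (e * m)) +
      t ^ 2 * (4 * (d + (2 * |b| + 2 * e * m0) * (2 * m0 + k0))) := by
  have hm0 : 0 ≤ m0 := (abs_nonneg _).trans hm
  rw [div_le_iff₀ (by linarith)]
  have h1 : -((2 * b - 2 * (e * m)) * (2 * m + t * k)) ≤
      (2 * |b| + 2 * e * m0) * (2 * m0 + k0) := by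
    refine (neg_le_abs _).trans ?_
    rw [abs_mul]
    gcongr
    · refine (abs_sub _ _).trans ?_
      rw [abs_mul, abs_mul, abs_mul, abs_of_nonneg he]; norm_num
      nlinarith
    · refine (abs_add_le _ _).trans ?_
      rw [abs_mul, abs_mul, abs_of_nonneg hk, abs_of_pos ht]; norm_num
      nlinarith
  set Z := (2 * |b| + 2 * e * m0) * (2 * m0 + k0) with hZ
  have hZ0 : 0 ≤ Z := by
    have : 0 ≤ k0 := hk.trans hk0
    positivity
  have h2 : 0 ≤ (d + Z) * (4 * s - 1) := mul_nonneg (by linarith) (by linarith)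
  have h3 : d - k * e - (2 * b - 2 * (e * m)) * (2 * m + t * k) ≤ 4 * (d + Z) * s := by
    nlinarith [mul_nonneg hk he]
  have h4 := mul_le_mul_of_nonneg_left h3 (sq_nonneg t)
  have h5 : (t * (2 * b - 2 * (e * m))) * s = t * (2 * b - 2 * (e * m)) +
      t ^ 2 * ((2 * b - 2 * (e * m)) * (2 * m + t * k)) := by rw [hs]; ring
  have h6 : e * s = e + 2 * t * m * e + t ^ 2 * k * e := by rw [hs]; ring
  nlinarith

lemma lim_nonneg {A D t0 : ℝ} (h0 : 0 < t0) (h : ∀ t, 0 < t → t ≤ t0 → 0 ≤ A + t * D) : 0 ≤ A := by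
  by_contra hA
  push Not at hA
  have hD : 0 < D := by nlinarith [h t0 h0 le_rfl]
  have := h (min t0 (-A / (2 * D))) (lt_min h0 (by apply div_pos <;> linarith)) (min_le_left _ _)
  have h3 : min t0 (-A / (2 * D)) * D ≤ -A / 2 := by
    calc _ ≤ -A / (2 * D) * D := by gcongr; exact min_le_right _ _
      _ = -A / 2 := by field_simp
  linarith

lemma supp_ball {φ : E → ℝ} (hc : HasCompactSupport φ) {y : E} {R : ℝ}
    (h : tsupport φ ⊆ ball y R) : ∃ σ < R, tsupport φ ⊆ closedBall y σ := by
  by_cases hne : (tsupport φ).Nonempty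
  · obtain ⟨x, hx, hmax⟩ := hc.isCompact.exists_isMaxOn hne (f := fun z => dist z y) (by fun_prop)
    exact ⟨dist x y, h hx, fun z hz => hmax hz⟩
  · rw [not_nonempty_iff_eq_empty] at hne
    exact ⟨R - 1, by linarith, by simp [hne]⟩

lemma hs_expand (A : E →L[ℝ] F) (l : E →L[ℝ] ℝ) (a : F) (t : ℝ) :
    hs (A + t • l.smulRight a) = hs A + 2 * t * (∑ i, l (EuclideanSpace.single i 1) *
      inner ℝ (A (EuclideanSpace.single i 1)) a) + t ^ 2 * (‖l‖ ^ 2 * ‖a‖ ^ 2) := by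
  rw [← hs_smulRight]
  simp only [hs, Finset.mul_sum, ← Finset.sum_add_distrib]
  refine Finset.sum_congr rfl fun i _ => ?_
  simp only [ContinuousLinearMap.add_apply, ContinuousLinearMap.smul_apply,
    ContinuousLinearMap.smulRight_apply]
  rw [norm_add_sq_real, inner_smul_right, inner_smul_right, norm_smul t, mul_pow]
  simp
  ring

lemma LMin.el1 {y : E} {R : ℝ} {u : E → F} {g : E → E →L[ℝ] F} (L : LMin y R u g) {φ : E → ℝ}
    (hφ : ContDiff ℝ (⊤ : ℕ∞) φ) (hc : HasCompactSupport φ) (hs' : tsupport φ ⊆ ball y R) (a : F) :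
    Integrable (fun x => ∑ i, fderiv ℝ φ x (EuclideanSpace.single i 1) *
      inner ℝ (g x (EuclideanSpace.single i 1)) a) ∧
    Integrable (fun x => hs (g x) * (φ x * inner ℝ (u x) a)) ∧
    0 ≤ ∫ x, (2 * (∑ i, fderiv ℝ φ x (EuclideanSpace.single i 1) *
      inner ℝ (g x (EuclideanSpace.single i 1)) a) - 2 * (hs (g x) * (φ x * inner ℝ (u x) a))) := by
  obtain ⟨M, hM⟩ := hφ.continuous.bounded_above_of_compact_support hc
  have hM0 : 0 ≤ M := (norm_nonneg _).trans (hM 0)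
  set b : E → ℝ := fun x => ∑ i, fderiv ℝ φ x (EuclideanSpace.single i 1) *
      inner ℝ (g x (EuclideanSpace.single i 1)) a with hb
  set m : E → ℝ := fun x => φ x * inner ℝ (u x) a with hm
  set d : E → ℝ := fun x => ‖fderiv ℝ φ x‖ ^ 2 * ‖a‖ ^ 2 with hd
  set m0 := M * ‖a‖
  set k0 := M ^ 2 * ‖a‖ ^ 2
  have hmb : ∀ᵐ x, |m x| ≤ m0 := by
    filter_upwards [L.bd] with x hx
    rw [hm, abs_mul]
    have : |inner ℝ (u x) a| ≤ ‖a‖ := (abs_real_inner_le_norm _ _).trans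
      (mul_le_of_le_one_left (norm_nonneg _) hx)
    exact mul_le_mul (hM x) this (abs_nonneg _) hM0
  have ib : Integrable b := by
    refine integrable_finset_sum _ fun i _ => ?_
    have := int_smul (fd_cont hφ hc (EuclideanSpace.single i 1)).1.continuous
      (fd_cont hφ hc (EuclideanSpace.single i 1)).2
      (Integrable.inner_const (𝕜 := ℝ) (int_app L.w.ig (EuclideanSpace.single i 1)) a)
    exact this
  have im : AEStronglyMeasurable m :=
    hφ.continuous.aestronglyMeasurable.mul (L.w.iu.inner_const a).aestronglyMeasurable
  have iem : Integrable (fun x => hs (g x) * m x) := by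
    refine (L.ie.mul_const m0).mono' (L.ie.aestronglyMeasurable.mul im) ?_
    filter_upwards [hmb] with x hx
    rw [norm_mul, Real.norm_of_nonneg (hs_nonneg _)]
    exact mul_le_mul_of_nonneg_left hx (hs_nonneg _)
  have id' : Integrable d :=
    (int_sq (hφ.continuous_fderiv (by simp)) (hc.fderiv (𝕜 := ℝ))).mul_const _
  set D : E → ℝ := fun x => 4 * (d x + (2 * |b x| + 2 * hs (g x) * m0) * (2 * m0 + k0)) with hD
  have iD : Integrable D := by
    refine (id'.add ?_).const_mul 4
    exact ((ib.abs.const_mul 2).add ((L.ie.const_mul 2).mul_const m0)).mul_const _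
  set A : E → ℝ := fun x => 2 * b x - 2 * (hs (g x) * m x) with hA
  have iA : Integrable A := (ib.const_mul 2).sub (iem.const_mul 2)
  refine ⟨ib, iem, ?_⟩
  change 0 ≤ ∫ x, A x
  obtain ⟨σ, hσ, hsσ⟩ := supp_ball hc hs'
  have hφ0 : ∀ x, x ∉ ball y R → φ x = 0 := fun x hx =>
    image_eq_zero_of_notMem_tsupport fun h => hx (hs' h)
  have hdφ0 : ∀ x, x ∉ ball y R → fderiv ℝ φ x = 0 := fun x hx =>
    image_eq_zero_of_notMem_tsupport fun h => hx (hs' (tsupport_fderiv_subset ℝ h))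
  have hA0 : ∫ x in ball y R, A x = ∫ x, A x :=
    setIntegral_eq_integral_of_forall_compl_eq_zero fun x hx => by
      simp [hA, hb, hm, hφ0 x hx, hdφ0 x hx]
  rw [← hA0]
  refine lim_nonneg (t0 := min 1 (1 / (2 * (m0 + 1)))) (D := ∫ x in ball y R, D x)
    (by have : 0 ≤ m0 := by positivity
        positivity) fun t ht ht1 => ?_
  have ht2 : t ≤ 1 := ht1.trans (min_le_left _ _)
  have ht3 : t * m0 ≤ 1 / 2 := by
    have h0 : 0 ≤ m0 := by positivity
    have := ht1.trans (min_le_right _ _)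
    rw [le_div_iff₀ (by positivity)] at this
    nlinarith
  have wφ : W1 (fun x => φ x • a) (fun x => (fderiv ℝ φ x).smulRight a) := by
    have h1 : ContDiff ℝ 1 (fun x => φ x • a) := (hφ.of_le (by simp)).smul contDiff_const
    have h2 : fderiv ℝ (fun x => φ x • a) = fun x => (fderiv ℝ φ x).smulRight a := by
      ext1 x
      exact ((hφ.differentiable (by simp) x).hasFDerivAt.smul_const a).fderiv
    have hcs : HasCompactSupport (fun x => φ x • a) := hc.smul_right
    rw [← h2]
    exact W1.of_C1 h1 (h1.continuous.integrable_of_hasCompactSupport hcs)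
      ((h1.continuous_fderiv (by simp)).integrable_of_hasCompactSupport (hcs.fderiv (𝕜 := ℝ)))
  have hmin := L.mini _ _ σ hσ (L.w.add (wφ.smul t)) ?_ ?_ ?_
  · have hle : ∫ x in ball y R, hs (g x + t • (fderiv ℝ φ x).smulRight a) / ‖u x + t • φ x • a‖ ^ 2 ≤
        ∫ x in ball y R, (hs (g x) + t * A x + t ^ 2 * D x) := by
      refine integral_mono_of_nonneg (Eventually.of_forall fun x => div_nonneg (hs_nonneg _)
        (by positivity)) ?_ ?_
      · exact ((L.ie.add (iA.const_mul t)).add (iD.const_mul (t ^ 2))).integrableOn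
      · rw [EventuallyLE, ae_restrict_iff' measurableSet_ball]
        filter_upwards [L.one, hmb] with x hx hmx hxb
        have hn : ‖u x + t • φ x • a‖ ^ 2 = 1 + 2 * t * m x + t ^ 2 * (φ x ^ 2 * ‖a‖ ^ 2) := by
          rw [norm_add_sq_real, hx hxb, norm_smul, norm_smul, inner_smul_right, inner_smul_right]
          simp only [hm, mul_pow, Real.norm_eq_abs, sq_abs]; ring
        rw [hn, hs_expand]
        refine el_real (hs_nonneg _) (by positivity) hmx (by positivity) ?_ ht ht2 rfl ?_
        · have := hM x
          rw [Real.norm_eq_abs] at this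
          have := sq_le_sq' (by linarith [neg_abs_le (φ x), abs_nonneg (φ x)]) ((le_abs_self (φ x)).trans this)
          exact mul_le_mul_of_nonneg_right this (by positivity)
        · rw [← hn]
          have h1 : ‖t • φ x • a‖ ≤ 1/2 := by
            rw [norm_smul, norm_smul, Real.norm_of_nonneg ht.le]
            refine le_trans ?_ ht3
            exact mul_le_mul_of_nonneg_left (mul_le_mul_of_nonneg_right (hM x) (norm_nonneg a)) ht.le
          have h2 := norm_sub_le_norm_add (u x) (t • φ x • a)
          rw [hx hxb] at h2
          nlinarith
    have h2 := hmin.trans hle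
    rw [integral_add, integral_add, integral_const_mul, integral_const_mul] at h2
    · nlinarith
    · exact L.ie.integrableOn
    · exact (iA.const_mul t).integrableOn
    · exact (L.ie.add (iA.const_mul t)).integrableOn
    · exact (iD.const_mul (t ^ 2)).integrableOn
  · refine hs_int_add L.w.ig.aestronglyMeasurable (wφ.smul t).ig.aestronglyMeasurable L.ie ?_
    simp only [hs_smul, hs_smulRight]
    exact id'.const_mul _
  · refine Eventually.of_forall fun x hx => ?_
    rw [image_eq_zero_of_notMem_tsupport fun h => hx (hsσ h)]; simp
  · filter_upwards [L.one] with x hx hxb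
    have h1 : ‖t • φ x • a‖ ≤ 1/2 := by
      rw [norm_smul, norm_smul, Real.norm_of_nonneg ht.le]
      refine le_trans ?_ ht3
      exact mul_le_mul_of_nonneg_left (mul_le_mul_of_nonneg_right (hM x) (norm_nonneg a)) ht.le
    have h2 := norm_sub_le_norm_add (u x) (t • φ x • a)
    rw [hx hxb] at h2
    linarith

lemma LMin.iQ {y : E} {R : ℝ} {u : E → F} {g : E → E →L[ℝ] F} (L : LMin y R u g) :
    Integrable (fun x => -hs (g x) • u x) := by
  refine L.ie.mono' (L.ie.aestronglyMeasurable.neg.smul L.w.iu.aestronglyMeasurable) ?_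
  filter_upwards [L.bd] with x hx
  rw [norm_smul, norm_neg, Real.norm_of_nonneg (hs_nonneg _)]
  exact mul_le_of_le_one_right (hs_nonneg _) hx

lemma LMin.el {y : E} {R : ℝ} {u : E → F} {g : E → E →L[ℝ] F} (L : LMin y R u g) {φ : E → ℝ}
    (hφ : ContDiff ℝ (⊤ : ℕ∞) φ) (hc : HasCompactSupport φ) (hs' : tsupport φ ⊆ ball y R) :
    ∫ x, lap φ x • u x = ∫ x, φ x • (-hs (g x) • u x) := by
  have iL : ∀ i, Integrable (fun x => fderiv ℝ (fun y => fderiv ℝ φ y (EuclideanSpace.single i 1)) x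
      (EuclideanSpace.single i 1) • u x) := fun i => by
    have h1 := fd_cont hφ hc (EuclideanSpace.single i 1)
    have h2 := fd_cont h1.1 h1.2 (EuclideanSpace.single i 1)
    exact int_smul h2.1.continuous h2.2 L.w.iu
  have iR : ∀ i, Integrable (fun x => fderiv ℝ φ x (EuclideanSpace.single i 1) •
      g x (EuclideanSpace.single i 1)) := fun i => 
    int_smul (fd_cont hφ hc _).1.continuous (fd_cont hφ hc _).2 (int_app L.w.ig _)
  have e1 : ∫ x, lap φ x • u x = - ∫ x, ∑ i, fderiv ℝ φ x (EuclideanSpace.single i 1) •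
      g x (EuclideanSpace.single i 1) := by
    simp only [lap, Finset.sum_smul]
    rw [integral_finsetSum _ fun i _ => iL i, integral_finsetSum _ fun i _ => iR i,
      ← Finset.sum_neg_distrib]
    exact Finset.sum_congr rfl fun i _ => L.w.ibp _ (fd_cont hφ hc _).1 (fd_cont hφ hc _).2 _
  have iQ : Integrable (fun x => -(φ x • (-hs (g x) • u x))) := (int_smul hφ.continuous hc L.iQ).neg
  rw [e1, neg_eq_iff_eq_neg, ← integral_neg]
  refine ext_inner_left ℝ fun a => ?_
  rw [← integral_inner (integrable_finset_sum _ fun i _ => iR i), ← integral_inner iQ]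
  have key : ∀ a : F, 0 ≤ (∫ x, inner ℝ a (∑ i, fderiv ℝ φ x (EuclideanSpace.single i 1) •
      g x (EuclideanSpace.single i 1))) - ∫ x, inner ℝ a (-(φ x • (-hs (g x) • u x))) := by
    intro a
    obtain ⟨h1, h2, h3⟩ := L.el1 hφ hc hs' a
    rw [integral_sub (h1.const_mul 2) (h2.const_mul 2), integral_const_mul, integral_const_mul] at h3
    have e2 : ∀ x, inner ℝ a (∑ i, fderiv ℝ φ x (EuclideanSpace.single i 1) •
      g x (EuclideanSpace.single i 1)) = ∑ i, fderiv ℝ φ x (EuclideanSpace.single i 1) *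
      inner ℝ (g x (EuclideanSpace.single i 1)) a := fun x => by
      rw [inner_sum]
      simp only [inner_smul_right, real_inner_comm a]
    have e3 : ∀ x, inner ℝ a (-(φ x • (-hs (g x) • u x))) = hs (g x) * (φ x * inner ℝ (u x) a) :=
      fun x => by
      rw [inner_neg_right, inner_smul_right, inner_smul_right, real_inner_comm a]; ring
    simp only [e2, e3]
    linarith
  have k1 := key a
  have k2 := key (-a)
  simp only [inner_neg_left, integral_neg] at k2
  linarith

lemma lap_aff {Γ : E → ℝ} (hΓ : ContDiff ℝ (⊤ : ℕ∞) Γ) (x : E) (s : ℝ) (z : E) :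
    lap (fun w => Γ (s⁻¹ • (x - w))) z = (s ^ 2)⁻¹ * lap Γ (s⁻¹ • (x - z)) := by
  have key : ∀ (f : E → ℝ), ContDiff ℝ (⊤ : ℕ∞) f → ∀ z e, fderiv ℝ (fun w => f (s⁻¹ • (x - w))) z e =
      -s⁻¹ * fderiv ℝ f (s⁻¹ • (x - z)) e := by
    intro f hf z e
    have h1 : HasFDerivAt (fun w : E => s⁻¹ • (x - w)) (s⁻¹ • (-ContinuousLinearMap.id ℝ E)) z :=
      ((hasFDerivAt_id z).const_sub x).const_smul s⁻¹
    have h2 := ((hf.differentiable (by simp) (s⁻¹ • (x - z))).hasFDerivAt.comp z h1).fderiv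
    change fderiv ℝ (f ∘ fun w => s⁻¹ • (x - w)) z e = _
    rw [h2]; simp
  simp only [lap, Finset.mul_sum]
  refine Finset.sum_congr rfl fun i _ => ?_
  have hd : ContDiff ℝ (⊤ : ℕ∞) (fun y => fderiv ℝ Γ y (EuclideanSpace.single i 1)) :=
    (hΓ.fderiv_right (by simp)).clm_apply contDiff_const
  simp only [key Γ hΓ]
  have h3 := key (fun y => fderiv ℝ Γ y (EuclideanSpace.single i 1)) hd z (EuclideanSpace.single i 1)
  rw [fderiv_const_mul (by
    have h4 : ContDiff ℝ (⊤ : ℕ∞) (fun w : E => s⁻¹ • (x - w)) :=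
      (contDiff_const.sub contDiff_id).const_smul _
    exact (hd.comp h4).differentiable (by simp) z)]
  simp only [ContinuousLinearMap.smul_apply, smul_eq_mul]
  erw [h3]
  ring

lemma supp_aff {φ : E → ℝ} (h0 : ∀ z, 1 ≤ ‖z‖ → φ z = 0) (x : E) {s : ℝ} (hs : 0 < s) :
    tsupport (fun w => φ (s⁻¹ • (x - w))) ⊆ closedBall x s := by
  refine closure_minimal (fun w hw => ?_) isClosed_closedBall
  by_contra h
  apply hw
  apply h0
  rw [mem_closedBall, not_le, dist_comm, dist_eq_norm] at h
  rw [norm_smul, norm_inv, Real.norm_of_nonneg hs.le, inv_mul_eq_div, le_div_iff₀ hs]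
  linarith

lemma kernel_id {ψ Γ : E → ℝ} (K : KerPair n ψ Γ) {u Q : E → F} (iu : Integrable u) {O : Set E}
    (hEL : ∀ φ : E → ℝ, ContDiff ℝ (⊤ : ℕ∞) φ → HasCompactSupport φ → tsupport φ ⊆ O →
      ∫ x, lap φ x • u x = ∫ x, φ x • Q x) {x : E} {s : ℝ} (hs : 0 < s) (hO : closedBall x s ⊆ O) :
    mol ψ (s / 2) u x - mol ψ s u x = s ^ 2 • mol Γ s Q x := by
  have hsm : ContDiff ℝ (⊤ : ℕ∞) (fun w : E => s⁻¹ • (x - w)) :=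
      (contDiff_const.sub contDiff_id).const_smul _
  have hts := supp_aff K.zΓ x hs
  have h := hEL (fun w => Γ (s⁻¹ • (x - w))) (K.sΓ.comp hsm)
    ((isCompact_closedBall x s).of_isClosed_subset (isClosed_tsupport _) hts) (hts.trans hO)
  have e1 : mol Γ s Q x = (s ^ n)⁻¹ • ∫ z, Γ (s⁻¹ • (x - z)) • Q z := by
    rw [mol_gmol, gmol_eq _ _ hs]; rfl
  have e2 : mol ψ s u x = (s ^ n)⁻¹ • ∫ z, ψ (s⁻¹ • (x - z)) • u z := by
    rw [mol_gmol, gmol_eq _ _ hs]; rfl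
  have e3 : mol ψ (s / 2) u x = (s ^ n)⁻¹ • ((2 : ℝ) ^ n • ∫ z, ψ ((2:ℝ) • s⁻¹ • (x - z)) • u z) := by
    rw [mol_gmol, gmol_eq _ _ (half_pos hs), smul_smul]
    have c1 : (s / 2)⁻¹ = 2 * s⁻¹ := by field_simp
    have c2 : ((s / 2) ^ n)⁻¹ = (s ^ n)⁻¹ * 2 ^ n := by rw [div_pow, inv_div]; field_simp
    rw [c2]
    simp only [c1, mul_smul]
    rfl
  have i1 : Integrable (fun z => ψ (s⁻¹ • (x - z)) • u z) :=
    int_ker (ContinuousLinearMap.lsmul ℝ ℝ) K.sψ.continuous K.zψ x iu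
  have i2 : Integrable (fun z => ψ ((2:ℝ) • s⁻¹ • (x - z)) • u z) := by
    have := int_ker (s := s / 2) (ContinuousLinearMap.lsmul ℝ ℝ) K.sψ.continuous K.zψ x iu
    have c1 : (s / 2)⁻¹ = 2 * s⁻¹ := by field_simp
    simp only [c1, mul_smul] at this
    exact this
  have i3 : Integrable (fun z => (2:ℝ) ^ n • ψ ((2:ℝ) • s⁻¹ • (x - z)) • u z) :=
    Integrable.smul ((2:ℝ) ^ n) i2
  have e4 : ∫ z, lap (fun w => Γ (s⁻¹ • (x - w))) z • u z = (s ^ 2)⁻¹ •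
      ((2 : ℝ) ^ n • (∫ z, ψ ((2:ℝ) • s⁻¹ • (x - z)) • u z) - ∫ z, ψ (s⁻¹ • (x - z)) • u z) := by
    rw [← integral_smul, ← integral_sub i3 i1, ← integral_smul]
    refine integral_congr_ae (Eventually.of_forall fun z => ?_)
    simp only [lap_aff K.sΓ, K.lapΓ, mul_smul, sub_smul]
  rw [e1, e2, e3, ← smul_sub, ← h, e4, smul_comm (s ^ 2), smul_smul (s ^ 2),
    mul_inv_cancel₀ (by positivity), one_smul]
end
end

noncomputable section
section
variable {n p : ℕ}
local notation "E" => EuclideanSpace ℝ (Fin n)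
local notation "F" => EuclideanSpace ℝ (Fin p)

def rk (α β : ℝ) (r : E) : E →L[ℝ] E :=
  α • ContinuousLinearMap.id ℝ E - β • (innerSL ℝ r).smulRight r

lemma rk_norm {α β : ℝ} {r : E} (hα : 0 ≤ α) (hβ : 0 ≤ β) (h : β * ‖r‖ ^ 2 ≤ 2 * α) :
    ‖rk α β r‖ ≤ α := by
  refine ContinuousLinearMap.opNorm_le_bound _ hα fun v => ?_
  refine abs_le_of_sq_le_sq' ?_ (by positivity) |>.2
  have : rk α β r v = α • v - (β * inner ℝ r v) • r := by simp [rk, mul_smul]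
  rw [this, norm_sub_sq_real, norm_smul, norm_smul, inner_smul_left, inner_smul_right,
    real_inner_comm]
  simp only [Real.norm_eq_abs, mul_pow, sq_abs, RCLike.conj_to_real]
  have h2 : 0 ≤ β * (inner ℝ v r) ^ 2 * (2 * α - β * ‖r‖ ^ 2) :=
    mul_nonneg (by positivity) (by linarith)
  nlinarith

lemma rk_det (hn : 1 ≤ n) {α β : ℝ} (r : E) (hα : 0 < α) :
    (rk α β r).det = α ^ (n - 1) * (α - β * ‖r‖ ^ 2) := by
  have h1 : ((rk α β r : E →L[ℝ] E) : E →ₗ[ℝ] E) = α • (LinearMap.transvection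
      ((-(β / α)) • (innerSL ℝ r : E →ₗ[ℝ] ℝ)) r) := by
    ext v : 1
    have : α * (β / α) = β := by field_simp
    simp [rk, LinearMap.transvection.apply, smul_smul, sub_eq_add_neg, ← mul_assoc, this]
  rw [ContinuousLinearMap.det, h1, LinearMap.det_smul, LinearMap.transvection.det]
  simp
  obtain ⟨k, rfl⟩ : ∃ k, n = k + 1 := ⟨n - 1, by omega⟩
  simp only [add_tsub_cancel_right, pow_succ]
  field_simp
  ring

lemma mono_core {t z δ κ a N k A0 : ℝ} (ht : 0 < t) (ht2 : t ≤ 1 / 2) (hN0 : 0 ≤ N) (hk0 : 0 ≤ k)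
    (htk : t * N + t * k ≤ 1 / 2) (hz1 : |z| ≤ N) (hδ1 : |δ| ≤ N) (hκ1 : κ ≤ k) (hκ0 : 0 ≤ κ)
    (ha : 0 ≤ a) (hA : a ≤ A0) (hdz : δ - z = 2 * a) :
    (1 + t * a) ^ 2 ≤ (1 + t * δ - t ^ 2 * κ) *
      (1 - t * z + 2 * (k + N ^ 2 + k * N + A0 ^ 2) * t ^ 2) := by
  set C' := 2 * (k + N ^ 2 + k * N + A0 ^ 2) with hC'
  have hC0 : 0 ≤ C' := by positivity
  have htκ : t * κ ≤ k := (mul_le_of_le_one_left hκ0 (by linarith)).trans hκ1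
  have hD2 : 1 / 2 ≤ 1 + t * δ - t ^ 2 * κ := by
    have h1 := mul_le_mul_of_nonneg_left (abs_le.1 hδ1).1 ht.le
    have h2 := mul_le_mul_of_nonneg_left htκ ht.le
    linarith
  have h1 : (1 + t * δ - t ^ 2 * κ) * (1 - t * z) = 1 + t * (δ - z) - t ^ 2 * (κ + δ * z) +
    t ^ 2 * (t * κ * z) := by ring
  have h2 : C' * t ^ 2 * (1 / 2) ≤ (1 + t * δ - t ^ 2 * κ) * (C' * t ^ 2) := by
    rw [mul_comm]; gcongr
  have h3 : δ * z ≤ N ^ 2 := by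
    refine (le_abs_self _).trans ?_
    rw [abs_mul, sq]; gcongr
  have h4 : -(k * N) ≤ t * κ * z := by
    have : |t * κ * z| ≤ k * N := by
      rw [abs_mul, abs_mul, abs_of_pos ht, abs_of_nonneg hκ0]
      gcongr
    exact (abs_le.1 this).1
  have h5 : a ^ 2 ≤ A0 ^ 2 := by gcongr
  have h6 : 0 ≤ t ^ 2 * (C' / 2 - κ - δ * z + t * κ * z - a ^ 2) :=
    mul_nonneg (sq_nonneg _) (by rw [hC']; linarith)
  rw [mul_add, h1, hdz]
  linarith

lemma mono_real (hn : 2 ≤ n) {a b t A0 B0 L z' : ℝ} (ha : 0 ≤ a) (hA : a ≤ A0) (hb : 0 ≤ b)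
    (hB : b ≤ B0) (ht : 0 < t) (ht1 : t * (n * A0 + B0 + n * A0 * B0 + 1) ≤ 1 / 2)
    (hz : z' ≤ (n - 2) * a - b + L * t) :
    (1 + t * a) ^ 2 ≤ (1 + t * a) ^ (n - 1) * (1 + t * a - t * b) * (1 - t * z' +
      (L + 2 * (n * A0 * B0 + (n * A0 + B0) ^ 2 + n * A0 * B0 * (n * A0 + B0) + A0 ^ 2)) * t ^ 2)
    ∧ 0 ≤ 1 - t * z' +
      (L + 2 * (n * A0 * B0 + (n * A0 + B0) ^ 2 + n * A0 * B0 * (n * A0 + B0) + A0 ^ 2)) * t ^ 2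
    ∧ 0 ≤ 1 + t * a - t * b := by
  have hA0 : 0 ≤ A0 := ha.trans hA
  have hB0 : 0 ≤ B0 := hb.trans hB
  have hn' : (2:ℝ) ≤ n := by exact_mod_cast hn
  have hna : n * a ≤ n * A0 := by gcongr
  have hna0 : 0 ≤ (n - 2) * a := mul_nonneg (by linarith) ha
  have hκ1 : (n - 1) * a * b ≤ n * A0 * B0 := by
    have h1 : (n - 1) * a ≤ n * A0 := by linarith
    gcongr
  have hκ0 : 0 ≤ (n - 1) * a * b := mul_nonneg (mul_nonneg (by linarith) ha) hb
  have hN0 : 0 ≤ n * A0 + B0 := by positivity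
  have hk0 : 0 ≤ n * A0 * B0 := by positivity
  have hz1 : |(n - 2) * a - b| ≤ n * A0 + B0 := by
    rw [abs_le]; constructor <;> linarith
  have hδ1 : |n * a - b| ≤ n * A0 + B0 := by
    rw [abs_le]; constructor <;> linarith
  have htN := mul_nonneg ht.le hN0
  have htk := mul_nonneg ht.le hk0
  have ht1' : t * (n * A0 + B0) + t * (n * A0 * B0) + t ≤ 1 / 2 := by linarith
  have core := mono_core ht (by linarith) hN0 hk0 (by linarith) hz1 hδ1 hκ1 hκ0 ha hA (by ring)
  set C' := 2 * (n * A0 * B0 + (n * A0 + B0) ^ 2 + n * A0 * B0 * (n * A0 + B0) + A0 ^ 2) with hC'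
  have hC0 : 0 ≤ C' := by positivity
  have htz : t * ((n - 2) * a - b) ≤ 1 / 2 :=
    (mul_le_mul_of_nonneg_left ((le_abs_self _).trans hz1) ht.le).trans (by linarith)
  have hp0 : 0 ≤ 1 - t * ((n - 2) * a - b) + C' * t ^ 2 := by
    have : 0 ≤ C' * t ^ 2 := by positivity
    linarith
  have hpos : 1 - t * ((n - 2) * a - b) + C' * t ^ 2 ≤ 1 - t * z' + (L + C') * t ^ 2 := by
    have := mul_le_mul_of_nonneg_left hz ht.le
    linarith
  have htb : 0 ≤ 1 + t * a - t * b := by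
    have h1 := mul_le_mul_of_nonneg_left hB ht.le
    have h2 := mul_nonneg ht.le (mul_nonneg (Nat.cast_nonneg n : (0:ℝ) ≤ n) hA0)
    linarith [mul_nonneg ht.le ha]
  refine ⟨core.trans (mul_le_mul ?_ hpos hp0 (mul_nonneg (by positivity) htb)), hp0.trans hpos, htb⟩
  have hbern : 1 + (n - 1) * (t * a) ≤ (1 + t * a) ^ (n - 1) := by
    have := one_add_mul_le_pow (a := t * a) (by linarith [mul_nonneg ht.le ha]) (n - 1)
    rwa [Nat.cast_sub (by omega), Nat.cast_one] at this
  refine le_trans ?_ (mul_le_mul_of_nonneg_right hbern htb)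
  have : 0 ≤ (n - 1) * (t * a) ^ 2 := mul_nonneg (by linarith) (sq_nonneg _)
  have e : (1 + ((n:ℝ) - 1) * (t * a)) * (1 + t * a - t * b) = 1 + t * (n * a - b) -
      t ^ 2 * ((n - 1) * a * b) + (n - 1) * (t * a) ^ 2 := by ring
  rw [e]; linarith

lemma cb_ball {c y : E} {r R : ℝ} (h : closedBall c r ⊆ ball y R) :
    ∃ σ < R, closedBall c r ⊆ closedBall y σ := by
  by_cases hne : (closedBall c r).Nonempty
  · obtain ⟨x, hx, hmax⟩ := (isCompact_closedBall c r).exists_isMaxOn hne (f := fun z => dist z y)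
      (by fun_prop)
    exact ⟨dist x y, h hx, fun z hz => hmax hz⟩
  · rw [not_nonempty_iff_eq_empty] at hne
    exact ⟨R - 1, by linarith, by simp [hne]⟩
end
end

noncomputable section
section
variable {n p : ℕ}
local notation "E" => EuclideanSpace ℝ (Fin n)
local notation "F" => EuclideanSpace ℝ (Fin p)

lemma flow_anti {X : E → E} {Λ : NNReal} (hX : LipschitzWith Λ X) {t : ℝ} (ht : 0 ≤ t)
    (h : t * Λ ≤ 1 / 2) : AntilipschitzWith 2 (fun x => x + t • X x) := by
  refine AntilipschitzWith.of_le_mul_dist fun x y => ?_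
  have h1 := mul_le_mul_of_nonneg_left (hX.dist_le_mul x y) ht
  rw [dist_eq_norm, dist_eq_norm] at *
  have e : x - y = (x + t • X x - (y + t • X y)) - t • (X x - X y) := by
    rw [smul_sub]; abel
  have h2 : ‖x - y‖ ≤ ‖x + t • X x - (y + t • X y)‖ + ‖t • (X x - X y)‖ := by
    conv_lhs => rw [e]
    exact norm_sub_le _ _
  rw [norm_smul, Real.norm_of_nonneg ht] at h2
  have h3 : t * (Λ * ‖x - y‖) ≤ 1 / 2 * ‖x - y‖ := by
    rw [← mul_assoc]; gcongr
  have h4 : ((2 : NNReal) : ℝ) = 2 := by norm_num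
  rw [h4]
  linarith

lemma bdd_cs {f : E → ℝ} (hf : Continuous f) (hc : HasCompactSupport f) :
    ∃ A, 0 ≤ A ∧ ∀ x, |f x| ≤ A := by
  obtain ⟨C, hC⟩ := hc.exists_bound_of_continuous hf
  exact ⟨C, (norm_nonneg _).trans (hC 0), hC⟩

lemma LMin.radial (hn : 2 ≤ n) {ψ Γ : E → ℝ} (K : KerPair n ψ Γ) {y c : E} {R R0 : ℝ} {u : E → F}
    {g : E → E →L[ℝ] F} (a : LMin y R0 u g) (hcR : closedBall c R ⊆ ball y R0) {α β : E → ℝ}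
    (sα : ContDiff ℝ 1 α) (sβ : ContDiff ℝ 1 β)
    (hd : ∀ x, HasFDerivAt α (-(β x) • innerSL ℝ (x - c)) x)
    (pα : ∀ x, 0 ≤ α x) (pβ : ∀ x, 0 ≤ β x) (zα : ∀ x, x ∉ closedBall c R → α x = 0)
    (zβ : ∀ x, x ∉ closedBall c R → β x = 0) :
    ∫ x in ball y R0, hs (g x) * ((n - 2) * α x - β x * ‖x - c‖ ^ 2) ≤ 0 := by
  set B := ball y R0 with hB
  have cs : ∀ {W : Type} [NormedAddCommGroup W] (f : E → W),
      (∀ x, x ∉ closedBall c R → f x = 0) → HasCompactSupport f := fun f h =>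
    HasCompactSupport.intro (isCompact_closedBall c R) fun x hx => h x hx
  have sX : ContDiff ℝ 1 (fun x => α x • (x - c)) := by fun_prop
  have sb : ContDiff ℝ 1 (fun x => β x * ‖x - c‖ ^ 2) :=
    sβ.mul ((contDiff_id.sub contDiff_const).norm_sq ℝ)
  set ζ : E → ℝ := fun x => (n - 2) * α x - β x * ‖x - c‖ ^ 2 with hζ
  have sζ : ContDiff ℝ 1 ζ := (contDiff_const.mul sα).sub sb
  have zζ : ∀ x, x ∉ closedBall c R → ζ x = 0 := fun x hx => by simp [hζ, zα x hx, zβ x hx]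
  have zX : ∀ x, x ∉ closedBall c R → α x • (x - c) = 0 := fun x hx => by simp [zα x hx]
  obtain ⟨Λ, hΛ⟩ := ContDiff.lipschitzWith_of_hasCompactSupport (cs _ zX) sX one_ne_zero
  obtain ⟨Z, hZ⟩ := ContDiff.lipschitzWith_of_hasCompactSupport (cs _ zζ) sζ one_ne_zero
  obtain ⟨A0, hA00, hA0⟩ := bdd_cs sα.continuous (cs _ zα)
  obtain ⟨B0, hB00, hB0⟩ := bdd_cs sb.continuous (cs _ fun x hx => by simp [zβ x hx])
  obtain ⟨X0, hX0⟩ := (cs _ zX).exists_bound_of_continuous sX.continuous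
  obtain ⟨Z0, hZ00, hZ0⟩ := bdd_cs sζ.continuous (cs _ zζ)
  have hX00 : 0 ≤ X0 := (norm_nonneg _).trans (hX0 0)
  obtain ⟨σ, hσ, hcσ⟩ := cb_ball hcR
  set L := Z * X0 with hL
  have hL0 : 0 ≤ L := by positivity
  set C := L + 2 * (n * A0 * B0 + (n * A0 + B0) ^ 2 + n * A0 * B0 * (n * A0 + B0) + A0 ^ 2) with hC
  have main : ∀ t, 0 < t → t ≤ (1 / 2) / (Λ + (n * A0 + B0 + n * A0 * B0 + 1)) →
      0 ≤ (-∫ x in B, hs (g x) * ζ x) + t * (C * ∫ x in B, hs (g x)) := by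
    intro t ht ht0
    have hden : (0:ℝ) < Λ + (n * A0 + B0 + n * A0 * B0 + 1) := by positivity
    rw [le_div_iff₀ hden] at ht0
    have hq0 : 0 ≤ t * (n * A0 + B0 + n * A0 * B0 + 1) := by positivity
    have hΛ0 : 0 ≤ t * Λ := by positivity
    have ht1 : t * (n * A0 + B0 + n * A0 * B0 + 1) ≤ 1 / 2 := by linarith
    set Φ : E → E := fun x => x + t • (α x • (x - c)) with hΦ
    have hA : AntilipschitzWith 2 Φ := flow_anti hΛ ht.le (by linarith)
    have sΦ : ContDiff ℝ 1 Φ := by fun_prop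
    have dΦ : ∀ x, HasFDerivAt Φ (rk (1 + t * α x) (t * β x) (x - c)) x := by
      intro x
      refine ((hasFDerivAt_id x).add (((hd x).smul ((hasFDerivAt_id x).sub_const c)).const_smul t)).congr_fderiv ?_
      ext1 v
      simp [rk, add_smul, mul_smul, smul_add, sub_eq_add_neg]
      module
    have fΦ : ∀ x, fderiv ℝ Φ x = rk (1 + t * α x) (t * β x) (x - c) := fun x => (dΦ x).fderiv
    have MR := fun (x : E) (z' : ℝ) (hz : z' ≤ ζ x + L * t) => mono_real hn (pα x)
      ((le_abs_self _).trans (hA0 x)) (mul_nonneg (pβ x) (sq_nonneg ‖x - c‖))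
      ((le_abs_self _).trans (hB0 x)) ht ht1 hz
    have hbx : ∀ x, 0 ≤ 1 + t * α x - t * β x * ‖x - c‖ ^ 2 := fun x => by
      have := (MR x (ζ x) (le_add_of_nonneg_right (by positivity))).2.2
      rwa [mul_assoc]
    have hα1 : ∀ x, 0 < 1 + t * α x := fun x => by have := mul_nonneg ht.le (pα x); linarith
    have nΦ : ∀ x, ‖fderiv ℝ Φ x‖ ≤ 1 + t * α x := fun x => by
      rw [fΦ]
      exact rk_norm (hα1 x).le (mul_nonneg ht.le (pβ x)) (by linarith [hbx x, hα1 x])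
    have inj := hA.injective
    have hid : ∀ x, x ∉ closedBall c R → Φ x = x := fun x hx => by simp [hΦ, zα x hx]
    have hmap : ∀ x ∈ B, Φ x ∈ B := by
      intro x hx
      by_contra hn
      have := inj (hid _ fun h' => hn (hcR h'))
      rw [this] at hn
      exact hn hx
    have hM : ∀ x, ‖fderiv ℝ Φ x‖ ≤ 1 + t * A0 := fun x =>
      (nΦ x).trans (by gcongr; exact (le_abs_self _).trans (hA0 x))
    have W := a.w.comp K sΦ hA hM
    have mΦ := sΦ.continuous.measurable
    have ih0 : Integrable (fun x => hs (g (Φ x))) := (integrable_comp_anti mΦ hA a.ie).1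
    have hle : ∀ x, hs ((g (Φ x)).comp (fderiv ℝ Φ x)) ≤ (1 + t * α x) ^ 2 * hs (g (Φ x)) :=
      fun x => (hs_pre_le _ _).trans (by gcongr; exacts [hs_nonneg _, nΦ x])
    have ih : Integrable (fun x => hs ((g (Φ x)).comp (fderiv ℝ Φ x))) := by
      refine (ih0.const_mul ((1 + t * A0) ^ 2)).mono' (hs_meas W.ig.aestronglyMeasurable)
        (Eventually.of_forall fun x => ?_)
      rw [Real.norm_of_nonneg (hs_nonneg _)]
      refine (hs_pre_le _ _).trans ?_
      gcongr
      exacts [hs_nonneg _, hM x]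
    have hone : ∀ᵐ x, x ∈ B → ‖u (Φ x)‖ = 1 := by
      filter_upwards [(qmp_of_anti Φ mΦ hA).ae a.one] with x hx hxB using hx (hmap x hxB)
    have h1 := a.mini _ _ σ hσ W ih (Eventually.of_forall fun x hx => by
      rw [hid x fun h => hx (hcσ h)]) (by
      filter_upwards [hone] with x hx hxB
      rw [hx hxB]; norm_num)
    set k : E → ℝ := fun x => hs (g x) * (1 - t * ζ x + C * t ^ 2) with hk
    have k0 : ∀ x, 0 ≤ k x := fun x => mul_nonneg (hs_nonneg _)
      (MR x (ζ x) (le_add_of_nonneg_right (by positivity))).2.1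
    have iζ : Integrable (fun x => hs (g x) * ζ x) :=
      a.ie.mul_bdd (c := Z0) sζ.continuous.aestronglyMeasurable (Eventually.of_forall hZ0)
    have ek : k = fun x => (hs (g x) + (-t) * (hs (g x) * ζ x)) + (C * t ^ 2) * hs (g x) := by
      funext x; simp only [hk]; ring
    have ik : Integrable k := by
      rw [ek]; exact (a.ie.add (iζ.const_mul _)).add (a.ie.const_mul _)
    have hdet : ∀ x, |(fderiv ℝ Φ x).det| =
        (1 + t * α x) ^ (n - 1) * (1 + t * α x - t * (β x * ‖x - c‖ ^ 2)) := fun x => by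
      rw [fΦ, rk_det (by omega) _ (hα1 x), abs_of_nonneg, mul_assoc t]
      exact mul_nonneg (pow_nonneg (hα1 x).le _) (hbx x)
    have hkey : ∀ x, hs ((g (Φ x)).comp (fderiv ℝ Φ x)) ≤ |(fderiv ℝ Φ x).det| • k (Φ x) := by
      intro x
      refine (hle x).trans ?_
      rw [hdet, smul_eq_mul, hk]
      have hz : ζ (Φ x) ≤ ζ x + L * t := by
        have h2 := (le_abs_self _).trans (hZ.dist_le_mul (Φ x) x)
        have h3 : dist (Φ x) x ≤ t * X0 := by
          rw [dist_eq_norm]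
          simp only [hΦ, add_sub_cancel_left]
          rw [norm_smul, Real.norm_of_nonneg ht.le]
          gcongr
          exact hX0 x
        have h4 : (Z:ℝ) * dist (Φ x) x ≤ Z * (t * X0) := by gcongr
        have : L * t = Z * (t * X0) := by rw [hL]; ring
        linarith
      have := (MR x _ hz).1
      calc _ ≤ _ := mul_le_mul_of_nonneg_right this (hs_nonneg _)
        _ = _ := by ring
    have mB : MeasurableSet B := measurableSet_ball
    have hdw : ∀ x ∈ B, HasFDerivWithinAt Φ (fderiv ℝ Φ x) B x := fun x _ => by
      rw [fΦ]; exact (dΦ x).hasFDerivWithinAt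
    have hI := integral_image_eq_integral_abs_det_fderiv_smul volume mB hdw inj.injOn k
    have hII := (integrableOn_image_iff_integrableOn_abs_det_fderiv_smul volume mB hdw inj.injOn k).1
      ik.integrableOn
    have h2 : ∫ x in B, hs ((g (Φ x)).comp (fderiv ℝ Φ x)) / ‖u (Φ x)‖ ^ 2 =
        ∫ x in B, hs ((g (Φ x)).comp (fderiv ℝ Φ x)) := by
      refine setIntegral_congr_ae mB ?_
      filter_upwards [hone] with x hx hxB
      rw [hx hxB]; simp
    have h3 : ∫ x in B, hs ((g (Φ x)).comp (fderiv ℝ Φ x)) ≤ ∫ x in B, |(fderiv ℝ Φ x).det| • k (Φ x) :=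
      integral_mono ih.integrableOn hII hkey
    have h4 : ∫ x in Φ '' B, k x ≤ ∫ x in B, k x :=
      setIntegral_mono_set ik.integrableOn (Eventually.of_forall k0)
        (HasSubset.Subset.eventuallyLE (by rintro _ ⟨x, hx, rfl⟩; exact hmap x hx))
    have h5 : ∫ x in B, k x = (∫ x in B, hs (g x)) + (-t) * (∫ x in B, hs (g x) * ζ x) +
        (C * t ^ 2) * ∫ x in B, hs (g x) := by
      rw [ek, integral_add (f := fun x => hs (g x) + (-t) * (hs (g x) * ζ x))
        (a.ie.add (iζ.const_mul _)).integrableOn (a.ie.const_mul _).integrableOn,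
        integral_add a.ie.integrableOn (iζ.const_mul _).integrableOn, integral_const_mul,
        integral_const_mul]
    rw [h2] at h1
    rw [← hI] at h3
    have h6 : 0 ≤ t * ((-∫ x in B, hs (g x) * ζ x) + t * (C * ∫ x in B, hs (g x))) := by
      linarith
    exact nonneg_of_mul_nonneg_right h6 ht
  have := lim_nonneg (by positivity) main
  linarith
end
end

noncomputable section
section
variable {n p : ℕ}
local notation "E" => EuclideanSpace ℝ (Fin n)
local notation "F" => EuclideanSpace ℝ (Fin p)

def En (g : E → E →L[ℝ] F) (c : E) (r : ℝ) : ℝ := ∫ x in closedBall c r, hs (g x)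

lemma En_nonneg (g : E → E →L[ℝ] F) (c : E) (r : ℝ) : 0 ≤ En g c r :=
  integral_nonneg fun _ => hs_nonneg _

lemma LMin.En_mono {y : E} {R0 : ℝ} {u : E → F} {g : E → E →L[ℝ] F} (a : LMin y R0 u g) {A B : Set E}
    (h : A ⊆ B) : ∫ x in A, hs (g x) ≤ ∫ x in B, hs (g x) :=
  setIntegral_mono_set a.ie.integrableOn (Eventually.of_forall fun _ => hs_nonneg _) h.eventuallyLE

lemma kap'_bdd : ∃ M, 0 ≤ M ∧ ∀ t, deriv kap t ≤ M := by
  obtain ⟨M, hM⟩ := (isCompact_Icc (a := (0:ℝ)) (b := 1)).exists_bound_of_continuousOn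
    kap'_smooth.continuous.continuousOn
  refine ⟨M, (norm_nonneg _).trans (hM 0 (by simp)), fun t => ?_⟩
  by_cases h : t ∈ Icc (0:ℝ) 1
  · exact (le_abs_self _).trans (hM t h)
  · have : deriv kap t = 0 := by
      by_cases h1 : t ≤ 1 / 2
      · exact kap'_zero_left h1
      · exact kap'_zero_right (by by_contra h2; exact h ⟨by linarith, by linarith⟩)
    rw [this]; exact (norm_nonneg _).trans (hM 0 (by simp))

lemma LMin.mono1 (hn : 2 ≤ n) {ψ Γ : E → ℝ} (K : KerPair n ψ Γ) {y c : E} {R R0 ρ : ℝ} {u : E → F}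
    {g : E → E →L[ℝ] F} (a : LMin y R0 u g) (hcR : closedBall c R ⊆ ball y R0) (hρ : 0 < ρ)
    (hR : 2 * ρ ≤ R) {M : ℝ} (hM0 : 0 ≤ M) (hM : ∀ t, deriv kap t ≤ M) {ν : ℝ}
    (hν : ν = (n - 2) / 2) :
    ν * (2 * ρ ^ 2) ^ (-ν) * En g c ρ ≤ 2 * M * (R ^ 2 / 2) ^ (-ν) * En g c R := by
  have hR0 : 0 < R := by linarith
  have hn' : (2:ℝ) ≤ n := by exact_mod_cast hn
  have hν0 : 0 ≤ ν := by rw [hν]; linarith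
  set s : E → ℝ := fun x => ‖x - c‖ ^ 2 with hs'
  have s0 : ∀ x, 0 ≤ s x := fun x => sq_nonneg _
  have ss : ContDiff ℝ (⊤ : ℕ∞) s := (contDiff_id.sub contDiff_const).norm_sq ℝ
  have ds : ∀ x, HasFDerivAt s ((2:ℝ) • innerSL ℝ (x - c)) x := fun x => by
    have := (hasFDerivAt_id x).sub_const c |>.norm_sq
    refine this.congr_fderiv ?_
    ext1 v; simp
  have pos : ∀ x, 0 < ρ ^ 2 + s x := fun x => by have := s0 x; positivity
  set χ : E → ℝ := fun x => 1 - kap (s x / R ^ 2) with hχ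
  have kap1 : ∀ t, kap t ≤ 1 := fun t => Real.smoothTransition.le_one _
  have χ0 : ∀ x, 0 ≤ χ x := fun x => sub_nonneg.2 (kap1 _)
  have sχ : ContDiff ℝ (⊤ : ℕ∞) χ := contDiff_const.sub (kap_smooth.comp (ss.div_const _))
  have dχ : ∀ x, HasFDerivAt χ ((-(deriv kap (s x / R ^ 2) * (R ^ 2)⁻¹ * 2)) • innerSL ℝ (x - c)) x := by
    intro x
    have h1 : HasFDerivAt (fun x => s x / R ^ 2) _ x := (ds x).mul_const (R ^ 2)⁻¹
    have h2 : HasDerivAt kap (deriv kap (s x / R ^ 2)) (s x / R ^ 2) :=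
      (kap_smooth.differentiable (by simp) _).hasDerivAt
    refine ((h2.comp_hasFDerivAt x h1).const_sub 1).congr_fderiv ?_
    ext1 v; simp; ring
  set q : E → ℝ := fun x => (ρ ^ 2 + s x) ^ (-ν) with hq
  set q1 : E → ℝ := fun x => (ρ ^ 2 + s x) ^ (-ν - 1) with hq1
  have sq : ContDiff ℝ (⊤ : ℕ∞) q := (contDiff_const.add ss).rpow_const_of_ne fun x => (pos x).ne'
  have sq1 : ContDiff ℝ (⊤ : ℕ∞) q1 := (contDiff_const.add ss).rpow_const_of_ne fun x => (pos x).ne'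
  have dq : ∀ x, HasFDerivAt q ((-(ν * q1 x * 2)) • innerSL ℝ (x - c)) x := fun x => by
    refine (((ds x).const_add (ρ ^ 2)).rpow_const (p := -ν) (Or.inl (pos x).ne')).congr_fderiv ?_
    ext1 v; simp [hq1]; ring
  have q0 : ∀ x, 0 ≤ q x := fun x => Real.rpow_nonneg (pos x).le _
  have q10 : ∀ x, 0 ≤ q1 x := fun x => Real.rpow_nonneg (pos x).le _
  have qq1 : ∀ x, q x = q1 x * (ρ ^ 2 + s x) := fun x => by
    simp only [hq, hq1]; rw [← Real.rpow_add_one (pos x).ne']; ring_nf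
  have out : ∀ x, x ∉ closedBall c R → 1 ≤ s x / R ^ 2 := fun x hx => by
    rw [mem_closedBall, dist_eq_norm, not_le] at hx
    rw [le_div_iff₀ (by positivity), one_mul]; simp only [hs']; gcongr
  have zχ : ∀ x, x ∉ closedBall c R → χ x = 0 := fun x hx => by simp [hχ, kap_one (out x hx)]
  have main := a.radial hn K hcR (α := fun x => q x * χ x)
    (β := fun x => 2 * ν * q1 x * χ x + 2 * q x * deriv kap (s x / R ^ 2) * (R ^ 2)⁻¹)
    ((sq.mul sχ).of_le (by simp))
    ((((contDiff_const.mul sq1).mul sχ).add (((contDiff_const.mul sq).mul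
      (kap'_smooth.comp (ss.div_const _))).mul contDiff_const)).of_le (by simp))
    (fun x => by
      refine ((dq x).mul (dχ x)).congr_fderiv ?_
      ext1 v; simp; ring)
    (fun x => mul_nonneg (q0 x) (χ0 x))
    (fun x => by have := q0 x; have := q10 x; have := χ0 x; have := kap'_nonneg (s x / R ^ 2); positivity)
    (fun x hx => by simp [zχ x hx])
    (fun x hx => by simp [zχ x hx, kap'_zero_right (out x hx)])
  have m1 : MeasurableSet (closedBall c ρ) := measurableSet_closedBall
  have m2 : MeasurableSet (closedBall c R) := measurableSet_closedBall
  have pt : ∀ x, (closedBall c ρ).indicator (fun x => ν * (2 * ρ ^ 2) ^ (-ν) * hs (g x)) x -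
      (closedBall c R).indicator (fun x => 2 * M * (R ^ 2 / 2) ^ (-ν) * hs (g x)) x ≤
      hs (g x) * ((n - 2) * (q x * χ x) - (2 * ν * q1 x * χ x +
        2 * q x * deriv kap (s x / R ^ 2) * (R ^ 2)⁻¹) * ‖x - c‖ ^ 2) := by
    intro x
    have e : (n - 2) * (q x * χ x) - (2 * ν * q1 x * χ x +
        2 * q x * deriv kap (s x / R ^ 2) * (R ^ 2)⁻¹) * ‖x - c‖ ^ 2 =
        2 * ν * χ x * q1 x * ρ ^ 2 - 2 * (q x * deriv kap (s x / R ^ 2) * (s x / R ^ 2)) := by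
      have : (n - 2 : ℝ) = 2 * ν := by rw [hν]; ring
      rw [this, qq1 x]; simp only [hs']; field_simp; ring
    rw [e, mul_sub]
    refine sub_le_sub ?_ ?_
    · by_cases hx : x ∈ closedBall c ρ
      · rw [indicator_of_mem hx, mul_comm]
        refine mul_le_mul_of_nonneg_left ?_ (hs_nonneg _)
        rw [mem_closedBall, dist_eq_norm] at hx
        have hsx : s x ≤ ρ ^ 2 := by simp only [hs']; gcongr
        have hc1 : χ x = 1 := by
          simp only [hχ]; rw [kap_zero, sub_zero]
          rw [div_le_iff₀ (by positivity)]
          have : (2 * ρ) ^ 2 ≤ R ^ 2 := by gcongr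
          nlinarith [sq_nonneg ρ]
        have h2 : (2 * ρ ^ 2) ^ (-ν - 1) ≤ q1 x :=
          Real.rpow_le_rpow_of_nonpos (pos x) (by linarith) (by linarith)
        have h3 : (2 * ρ ^ 2) ^ (-ν) = (2 * ρ ^ 2) ^ (-ν - 1) * (2 * ρ ^ 2) := by
          rw [← Real.rpow_add_one (by positivity)]; ring_nf
        rw [h3, hc1]
        calc _ = 2 * ν * 1 * (2 * ρ ^ 2) ^ (-ν - 1) * ρ ^ 2 := by ring
          _ ≤ _ := by gcongr
      · rw [indicator_of_notMem hx]
        have := χ0 x; have := q10 x; have := hs_nonneg (g x); positivity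
    · by_cases hx : x ∈ closedBall c R
      · rw [indicator_of_mem hx, mul_comm]
        refine mul_le_mul_of_nonneg_right ?_ (hs_nonneg _)
        by_cases h1 : s x / R ^ 2 ≤ 1 / 2
        · rw [kap'_zero_left h1]; simp only [mul_zero, zero_mul]; positivity
        · push Not at h1
          rw [mem_closedBall, dist_eq_norm] at hx
          have h3 : s x / R ^ 2 ≤ 1 := by
            rw [div_le_one (by positivity)]; simp only [hs']; gcongr
          have h2 : q x ≤ (R ^ 2 / 2) ^ (-ν) := by
            refine Real.rpow_le_rpow_of_nonpos (by positivity) ?_ (by linarith)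
            rw [lt_div_iff₀ (by positivity)] at h1
            nlinarith [sq_nonneg ρ]
          have h4 := hM (s x / R ^ 2)
          have h5 := kap'_nonneg (s x / R ^ 2)
          have h7 : 0 ≤ s x / R ^ 2 := by linarith
          have h6 : q x * deriv kap (s x / R ^ 2) * (s x / R ^ 2) ≤ (R ^ 2 / 2) ^ (-ν) * M * 1 := by
            gcongr
          linarith
      · rw [indicator_of_notMem hx, kap'_zero_right (out x hx)]; simp
  have i1 : IntegrableOn ((closedBall c ρ).indicator (fun x => ν * (2 * ρ ^ 2) ^ (-ν) * hs (g x)))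
    (ball y R0) := ((a.ie.const_mul _).indicator m1).integrableOn
  have i2 : IntegrableOn ((closedBall c R).indicator (fun x => 2 * M * (R ^ 2 / 2) ^ (-ν) * hs (g x)))
    (ball y R0) := ((a.ie.const_mul _).indicator m2).integrableOn
  by_cases hI : IntegrableOn (fun x => hs (g x) * ((n - 2) * (q x * χ x) - (2 * ν * q1 x * χ x +
        2 * q x * deriv kap (s x / R ^ 2) * (R ^ 2)⁻¹) * ‖x - c‖ ^ 2)) (ball y R0)
  swap
  · exfalso; apply hI
    obtain ⟨D, hD⟩ := (isCompact_closedBall y R0).exists_bound_of_continuousOn (f := fun x =>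
      ((n:ℝ) - 2) * (q x * χ x) - (2 * ν * q1 x * χ x +
        2 * q x * deriv kap (s x / R ^ 2) * (R ^ 2)⁻¹) * ‖x - c‖ ^ 2) (by
        have := sq.continuous; have := sq1.continuous; have := sχ.continuous
        have := kap'_smooth.continuous; have := ss.continuous
        fun_prop)
    refine a.ie.integrableOn.mul_bdd (c := D) ?_ ?_
    · have := sq.continuous; have := sq1.continuous; have := sχ.continuous
      have := kap'_smooth.continuous; have := ss.continuous
      exact Continuous.aestronglyMeasurable (by fun_prop)
    · exact (ae_restrict_iff' measurableSet_ball).2 (Eventually.of_forall fun x hx =>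
        hD x (ball_subset_closedBall hx))
  have hle := integral_mono (i1.sub i2) hI pt
  replace hle := (integral_sub i1 i2).symm.le.trans hle
  rw [setIntegral_indicator m1, setIntegral_indicator m2, inter_eq_right.2 hcR, inter_eq_right.2
    ((closedBall_subset_closedBall (by linarith)).trans hcR), integral_const_mul,
    integral_const_mul] at hle
  simp only [En]
  linarith

lemma LMin.mono (hn : 2 ≤ n) {ψ Γ : E → ℝ} (K : KerPair n ψ Γ) : ∃ C, 1 ≤ C ∧
    ∀ {y c : E} {R R0 ρ : ℝ} {u : E → F} {g : E → E →L[ℝ] F}, LMin y R0 u g →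
    closedBall c R ⊆ ball y R0 → 0 < ρ → ρ ≤ R → En g c ρ ≤ C * (ρ / R) ^ (n - 2) * En g c R := by
  obtain ⟨M, hM0, hM⟩ := kap'_bdd
  refine ⟨(4 * M + 1) * 2 ^ (n - 2), one_le_mul_of_one_le_of_one_le (by linarith)
    (one_le_pow₀ (by norm_num)), fun {y c R R0 ρ u g} a hcR hρ hR => ?_⟩
  have hR0 : 0 < R := by linarith
  have hE := En_nonneg g c R
  rw [mul_assoc (4 * M + 1), ← mul_pow]
  by_cases h : n = 2 ∨ R < 2 * ρ
  · have h1 : 1 ≤ (2 * (ρ / R)) ^ (n - 2) := by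
      rcases h with h | h
      · simp [h]
      · refine one_le_pow₀ ?_
        rw [← mul_div_assoc, le_div_iff₀ hR0]; linarith
    have h2 : En g c ρ ≤ En g c R := a.En_mono (closedBall_subset_closedBall hR)
    have h3 : 1 ≤ (4 * M + 1) * (2 * (ρ / R)) ^ (n - 2) :=
      one_le_mul_of_one_le_of_one_le (by linarith) h1
    exact h2.trans (le_mul_of_one_le_left hE h3)
  · push Not at h
    have h3 : 3 ≤ n := by omega
    have h3' : (3:ℝ) ≤ n := by exact_mod_cast h3
    set ν : ℝ := (n - 2) / 2 with hν
    have hν0 : 1 / 2 ≤ ν := by rw [hν]; linarith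
    have key := a.mono1 hn K hcR hρ h.2 hM0 hM hν
    have e : (R ^ 2 / 2) ^ (-ν) = (2 * (ρ / R)) ^ (n - 2) * (2 * ρ ^ 2) ^ (-ν) := by
      have h4 : (2 * (ρ / R)) ^ (n - 2) = ((2 * (ρ / R)) ^ 2) ^ ν := by
        rw [← Real.rpow_natCast, ← Real.rpow_natCast, ← Real.rpow_mul (by positivity)]
        congr 1
        rw [Nat.cast_sub (by omega), hν]; push_cast; ring
      rw [h4, Real.rpow_neg (by positivity), Real.rpow_neg (by positivity), ← Real.inv_rpow (by positivity),
        ← Real.inv_rpow (by positivity), ← Real.mul_rpow (by positivity) (by positivity)]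
      congr 1
      field_simp
    rw [e] at key
    have hp : 0 < (2 * ρ ^ 2) ^ (-ν) := by positivity
    have k2 : ν * En g c ρ ≤ 2 * M * (2 * (ρ / R)) ^ (n - 2) * En g c R := by
      refine le_of_mul_le_mul_left ?_ hp
      linarith
    have k3 : 1 / 2 * En g c ρ ≤ ν * En g c ρ := by gcongr; exact En_nonneg _ _ _
    have k4 : 0 ≤ (2 * (ρ / R)) ^ (n - 2) * En g c R := by positivity
    linarith
end
end

noncomputable section
section
variable {n p : ℕ}
local notation "E" => EuclideanSpace ℝ (Fin n)
local notation "F" => EuclideanSpace ℝ (Fin p)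

lemma gmol_bound' {V W X : Type*} [NormedAddCommGroup V] [NormedSpace ℝ V] [NormedAddCommGroup W]
    [NormedSpace ℝ W] [NormedAddCommGroup X] [NormedSpace ℝ X] (B : W →L[ℝ] V →L[ℝ] X) {K : E → W}
    (hK : Continuous K) (hK0 : ∀ z, 1 ≤ ‖z‖ → K z = 0) : ∃ b, 0 ≤ b ∧ ∀ {s : ℝ}, 0 < s →
    ∀ {u : E → V} (x : E), IntegrableOn u (closedBall x s) →
    ‖gmol B K s u x‖ ≤ b * ((s ^ n)⁻¹ * ∫ y in closedBall x s, ‖u y‖) := by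
  obtain ⟨M, h0, hM⟩ := bdd_of_zero hK hK0
  exact ⟨‖B‖ * M, by positivity, fun hs _ x hu => gmol_bound B hM hK0 hs x hu⟩

lemma wcs {μ : Measure E} {w f : E → ℝ} (h0 : ∀ x, 0 ≤ w x) (i0 : Integrable w μ)
    (i1 : Integrable (fun x => w x * f x) μ) (i2 : Integrable (fun x => w x * f x ^ 2) μ) :
    (∫ x, w x * f x ∂μ) ^ 2 ≤ (∫ x, w x ∂μ) * ∫ x, w x * f x ^ 2 ∂μ := by
  have h : ∀ t : ℝ, 0 ≤ (∫ x, w x ∂μ) * (t * t) + (-2 * ∫ x, w x * f x ∂μ) * t +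
      ∫ x, w x * f x ^ 2 ∂μ := by
    intro t
    have e : ∫ x, (w x * (t * t) + (w x * f x) * (-2 * t)) + w x * f x ^ 2 ∂μ =
        (∫ x, w x ∂μ) * (t * t) + (-2 * ∫ x, w x * f x ∂μ) * t + ∫ x, w x * f x ^ 2 ∂μ := by
      rw [integral_add (f := fun x => w x * (t * t) + (w x * f x) * (-2 * t))
        ((i0.mul_const _).add (i1.mul_const _)) i2,
        integral_add (i0.mul_const _) (i1.mul_const _), integral_mul_const, integral_mul_const]
      ring
    rw [← e]
    refine integral_nonneg fun x => ?_
    have := mul_nonneg (h0 x) (sq_nonneg (t - f x))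
    simp only [Pi.zero_apply]
    linarith
  have := discrim_le_zero h
  unfold discrim at this
  linarith

lemma cs_ball {g : E → E →L[ℝ] F} (ig : Integrable g) (ie : Integrable (fun x => hs (g x))) (x : E)
    {r : ℝ} (hr : 0 ≤ r) :
    (∫ y in closedBall x r, ‖g y‖) ^ 2 ≤ r ^ n * volume.real (ball (0 : E) 1) * En g x r := by
  have i2 : Integrable (fun x => ‖g x‖ ^ 2) := ie.mono' (ig.1.norm.pow 2)
    (Eventually.of_forall fun x => by
      rw [Real.norm_of_nonneg (by positivity)]; exact hs_ge _)
  have := wcs (μ := volume.restrict (closedBall x r)) (w := fun _ => 1) (f := fun y => ‖g y‖)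
    (fun _ => zero_le_one) (integrableOn_const measure_closedBall_lt_top.ne) (by simp only [one_mul]; exact ig.norm.integrableOn)
    (by simp only [one_mul]; exact i2.integrableOn)
  simp only [one_mul, integral_const, smul_eq_mul, mul_one, measureReal_restrict_apply_univ] at this
  rw [vball x hr] at this
  refine this.trans ?_
  have : 0 ≤ volume.real (ball (0 : E) 1) := measureReal_nonneg
  gcongr
  exact integral_mono i2.integrableOn ie.integrableOn fun x => hs_ge _

lemma hs_vgrad {ψ Γ : E → ℝ} (K : KerPair n ψ Γ) {τ : E → ℝ} (hτ : LipschitzWith (1/2) τ)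
    (hτ1 : ContDiff ℝ 1 τ) {g : E → E →L[ℝ] F} (ig : Integrable g)
    (ie : Integrable (fun x => hs (g x))) :
    ∀ᵐ x, hs (vgrad ψ τ g x) ≤ 4 * vmol ψ τ (fun x => hs (g x)) x := by
  have h1 := (vmol_prod K.sψ.continuous K.zψ hτ ie).1.prod_right_ae
  have h2 := (vgrad_prod K.sψ.continuous K.zψ hτ hτ1 ig).prod_right_ae
  filter_upwards [h1, h2] with x h1 h2
  simp only [smul_eq_mul] at h1
  set G : E → E →L[ℝ] F := fun z => (g (x - τ x • z)).comp (dF τ x z) with hG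
  have hGle : ∀ z, ψ z * hs (G z) ≤ 4 * (ψ z * hs (g (x - τ x • z))) := by
    intro z
    by_cases hz : 1 ≤ ‖z‖
    · simp [K.zψ z hz]
    · have : hs (G z) ≤ 2 ^ 2 * hs (g (x - τ x • z)) := (hs_pre_le _ _).trans (by
        gcongr; exacts [hs_nonneg _, dF_norm hτ x (by linarith)])
      have := mul_le_mul_of_nonneg_left this (K.pos z)
      linarith
  have iGe : ∀ i, Integrable (fun z => ψ z * ‖G z (EuclideanSpace.single i 1)‖) := fun i => by
    have := (int_app h2 (EuclideanSpace.single i 1)).norm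
    refine this.congr (Eventually.of_forall fun z => ?_)
    simp only [ContinuousLinearMap.smul_apply, norm_smul, Real.norm_of_nonneg (K.pos z), hG]
  have iG2 : ∀ i, Integrable (fun z => ψ z * ‖G z (EuclideanSpace.single i 1)‖ ^ 2) := fun i => by
    have e : (fun z => ψ z * ‖G z (EuclideanSpace.single i 1)‖ ^ 2) = fun z =>
        (ψ z * ‖G z (EuclideanSpace.single i 1)‖) ^ 2 / ψ z := by
      funext z
      by_cases h : ψ z = 0
      · simp [h]
      · field_simp
    refine (h1.const_mul 4).mono' ?_ (Eventually.of_forall fun z => ?_)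
    · rw [e]
      exact (((iGe i).1.aemeasurable.pow_const 2).div
        K.sψ.continuous.measurable.aemeasurable).aestronglyMeasurable
    · rw [Real.norm_of_nonneg (mul_nonneg (K.pos z) (sq_nonneg _))]
      refine le_trans (mul_le_mul_of_nonneg_left ?_ (K.pos z)) (hGle z)
      exact Finset.single_le_sum (f := fun i => ‖G z (EuclideanSpace.single i 1)‖ ^ 2)
        (fun i _ => sq_nonneg _) (Finset.mem_univ i)
  calc hs (vgrad ψ τ g x) = ∑ i, ‖∫ z, (ψ z • G z) (EuclideanSpace.single i 1)‖ ^ 2 := by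
        simp only [hs, vgrad]
        refine Finset.sum_congr rfl fun i _ => ?_
        rw [ContinuousLinearMap.integral_apply h2]
    _ ≤ ∑ i, ∫ z, ψ z * ‖G z (EuclideanSpace.single i 1)‖ ^ 2 := by
        refine Finset.sum_le_sum fun i _ => ?_
        have h3 := wcs K.pos K.int (iGe i) (iG2 i)
        rw [K.one, one_mul] at h3
        refine le_trans ?_ h3
        gcongr
        refine (norm_integral_le_integral_norm _).trans_eq (integral_congr_ae
          (Eventually.of_forall fun z => ?_))
        simp only [ContinuousLinearMap.smul_apply, norm_smul, Real.norm_of_nonneg (K.pos z)]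
    _ = ∫ z, ψ z * hs (G z) := by
        rw [← integral_finsetSum _ fun i _ => iG2 i]
        simp only [hs, Finset.mul_sum]
    _ ≤ ∫ z, 4 * (ψ z * hs (g (x - τ x • z))) := by
        refine integral_mono ?_ (h1.const_mul 4) hGle
        have := integrable_finsetSum Finset.univ fun i _ => iG2 i
        simpa only [hs, Finset.mul_sum] using this
    _ = _ := by rw [integral_const_mul]; simp [vmol]

lemma LMin.grad_step {ψ Γ : E → ℝ} (K : KerPair n ψ Γ) {y : E} {R0 : ℝ} {u : E → F}
    {g : E → E →L[ℝ] F} (a : LMin y R0 u g) {s : ℝ} (hs0 : 0 < s) {x : E}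
    (hx : closedBall x (2 * s) ⊆ ball y R0) :
    mol ψ (s / 2) g x - mol ψ s g x = s • gmol ((ContinuousLinearMap.lsmul ℝ ℝ : ℝ →L[ℝ] F →L[ℝ] F).precompL E)
      (fderiv ℝ Γ) s (fun x => -hs (g x) • u x) x := by
  have sΓ : ContDiff ℝ 1 Γ := K.sΓ.of_le (by simp)
  have d1 := (a.w.mol_hasFDerivAt K.sψ K.zψ (half_pos hs0) x).sub
    (a.w.mol_hasFDerivAt K.sψ K.zψ hs0 x)
  have d2 := (gmol_hasFDerivAt (ContinuousLinearMap.lsmul ℝ ℝ : ℝ →L[ℝ] F →L[ℝ] F) sΓ K.zΓ hs0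
    a.iQ.locallyIntegrable x).const_smul (s ^ 2)
  have ev : (fun x => mol ψ (s / 2) u x - mol ψ s u x) =ᶠ[nhds x] fun x =>
      s ^ 2 • gmol (ContinuousLinearMap.lsmul ℝ ℝ : ℝ →L[ℝ] F →L[ℝ] F) Γ s (fun x => -hs (g x) • u x) x := by
    filter_upwards [ball_mem_nhds x hs0] with x' hx'
    rw [← mol_gmol]
    refine kernel_id K a.w.iu (fun φ h1 h2 h3 => a.el h1 h2 h3) hs0 (subset_trans ?_ hx)
    intro z hz
    rw [mem_closedBall] at *
    rw [mem_ball] at hx'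
    linarith [dist_triangle z x' x]
  have := d1.unique (d2.congr_of_eventuallyEq ev)
  rw [this, smul_smul]
  congr 1
  field_simp

lemma LMin.Q_le {y : E} {R0 : ℝ} {u : E → F} {g : E → E →L[ℝ] F} (a : LMin y R0 u g) (x : E) (s : ℝ) :
    ∫ z in closedBall x s, ‖-hs (g z) • u z‖ ≤ En g x s := by
  refine integral_mono_ae a.iQ.norm.integrableOn a.ie.integrableOn (ae_restrict_of_ae ?_)
  filter_upwards [a.bd] with z hz
  simp only [norm_smul, norm_neg, Real.norm_of_nonneg (hs_nonneg _)]
  exact mul_le_of_le_one_right (hs_nonneg _) hz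

lemma LMin.inner_bd {ψ Γ : E → ℝ} (K : KerPair n ψ Γ) : ∃ C, 0 ≤ C ∧
    ∀ {y : E} {R0 : ℝ} {u : E → F} {g : E → E →L[ℝ] F}, LMin y R0 u g → ∀ {s : ℝ}, 0 < s → ∀ x,
    closedBall x (2 * s) ⊆ ball y R0 → ∀ J : ℕ, ‖mol ψ (s / 2 ^ J) g x‖ ≤
      C * ((s ^ n)⁻¹ * ∫ y in closedBall x s, ‖g y‖) +
      J * ((2 ^ n) ^ J * (C * (s * ((s ^ n)⁻¹ * En g x s)))) := by
  have sΓ : ContDiff ℝ 1 Γ := K.sΓ.of_le (by simp)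
  obtain ⟨b1, hb10, h1⟩ := gmol_bound' (ContinuousLinearMap.lsmul ℝ ℝ : ℝ →L[ℝ] (E →L[ℝ] F) →L[ℝ] (E →L[ℝ] F))
    K.sψ.continuous K.zψ
  obtain ⟨b2, hb20, h2⟩ := gmol_bound' ((ContinuousLinearMap.lsmul ℝ ℝ : ℝ →L[ℝ] F →L[ℝ] F).precompL E)
    (sΓ.continuous_fderiv one_ne_zero) (fderiv_zero_of sΓ K.zΓ)
  refine ⟨b1 + b2, add_nonneg hb10 hb20, fun {y R0 u g} a {s} hs0 x hx J => ?_⟩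
  induction J with
  | zero =>
    simp only [pow_zero, div_one, Nat.cast_zero, zero_mul, add_zero, mol_gmol]
    refine (h1 hs0 x a.w.ig.integrableOn).trans ?_
    have : 0 ≤ ∫ y in closedBall x s, ‖g y‖ := integral_nonneg fun _ => norm_nonneg _
    gcongr
    exact le_add_of_nonneg_right hb20
  | succ J ih =>
    have hsJ : 0 < s / 2 ^ J := by positivity
    have hle : s / 2 ^ J ≤ s := div_le_self hs0.le (one_le_pow₀ (by norm_num))
    have st := a.grad_step K hsJ ((closedBall_subset_closedBall (by linarith)).trans hx)
    have e : mol ψ (s / 2 ^ (J + 1)) g x = mol ψ (s / 2 ^ J) g x + (s / 2 ^ J) • gmol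
        ((ContinuousLinearMap.lsmul ℝ ℝ : ℝ →L[ℝ] F →L[ℝ] F).precompL E)
      (fderiv ℝ Γ) (s / 2 ^ J) (fun x => -hs (g x) • u x) x := by
      rw [← st, pow_succ, ← div_div]; exact (add_sub_cancel _ _).symm
    have hT : ‖(s / 2 ^ J) • gmol ((ContinuousLinearMap.lsmul ℝ ℝ : ℝ →L[ℝ] F →L[ℝ] F).precompL E)
      (fderiv ℝ Γ) (s / 2 ^ J) (fun x => -hs (g x) • u x) x‖ ≤
        (2 ^ n) ^ J * ((b1 + b2) * (s * ((s ^ n)⁻¹ * En g x s))) := by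
      rw [norm_smul, Real.norm_of_nonneg hsJ.le]
      have h3 := h2 hsJ x a.iQ.integrableOn
      have h4 : ∫ z in closedBall x (s / 2 ^ J), ‖-hs (g z) • u z‖ ≤ En g x s :=
        (a.Q_le x _).trans (a.En_mono (closedBall_subset_closedBall hle))
      have h5 : ((s / 2 ^ J) ^ n)⁻¹ = (2 ^ n) ^ J * (s ^ n)⁻¹ := by
        rw [div_pow, inv_div, ← pow_mul, ← pow_mul, mul_comm J n]; rfl
      have h6 := En_nonneg g x s
      rw [h5] at h3
      calc _ ≤ s * ((b1 + b2) * ((2 ^ n) ^ J * (s ^ n)⁻¹ * En g x s)) := by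
            refine mul_le_mul hle (h3.trans ?_) (norm_nonneg _) hs0.le
            have h7 : 0 ≤ ∫ z in closedBall x (s / 2 ^ J), ‖-hs (g z) • u z‖ :=
              integral_nonneg fun _ => norm_nonneg _
            gcongr
            exact le_add_of_nonneg_left hb10
        _ = _ := by ring
    rw [e]
    refine (norm_add_le _ _).trans ((add_le_add ih hT).trans ?_)
    set D := (b1 + b2) * (s * ((s ^ n)⁻¹ * En g x s)) with hD
    have hD0 : 0 ≤ D := by have := En_nonneg g x s; positivity
    have h8 : ((2:ℝ) ^ n) ^ J ≤ (2 ^ n) ^ (J + 1) := pow_le_pow_right₀ (one_le_pow₀ (by norm_num)) (by omega)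
    have h9 : ((2:ℝ) ^ n) ^ J * D ≤ (2 ^ n) ^ (J + 1) * D := by gcongr
    have h10 := mul_le_mul_of_nonneg_left h9 (Nat.cast_nonneg (α := ℝ) J)
    push_cast
    linarith
end
end

noncomputable section
section
variable {n p : ℕ}
local notation "E" => EuclideanSpace ℝ (Fin n)
local notation "F" => EuclideanSpace ℝ (Fin p)

lemma cb_sub {x c : E} {r R : ℝ} (h : dist x c + r ≤ R) : closedBall x r ⊆ closedBall c R :=
  fun z hz => by
    rw [mem_closedBall] at *
    linarith [dist_triangle z x c]

lemma LMin.inner2 (hn : 2 ≤ n) {ψ Γ : E → ℝ} (K : KerPair n ψ Γ) : ∃ C0, 0 ≤ C0 ∧ ∀ J : ℕ,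
    ∃ CJ, 0 ≤ CJ ∧ ∀ {y : E} {R0 : ℝ} {u : E → F} {g : E → E →L[ℝ] F}, LMin y R0 u g →
    ∀ {c : E} {R ε : ℝ}, 0 < R → closedBall c R ⊆ ball y R0 → En g c R ≤ ε * R ^ (n - 2) →
    ∀ x ∈ closedBall c (R / 2), hs (mol ψ (R / 4 / 2 ^ J) g x) ≤
      (C0 + CJ * ε) * ((R ^ n)⁻¹ * En g c R) := by
  obtain ⟨C, hC0, hC⟩ := LMin.inner_bd (p := p) K
  set ω := volume.real (ball (0 : E) 1) with hω
  have hω0 : 0 < ω := vball_pos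
  refine ⟨2 * n * (C ^ 2 * ω) * 4 ^ n, by positivity, fun J => ⟨2 * n * (J * (2 ^ n) ^ J * C) ^ 2 *
    4 ^ (n - 2) * 4 ^ n, by positivity, fun {y R0 u g} a {c R ε} hR hcR hE x hx => ?_⟩⟩
  rw [mem_closedBall] at hx
  set s := R / 4 with hs'
  have hs0 : 0 < s := by positivity
  have hRs : R = 4 * s := by rw [hs']; ring
  have h1 := hC a hs0 x ((cb_sub (by linarith)).trans hcR) J
  have hEx : En g x s ≤ En g c R := a.En_mono (cb_sub (by linarith))
  have hEx0 := En_nonneg g x s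
  set I := ∫ y in closedBall x s, ‖g y‖ with hI
  have hI2 : I ^ 2 ≤ s ^ n * ω * En g c R := (cs_ball a.w.ig a.ie x hs0.le).trans (by gcongr)
  set Ec := En g c R with hEc
  have hEc0 : 0 ≤ Ec := En_nonneg _ _ _
  set D : ℝ := J * (2 ^ n) ^ J * C with hD
  set A := C * ((s ^ n)⁻¹ * I) with hA
  set B := D * (s * ((s ^ n)⁻¹ * En g x s)) with hB
  have hB' : J * ((2 ^ n) ^ J * (C * (s * ((s ^ n)⁻¹ * En g x s)))) = B := by rw [hB, hD]; ring
  rw [hB'] at h1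
  have hsn : 0 < s ^ n := by positivity
  have hA2 : A ^ 2 ≤ C ^ 2 * ω * ((s ^ n)⁻¹ * Ec) := by
    calc A ^ 2 = C ^ 2 * ((s ^ n)⁻¹) ^ 2 * I ^ 2 := by rw [hA]; ring
      _ ≤ C ^ 2 * ((s ^ n)⁻¹) ^ 2 * (s ^ n * ω * Ec) := by gcongr
      _ = _ := by field_simp
  have hB2 : B ^ 2 ≤ D ^ 2 * 4 ^ (n - 2) * ε * ((s ^ n)⁻¹ * Ec) := by
    have hsq : s ^ n = s ^ 2 * s ^ (n - 2) := by rw [← pow_add]; congr 1; omega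
    have hEE : En g x s ^ 2 ≤ (ε * (4 ^ (n - 2) * s ^ (n - 2))) * Ec := by
      rw [sq, ← mul_pow, ← hRs]
      exact mul_le_mul (hEx.trans hE) hEx hEx0 (hEc0.trans hE)
    calc B ^ 2 = D ^ 2 * (s ^ 2 * ((s ^ n)⁻¹) ^ 2) * En g x s ^ 2 := by rw [hB]; ring
      _ ≤ D ^ 2 * (s ^ 2 * ((s ^ n)⁻¹) ^ 2) * ((ε * (4 ^ (n - 2) * s ^ (n - 2))) * Ec) := by gcongr
      _ = D ^ 2 * 4 ^ (n - 2) * ε * (((s ^ n)⁻¹) * ((s ^ n)⁻¹ * (s ^ 2 * s ^ (n - 2))) * Ec) := by ring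
      _ = _ := by rw [← hsq, inv_mul_cancel₀ hsn.ne', mul_one]
  refine (hs_le _).trans ?_
  have h3 : ‖mol ψ (s / 2 ^ J) g x‖ ^ 2 ≤ 2 * (A ^ 2 + B ^ 2) := by
    calc _ ≤ (A + B) ^ 2 := by gcongr
      _ ≤ _ := add_sq_le
  calc _ ≤ n * (2 * (C ^ 2 * ω * ((s ^ n)⁻¹ * Ec) + D ^ 2 * 4 ^ (n - 2) * ε * ((s ^ n)⁻¹ * Ec))) := by
        gcongr; linarith
    _ = _ := by
        rw [hRs, mul_pow]
        field_simp
        rw [mul_pow]; ring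

lemma LMin.lower (hn : 2 ≤ n) {ψ Γ : E → ℝ} (K : KerPair n ψ Γ) : ∃ C, 0 ≤ C ∧
    ∀ {y : E} {R0 : ℝ} {u : E → F} {g : E → E →L[ℝ] F}, LMin y R0 u g →
    ∀ {c : E} {R ε : ℝ}, 0 < R → closedBall c R ⊆ ball y R0 → En g c R ≤ ε * R ^ (n - 2) →
    ∀ x ∈ closedBall c (R / 2), ∀ τ, 0 < τ → 6 * τ ≤ R → 1 - ‖mol ψ τ u x‖ ≤ C * √ε := by
  obtain ⟨Cl, hl0, hl⟩ := mol_lower (V := F) K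
  obtain ⟨Cm, hm1, hm⟩ := LMin.mono (p := p) hn K
  set ω := volume.real (ball (0 : E) 1) with hω
  have hω0 : 0 < ω := vball_pos
  refine ⟨Cl * √(3 ^ n * ω * Cm * 6 ^ (n - 2)), by positivity,
    fun {y R0 u g} a {c R ε} hR hcR hE x hx τ hτ hτR => ?_⟩
  rw [mem_closedBall] at hx
  have hsub : closedBall x (R / 2) ⊆ closedBall c R := cb_sub (by linarith)
  have h1 := hl u g a.w x τ hτ (by
    filter_upwards [a.one] with b hb hbx
    exact hb (hcR (hsub (closedBall_subset_closedBall (by linarith) hbx))))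
  refine h1.trans ?_
  rw [mul_assoc]
  refine mul_le_mul_of_nonneg_left ?_ hl0
  rw [← Real.sqrt_mul (by positivity)]
  refine Real.le_sqrt_of_sq_le ?_
  have h2 := cs_ball a.w.ig a.ie x (r := 3 * τ) (by positivity)
  have h3 := hm a (hsub.trans hcR) (ρ := 3 * τ) (by positivity) (by linarith)
  have h4 : En g x (R / 2) ≤ ε * R ^ (n - 2) := (a.En_mono hsub).trans hE
  set I := ∫ y in closedBall x (3 * τ), ‖g y‖ with hI
  have hn2 : τ ^ n = τ ^ 2 * τ ^ (n - 2) := by rw [← pow_add]; congr 1; omega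
  have h5 : Cm * (3 * τ / (R / 2)) ^ (n - 2) * (ε * R ^ (n - 2)) = Cm * 6 ^ (n - 2) * τ ^ (n - 2) * ε := by
    have : (3 * τ / (R / 2)) = 6 * τ * R⁻¹ := by field_simp; ring
    rw [this, mul_pow, mul_pow]
    have : R⁻¹ ^ (n - 2) * R ^ (n - 2) = 1 := by rw [← mul_pow, inv_mul_cancel₀ hR.ne', one_pow]
    linear_combination Cm * 6 ^ (n - 2) * τ ^ (n - 2) * ε * this
  calc ((τ ^ n)⁻¹ * (τ * I)) ^ 2 = ((τ ^ n)⁻¹) ^ 2 * τ ^ 2 * I ^ 2 := by ring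
    _ ≤ ((τ ^ n)⁻¹) ^ 2 * τ ^ 2 * ((3 * τ) ^ n * ω * (Cm * (3 * τ / (R / 2)) ^ (n - 2) * (ε * R ^ (n - 2)))) := by
        gcongr
        exact h2.trans (by gcongr; exact h3.trans (by gcongr))
    _ = ((τ ^ n)⁻¹ * (τ ^ 2 * τ ^ (n - 2))) * ((τ ^ n)⁻¹ * τ ^ n) * (3 ^ n * ω * Cm * 6 ^ (n - 2) * ε) := by
        rw [h5, mul_pow]; ring
    _ = _ := by rw [← hn2, inv_mul_cancel₀ (by positivity)]; ring

/-- cutoff scale function -/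
lemma tau_exists {M : ℝ} (hM0 : 0 ≤ M) (hM : ∀ t, deriv kap t ≤ M) (c : E) {b1 b2 τ0 : ℝ} (hb1 : 0 < b1)
    (hb : b1 < b2) (hτ : 0 < τ0) (hτM : 2 * M * τ0 ≤ b2 - b1) : ∃ τ : E → ℝ, ContDiff ℝ 1 τ ∧
    LipschitzWith (1/2) τ ∧ (∀ x, 0 ≤ τ x) ∧ (∀ x, τ x ≤ τ0) ∧
    (∀ x ∈ closedBall c b1, τ x = τ0 ∧ fderiv ℝ τ x = 0) ∧
    ∀ x, x ∉ ball c b2 → τ x = 0 ∧ fderiv ℝ τ x = 0 := by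
  set s : E → ℝ := fun x => ‖x - c‖ ^ 2 with hs'
  have ss : ContDiff ℝ (⊤ : ℕ∞) s := (contDiff_id.sub contDiff_const).norm_sq ℝ
  have ds : ∀ x, HasFDerivAt s ((2:ℝ) • innerSL ℝ (x - c)) x := fun x => by
    have := (hasFDerivAt_id x).sub_const c |>.norm_sq
    refine this.congr_fderiv ?_
    ext1 v; simp
  set k : ℝ := (2 * (b2 ^ 2 - b1 ^ 2))⁻¹ with hk
  have hbb : 0 < b2 ^ 2 - b1 ^ 2 := by nlinarith
  have hk0 : 0 < k := by positivity
  have hkb : k * (b2 ^ 2 - b1 ^ 2) = 1 / 2 := by rw [hk]; field_simp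
  set T : E → ℝ := fun x => 1 / 2 + (s x - b1 ^ 2) * k with hT
  have hT1 : ∀ x ∈ closedBall c b1, T x ≤ 1 / 2 := fun x hx => by
    rw [mem_closedBall, dist_eq_norm] at hx
    have : s x ≤ b1 ^ 2 := by simp only [hs']; gcongr
    have := mul_nonneg (sub_nonneg.2 this) hk0.le
    simp only [hT]; linarith
  have hT2 : ∀ x, x ∉ ball c b2 → 1 ≤ T x := fun x hx => by
    rw [mem_ball, dist_eq_norm, not_lt] at hx
    have hb2 : 0 < b2 := hb1.trans hb
    have : b2 ^ 2 ≤ s x := by simp only [hs']; gcongr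
    have := mul_nonneg (sub_nonneg.2 this) hk0.le
    simp only [hT]; linarith
  have sT : ContDiff ℝ (⊤ : ℕ∞) T := contDiff_const.add ((ss.sub contDiff_const).mul contDiff_const)
  have d : ∀ x, HasFDerivAt (fun x => τ0 * (1 - kap (T x))) ((-(τ0 * deriv kap (T x) * k * 2)) • innerSL ℝ (x - c)) x := by
    intro x
    have h1 : HasFDerivAt T _ x := (((ds x).sub_const (b1 ^ 2)).mul_const k).const_add (1 / 2)
    have h2 : HasDerivAt kap (deriv kap (T x)) (T x) :=
      (kap_smooth.differentiable (by simp) _).hasDerivAt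
    refine (((h2.comp_hasFDerivAt x h1).const_sub 1).const_mul τ0).congr_fderiv ?_
    ext1 v; simp; ring
  have kap1 : ∀ t, kap t ≤ 1 := fun t => Real.smoothTransition.le_one _
  have kap0 : ∀ t, 0 ≤ kap t := fun t => Real.smoothTransition.nonneg _
  refine ⟨fun x => τ0 * (1 - kap (T x)), (contDiff_const.mul (contDiff_const.sub
    (kap_smooth.comp sT))).of_le (by simp), ?_, fun x => mul_nonneg hτ.le (sub_nonneg.2 (kap1 _)),
    fun x => mul_le_of_le_one_right hτ.le (by linarith [kap0 (T x)]), fun x hx => ⟨?_, ?_⟩, fun x hx => ⟨?_, ?_⟩⟩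
  · refine lipschitzWith_of_nnnorm_fderiv_le (fun x => (d x).differentiableAt) fun x => ?_
    rw [← NNReal.coe_le_coe, coe_nnnorm, (d x).fderiv, norm_smul, innerSL_apply_norm, norm_neg,
      Real.norm_of_nonneg (by have := kap'_nonneg (T x); positivity)]
    have : ((1/2 : NNReal) : ℝ) = 1/2 := by norm_num
    rw [this]
    by_cases hx : x ∈ ball c b2
    · rw [mem_ball, dist_eq_norm] at hx
      have hb2 : 0 < b2 := hb1.trans hb
      calc τ0 * deriv kap (T x) * k * 2 * ‖x - c‖ ≤ τ0 * M * k * 2 * b2 := by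
            have := kap'_nonneg (T x)
            gcongr
            exact hM _
        _ = (2 * M * τ0) * (k * b2) := by ring
        _ ≤ (b2 - b1) * (k * b2) := by gcongr
        _ ≤ (b2 - b1) * (k * (b2 + b1)) := by have := sub_nonneg.2 hb.le; gcongr; linarith
        _ = 1 / 2 := by rw [← hkb]; ring
    · rw [kap'_zero_right (hT2 x hx)]; simp
  · simp only [kap_zero (hT1 x hx)]; ring
  · rw [(d x).fderiv, kap'_zero_left (hT1 x hx)]; simp
  · simp only [kap_one (hT2 x hx)]; ring
  · rw [(d x).fderiv, kap'_zero_right (hT2 x hx)]; simp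
end
end

noncomputable section
section
variable {n p : ℕ}
local notation "E" => EuclideanSpace ℝ (Fin n)
local notation "F" => EuclideanSpace ℝ (Fin p)

lemma LMin.cmp {ψ Γ : E → ℝ} (K : KerPair n ψ Γ) {y : E} {R0 : ℝ} {u : E → F} {g : E → E →L[ℝ] F}
    (a : LMin y R0 u g) {c : E} {a1 b1 b2 a2 τ0 B : ℝ} {τ : E → ℝ} (h11 : 0 < b1) (hb : b1 < b2)
    (h1 : a1 + τ0 ≤ b1) (h2 : b2 + τ0 ≤ a2) (hτ0 : 0 < τ0) (hc : closedBall c a2 ⊆ ball y R0)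
    (t1 : ContDiff ℝ 1 τ) (tl : LipschitzWith (1/2) τ) (tp : ∀ x, 0 ≤ τ x) (tle : ∀ x, τ x ≤ τ0)
    (ti : ∀ x ∈ closedBall c b1, τ x = τ0 ∧ fderiv ℝ τ x = 0)
    (tz : ∀ x, x ∉ ball c b2 → τ x = 0 ∧ fderiv ℝ τ x = 0)
    (hlow : ∀ x ∈ closedBall c b2, ∀ t, 0 < t → t ≤ τ0 → 1 / 2 ≤ ‖mol ψ t u x‖)
    (hB : ∀ x ∈ closedBall c b1, hs (mol ψ τ0 g x) ≤ B) (hB0 : 0 ≤ B) :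
    En g c a1 ≤ 4 * B * (b1 ^ n * volume.real (ball (0 : E) 1)) +
      16 * 2 ^ n * (En g c a2 - En g c a1) := by
  set v := vmol ψ τ u with hv
  set h := vgrad ψ τ g with hh
  set A := closedBall c a2 \ closedBall c a1 with hA
  have mA : MeasurableSet A := measurableSet_closedBall.diff measurableSet_closedBall
  set f : E → ℝ := A.indicator (fun x => hs (g x)) with hf
  have f0 : ∀ x, 0 ≤ f x := fun x => indicator_nonneg (fun _ _ => hs_nonneg _) x
  have fi : Integrable f := a.ie.indicator mA
  have hW := a.w.vmol K tl t1
  have hvm := vmol_integrable K.sψ.continuous K.zψ tl a.ie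
  have hvf := vmol_integrable K.sψ.continuous K.zψ tl fi
  have hle := hs_vgrad K tl t1 a.w.ig a.ie
  have ih : Integrable (fun x => hs (h x)) := by
    refine (hvm.1.const_mul 4).mono' (hs_meas hW.ig.1) ?_
    filter_upwards [hle] with x hx
    rwa [Real.norm_of_nonneg (hs_nonneg _)]
  have v0 : ∀ x, τ x = 0 → v x = u x := fun x hx => by
    simp only [hv, vmol, hx, zero_smul, sub_zero]
    rw [integral_smul_const, K.one, one_smul]
  have hd : ∀ x, fderiv ℝ τ x = 0 → h x = mol ψ (τ x) g x := fun x hx => by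
    have : ∀ z, dF τ x z = ContinuousLinearMap.id ℝ E := fun z => by
      simp [dF, hx]
    simp only [hh, vgrad, this, ContinuousLinearMap.comp_id, mol, vmol]
  have h0 : ∀ x, x ∉ ball c b2 → h x = g x := fun x hx => by
    rw [hd x (tz x hx).2, (tz x hx).1]
    simp only [mol, vmol, zero_smul, sub_zero]
    rw [integral_smul_const, K.one, one_smul]
  have hb2a : closedBall c b2 ⊆ ball y R0 := (closedBall_subset_closedBall (by linarith)).trans hc
  obtain ⟨σ, hσ, hσ'⟩ := cb_ball hb2a
  have vlow : ∀ᵐ x, x ∈ ball y R0 → 1/2 ≤ ‖v x‖ := by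
    filter_upwards [a.one] with x hx hxR
    by_cases ht : τ x = 0
    · rw [v0 x ht, hx hxR]; norm_num
    · have hxb : x ∈ ball c b2 := by by_contra hxb; exact ht (tz x hxb).1
      exact hlow x (ball_subset_closedBall hxb) (τ x) (lt_of_le_of_ne (tp x) (Ne.symm ht)) (tle x)
  have hmin := a.mini v h σ hσ hW ih (Eventually.of_forall fun x hx => v0 x (tz x fun hx' =>
    hx (hσ' (ball_subset_closedBall hx'))).1) vlow
  set G : E → ℝ := fun x => (hs (g x) - (closedBall c b2).indicator (fun x => hs (g x)) x) +
    ((closedBall c b1).indicator (fun _ => 4 * B) x + 16 * vmol ψ τ f x) with hG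
  have i1 : Integrable ((closedBall c b2).indicator (fun x => hs (g x))) :=
    a.ie.indicator measurableSet_closedBall
  have i2 : Integrable ((closedBall c b1).indicator (fun _ : E => 4 * B)) :=
    (integrable_indicator_iff measurableSet_closedBall).2 (integrableOn_const measure_closedBall_lt_top.ne)
  have i3 : Integrable (fun x => 16 * vmol ψ τ f x) := hvf.1.const_mul 16
  have iG1 : Integrable (fun x => hs (g x) - (closedBall c b2).indicator (fun x => hs (g x)) x) := a.ie.sub i1
  have iG2 : Integrable (fun x => (closedBall c b1).indicator (fun _ => 4 * B) x + 16 * vmol ψ τ f x) := i2.add i3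
  have vf0 : ∀ x, 0 ≤ vmol ψ τ f x := fun x =>
    integral_nonneg fun z => mul_nonneg (K.pos z) (f0 _)
  have key : ∀ᵐ x ∂volume.restrict (ball y R0), hs (h x) / ‖v x‖ ^ 2 ≤ G x := by
    rw [ae_restrict_iff' measurableSet_ball]
    filter_upwards [vlow, hle, a.one] with x hx hlx h1x hxR
    specialize hx hxR
    have h4 : hs (h x) / ‖v x‖ ^ 2 ≤ 4 * hs (h x) := by
      have : (1/2 : ℝ) ^ 2 ≤ ‖v x‖ ^ 2 := by gcongr
      rw [div_le_iff₀ (by linarith)]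
      have := mul_le_mul_of_nonneg_left this (hs_nonneg (h x)); linarith
    simp only [hG]
    by_cases hx2 : x ∈ closedBall c b2
    · rw [indicator_of_mem hx2, sub_self, zero_add]
      by_cases hx1 : x ∈ closedBall c b1
      · rw [indicator_of_mem hx1]
        have := hB x hx1
        rw [hd x (ti x hx1).2, (ti x hx1).1] at h4
        rw [hd x (ti x hx1).2, (ti x hx1).1]
        linarith [vf0 x]
      · rw [indicator_of_notMem hx1, zero_add]
        have : vmol ψ τ (fun x => hs (g x)) x = vmol ψ τ f x := by
          refine integral_congr_ae (Eventually.of_forall fun z => ?_)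
          by_cases hz : 1 ≤ ‖z‖
          · simp [K.zψ z hz]
          · have hxA : x - τ x • z ∈ A := by
              rw [mem_closedBall, dist_eq_norm] at hx1 hx2
              have e : x - τ x • z - c = (x - c) - τ x • z := by abel
              have e2 : ‖τ x • z‖ ≤ τ0 := by
                rw [norm_smul, Real.norm_of_nonneg (tp x)]
                exact (mul_le_of_le_one_right (tp x) (not_le.1 hz).le).trans (tle x)
              have e3 := norm_sub_norm_le (x - c) (τ x • z)
              have e4 := norm_sub_le (x - c) (τ x • z)
              rw [hA, Set.mem_sdiff, mem_closedBall, mem_closedBall, dist_eq_norm, e]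
              constructor <;> linarith
            simp only [hf, indicator_of_mem hxA]
        rw [this] at hlx
        linarith
    · rw [indicator_of_notMem hx2]
      have hxb : x ∉ ball c b2 := fun h => hx2 (ball_subset_closedBall h)
      have : 0 ≤ (closedBall c b1).indicator (fun _ => 4 * B) x :=
        indicator_nonneg (fun _ _ => by linarith) x
      rw [h0 x hxb, v0 x (tz x hxb).1, h1x hxR]
      linarith [vf0 x]
  have hI : ∫ x in ball y R0, hs (h x) / ‖v x‖ ^ 2 ≤ ∫ x in ball y R0, G x :=
    integral_mono_of_nonneg (Eventually.of_forall fun x => div_nonneg (hs_nonneg _) (sq_nonneg _))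
      (iG1.add iG2).integrableOn key
  have hGi : ∫ x in ball y R0, G x = (∫ x in ball y R0, hs (g x)) - En g c b2 +
      ((∫ x in ball y R0, (closedBall c b1).indicator (fun _ => 4 * B) x) +
        ∫ x in ball y R0, 16 * vmol ψ τ f x) := by
    simp only [hG]
    rw [integral_add iG1.integrableOn iG2.integrableOn, integral_sub a.ie.integrableOn i1.integrableOn,
      integral_add i2.integrableOn i3.integrableOn, setIntegral_indicator measurableSet_closedBall,
      inter_eq_right.2 hb2a, En]
  have e1 : ∫ x in ball y R0, (closedBall c b1).indicator (fun _ => 4 * B) x ≤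
      4 * B * (b1 ^ n * volume.real (ball (0 : E) 1)) := by
    refine (setIntegral_le_integral i2 (Eventually.of_forall fun x =>
      indicator_nonneg (fun _ _ => by positivity) x)).trans_eq ?_
    rw [integral_indicator measurableSet_closedBall, setIntegral_const, vball _ h11.le, smul_eq_mul]
    ring
  have e2 : ∫ x in ball y R0, 16 * vmol ψ τ f x ≤ 16 * 2 ^ n * (En g c a2 - En g c a1) := by
    refine (setIntegral_le_integral i3 (Eventually.of_forall fun x => by
      have := vf0 x; simp only [Pi.zero_apply]; positivity)).trans ?_
    rw [integral_const_mul, mul_assoc]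
    refine mul_le_mul_of_nonneg_left ?_ (by norm_num)
    have e3 := hvf.2
    rw [K.one', one_mul] at e3
    have e4 : ∫ x, ‖f x‖ = En g c a2 - En g c a1 := by
      simp only [Real.norm_of_nonneg (f0 _)]
      rw [hf, integral_indicator mA, En, En, setIntegral_sdiff measurableSet_closedBall a.ie.integrableOn
        (closedBall_subset_closedBall (by linarith))]
    rw [e4] at e3
    refine le_trans (le_of_eq ?_) e3
    simp only [Real.norm_of_nonneg (vf0 _)]
  have e5 : En g c a1 ≤ En g c b2 := a.En_mono (closedBall_subset_closedBall (by linarith))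
  rw [hGi] at hI
  linarith

set_option maxHeartbeats 1000000 in
lemma LMin.decay (hn : 2 ≤ n) {ψ Γ : E → ℝ} (K : KerPair n ψ Γ) : ∃ s ε : ℝ, 0 < s ∧ s ≤ 1 / 4 ∧ 0 < ε ∧
    ∀ {y : E} {R0 : ℝ} {u : E → F} {g : E → E →L[ℝ] F}, LMin y R0 u g →
    ∀ {c : E} {R : ℝ}, 0 < R → closedBall c R ⊆ ball y R0 → En g c R ≤ ε * R ^ (n - 2) →
    En g c (s ^ 2 * R) ≤ (s ^ 2) ^ (n - 1) * s * En g c R := by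
  obtain ⟨C0, hC0, hI⟩ := LMin.inner2 (p := p) hn K
  obtain ⟨Cl, hl0, hl⟩ := LMin.lower (p := p) hn K
  obtain ⟨Cm, hm1, hm⟩ := LMin.mono (p := p) hn K
  obtain ⟨M, hM0, hM⟩ := kap'_bdd
  set ω := volume.real (ball (0 : E) 1) with hω
  have hω0 : 0 < ω := vball_pos
  set A0 := 4 * 2 ^ n * ω * (C0 + 1) with hA0
  set A1 := 16 * 2 ^ n * (Cm * 2 ^ (n - 2)) with hA1
  have hA0p : 0 ≤ A0 := by positivity
  have hA1p : 0 ≤ A1 := by positivity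
  set s : ℝ := 1 / (2 * A0 + 4) with hs'
  have s0 : 0 < s := by positivity
  have s4 : s ≤ 1 / 4 := one_div_le_one_div_of_le (by norm_num) (by linarith)
  have sA : A0 * s ≤ 1 / 2 := by
    rw [hs', mul_one_div, div_le_iff₀ (by positivity)]; linarith
  obtain ⟨N, hN⟩ := exists_nat_gt (2 * A1 / s ^ 3)
  have hN0 : (0:ℝ) < N := lt_of_le_of_lt (by positivity) hN
  have hNA : A1 / N ≤ s ^ 3 / 2 := by
    rw [div_lt_iff₀ (by positivity)] at hN
    rw [div_le_iff₀ hN0]; linarith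
  obtain ⟨J, hJ⟩ := exists_pow_lt_of_lt_one (y := (1/2:ℝ)) (x := s ^ 2 / (N * (4 * M + 4)))
    (by positivity) (by norm_num)
  obtain ⟨CJ, hCJ0, hCJ⟩ := hI J
  set d : ℝ := 1 / (2 * Cl + 2 * CJ + 2) with hd
  have d0 : 0 < d := by positivity
  have dl : Cl * d ≤ 1 / 2 := by
    rw [hd, mul_one_div, div_le_iff₀ (by positivity)]; linarith
  have dJ : CJ * d ≤ 1 := by
    rw [hd, mul_one_div, div_le_iff₀ (by positivity)]; linarith
  have d1 : d ≤ 1 := by rw [hd, div_le_one (by positivity)]; linarith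
  refine ⟨s, d ^ 2, s0, s4, by positivity, fun {y R0 u g} a {c R} hR hcR hE => ?_⟩
  set θ := s ^ 2 with hθ
  have θ0 : 0 < θ := by positivity
  have θ4 : θ ≤ 1 / 16 := by rw [hθ]; calc s ^ 2 ≤ (1/4) ^ 2 := by gcongr
    _ = _ := by norm_num
  set w := θ * R / N with hw
  have w0 : 0 < w := by positivity
  have hwN : N * w = θ * R := by rw [hw]; field_simp
  set Ec := En g c R with hEc
  have Ec0 : 0 ≤ Ec := En_nonneg _ _ _
  have hRθ : θ * R ≤ R / 16 := by have := mul_le_mul_of_nonneg_right θ4 hR.le; linarith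
  set α : ℕ → ℝ := fun k => θ * R + k * w with hα
  obtain ⟨k, hk, hkE⟩ : ∃ k ∈ Finset.range N, En g c (α (k + 1)) - En g c (α k) ≤ En g c (2 * (θ * R)) / N := by
    refine Finset.exists_le_of_sum_le (Finset.nonempty_range_iff.2 (by rintro rfl; simp at hN0)) ?_
    rw [Finset.sum_range_sub (fun k => En g c (α k)), Finset.sum_const, Finset.card_range, nsmul_eq_mul,
      mul_div_cancel₀ _ hN0.ne']
    have : α N = 2 * (θ * R) := by simp only [hα, hwN]; ring
    rw [this]; linarith [En_nonneg g c (α 0)]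
  rw [Finset.mem_range] at hk
  have hk1 : α (k + 1) ≤ 2 * (θ * R) := by
    have : ((k + 1 : ℕ) : ℝ) * w ≤ N * w := by gcongr; exact_mod_cast hk
    simp only [hα]; linarith
  have hkw : α (k + 1) = α k + w := by simp only [hα]; push_cast; ring
  have hk0 : θ * R ≤ α k := by simp only [hα]; have : (0:ℝ) ≤ k * w := by positivity
                               linarith
  set τ0 := R / 4 / 2 ^ J with hτ0
  have τp : 0 < τ0 := by positivity
  have τw : (4 * M + 4) * τ0 ≤ w / 4 := by
    have : (4 * M + 4) * (1 / 2) ^ J ≤ θ / N := by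
      have := mul_le_mul_of_nonneg_left hJ.le (show 0 ≤ 4 * M + 4 by positivity)
      refine this.trans_eq ?_
      field_simp
    calc (4 * M + 4) * τ0 = ((4 * M + 4) * (1 / 2) ^ J) * (R / 4) := by
          rw [hτ0, one_div, inv_pow]; field_simp
      _ ≤ θ / N * (R / 4) := by gcongr
      _ = w / 4 := by rw [hw]; ring
  have hMτ : 0 ≤ M * τ0 := by positivity
  have hθR : 0 < θ * R := by positivity
  set b1 := α k + w / 4 with hb1
  set b2 := α k + 3 * w / 4 with hb2
  obtain ⟨τ, t1, tl, tp, tle, ti, tz⟩ := tau_exists hM0 hM c (b1 := b1) (b2 := b2) (τ0 := τ0)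
    (by linarith) (by linarith) τp (by linarith)
  set B := (C0 + CJ * d ^ 2) * ((R ^ n)⁻¹ * Ec) with hB
  have hcmp := a.cmp K (c := c) (a1 := α k) (b1 := b1) (b2 := b2) (a2 := α (k + 1)) (τ0 := τ0) (B := B)
    (by linarith) (by linarith) (by linarith) (by linarith) τp
    ((closedBall_subset_closedBall (by linarith)).trans hcR) t1 tl tp tle ti tz
    (fun x hx t ht0 ht => by
      have := hl a hR hcR hE x (closedBall_subset_closedBall (by linarith) hx) t ht0 (by linarith)
      rw [Real.sqrt_sq d0.le] at this
      linarith)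
    (fun x hx => hCJ a hR hcR hE x (closedBall_subset_closedBall (by linarith) hx)) (by positivity)
  have hEk : En g c (θ * R) ≤ En g c (α k) := a.En_mono (closedBall_subset_closedBall hk0)
  have h2 : En g c (2 * (θ * R)) ≤ Cm * 2 ^ (n - 2) * θ ^ (n - 2) * Ec := by
    refine (hm a hcR (by positivity) (by linarith)).trans_eq ?_
    have : 2 * (θ * R) / R = 2 * θ := by field_simp
    rw [this, mul_pow]; ring
  have hn1 : θ ^ (n - 1) = θ * θ ^ (n - 2) := by rw [← pow_succ']; congr 1; omega
  have hn2 : θ ^ n = θ * θ ^ (n - 1) := by rw [← pow_succ']; congr 1; omega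
  have hB' : B ≤ (C0 + 1) * ((R ^ n)⁻¹ * Ec) := by
    rw [hB]; gcongr
    calc CJ * d ^ 2 = (CJ * d) * d := by ring
      _ ≤ 1 * 1 := by gcongr
      _ = 1 := one_mul 1
  calc En g c (θ * R) ≤ _ := hEk.trans hcmp
    _ ≤ 4 * ((C0 + 1) * ((R ^ n)⁻¹ * Ec)) * ((2 * (θ * R)) ^ n * ω) +
        16 * 2 ^ n * ((Cm * 2 ^ (n - 2) * θ ^ (n - 2) * Ec) / N) := by
        gcongr
        · linarith
        · exact hkE.trans (by gcongr)
    _ = (A0 * s) * (s * θ ^ (n - 1) * Ec) + (A1 / N) * (θ ^ (n - 2) * Ec) := by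
        rw [hA0, hA1, mul_pow, mul_pow, hn2, hθ]
        have : (R ^ n)⁻¹ * R ^ n = 1 := inv_mul_cancel₀ (by positivity)
        linear_combination (4 * (C0 + 1) * Ec * 2 ^ n * s ^ 2 * (s ^ 2) ^ (n - 1) * ω) * this
    _ ≤ (1 / 2) * (s * θ ^ (n - 1) * Ec) + (s ^ 3 / 2) * (θ ^ (n - 2) * Ec) := by gcongr
    _ = _ := by rw [hn1, hθ]; ring
end
end

noncomputable section
section
variable {n p : ℕ}
local notation "E" => EuclideanSpace ℝ (Fin n)
local notation "F" => EuclideanSpace ℝ (Fin p)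
variable {V : Type*} [NormedAddCommGroup V] [NormedSpace ℝ V] [CompleteSpace V]

lemma unif_lim {X : Type*} {f : ℕ → X → V} {O : Set X} {C q : ℝ} (hq : 0 ≤ q) (hq1 : q < 1)
    (h : ∀ j, ∀ x ∈ O, ‖f (j + 1) x - f j x‖ ≤ C * q ^ j) : ∃ G, TendstoUniformlyOn f G atTop O := by
  have h1 := tendstoUniformlyOn_tsum_nat (f := fun j x => f (j + 1) x - f j x)
    ((summable_geometric_of_lt_one hq hq1).mul_left C) h
  refine ⟨fun x => (∑' j, (f (j + 1) x - f j x)) + f 0 x, ?_⟩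
  rw [tendstoUniformlyOn_iff] at h1 ⊢
  intro ε hε
  filter_upwards [h1 ε hε] with N hN x hx
  have := hN x hx
  rwa [Finset.sum_range_sub (fun j => f j x), ← dist_add_right _ _ (f 0 x), sub_add_cancel] at this

lemma C1_of {O : Set E} (hO : IsOpen O) {U : E → V} {G : E → E →L[ℝ] V} (hc : ContinuousOn G O)
    (h : ∀ x ∈ O, HasFDerivAt U (G x) x) : ContDiffOn ℝ 1 U O := by
  rw [show (1 : WithTop ℕ∞) = 0 + 1 from rfl, contDiffOn_succ_iff_fderiv_of_isOpen hO]
  refine ⟨fun x hx => (h x hx).differentiableAt.differentiableWithinAt, by simp, ?_⟩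
  rw [contDiffOn_zero]
  exact hc.congr fun x hx => (h x hx).fderiv

lemma lim_C1 {f : ℕ → E → V} {f' : ℕ → E → E →L[ℝ] V} {U : E → V} {O : Set E} (hO : IsOpen O) {C q : ℝ}
    (hq : 0 ≤ q) (hq1 : q < 1) (hd : ∀ j, ∀ x ∈ O, HasFDerivAt (f j) (f' j x) x)
    (hc : ∀ j, ContinuousOn (f' j) O)
    (h : ∀ j, ∀ x ∈ O, ‖f' (j + 1) x - f' j x‖ ≤ C * q ^ j)
    (hU : ∀ x ∈ O, Tendsto (fun j => f j x) atTop (nhds (U x))) :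
    ContDiffOn ℝ 1 U O ∧ ∀ x ∈ O, Tendsto (fun j => f' j x) atTop (nhds (fderiv ℝ U x)) := by
  obtain ⟨G, hG⟩ := unif_lim hq hq1 h
  have hGd : ∀ x ∈ O, HasFDerivAt U (G x) x := fun x hx =>
    hasFDerivAt_of_tendstoUniformlyOn hO hG hd hU hx
  refine ⟨C1_of hO (hG.continuousOn (Frequently.of_forall hc)) hGd, fun x hx => ?_⟩
  rw [(hGd x hx).fderiv]
  exact hG.tendsto_at hx

lemma ae_lim {ψ Γ : E → ℝ} (K : KerPair n ψ Γ) {u U : E → V} (hu : Integrable u) {O : Set E} {s0 : ℝ}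
    (hs0 : 0 < s0) (h : ∀ x ∈ O, Tendsto (fun j : ℕ => mol ψ (s0 / 2 ^ j) u x) atTop (nhds (U x))) :
    ∀ᵐ x, x ∈ O → u x = U x := by
  have hi : ∀ j : ℕ, Integrable (fun x => mol ψ (s0 / 2 ^ j) u x) := fun j =>
    (vmol_integrable K.sψ.continuous K.zψ (lipc _) hu).1
  have hs : Tendsto (fun j : ℕ => s0 / 2 ^ j) atTop (nhds 0) := by
    have := (tendsto_pow_atTop_nhds_zero_of_lt_one (r := (1/2:ℝ)) (by norm_num) (by norm_num)).const_mul s0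
    rw [mul_zero] at this
    refine this.congr fun j => ?_
    rw [one_div, inv_pow, div_eq_mul_inv]
  have h1 : Tendsto (fun j : ℕ => ∫ x, ‖mol ψ (s0 / 2 ^ j) u x - u x‖) atTop (nhds 0) := by
    rw [Metric.tendsto_nhds]
    intro ε hε
    obtain ⟨δ, hδ, hδ'⟩ := mol_tendsto K hu (half_pos hε)
    filter_upwards [hs.eventually_lt_const hδ] with j hj
    rw [Real.dist_0_eq_abs, abs_of_nonneg (integral_nonneg fun _ => norm_nonneg _)]
    exact (hδ' _ (by positivity) hj).trans_lt (half_lt_self hε)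
  have h2 : TendstoInMeasure volume (fun (j : ℕ) x => mol ψ (s0 / 2 ^ j) u x) atTop u := by
    refine tendstoInMeasure_of_tendsto_eLpNorm one_ne_zero (fun j => (hi j).1) hu.1 ?_
    have := ENNReal.tendsto_ofReal h1
    rw [ENNReal.ofReal_zero] at this
    refine this.congr fun j => ?_
    rw [eLpNorm_one_eq_lintegral_enorm, ← ofReal_integral_norm_eq_lintegral_enorm ((hi j).sub hu)]
    rfl
  obtain ⟨ns, hns, hae⟩ := h2.exists_seq_tendsto_ae
  filter_upwards [hae] with x hx hxO
  exact tendsto_nhds_unique hx ((h x hxO).comp hns.tendsto_atTop)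

lemma LMin.morrey (hn : 2 ≤ n) {ψ Γ : E → ℝ} (K : KerPair n ψ Γ) : ∃ ε : ℝ, 0 < ε ∧
    ∀ {y : E} {R0 : ℝ} {u : E → F} {g : E → E →L[ℝ] F}, LMin y R0 u g →
    ∀ {c : E} {R : ℝ}, 0 < R → closedBall c R ⊆ ball y R0 → En g c R ≤ ε * R ^ (n - 2) →
    ∃ C, 0 ≤ C ∧ ∀ x ∈ closedBall c (R / 2), ∀ r, 0 < r → r ≤ R / 2 → En g x r ≤ C * (r ^ (n - 1) * √r) := by
  obtain ⟨s, ε, s0, s4, ε0, hdec⟩ := LMin.decay (p := p) hn K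
  refine ⟨ε / 2 ^ (n - 2), by positivity, fun {y R0 u g} a {c R} hR hcR hE => ?_⟩
  set ρ := R / 2 with hρ
  have ρ0 : 0 < ρ := by positivity
  set Ec := En g c R with hEc
  have Ec0 : 0 ≤ Ec := En_nonneg _ _ _
  have hE' : Ec ≤ ε * ρ ^ (n - 2) := by
    refine hE.trans_eq ?_
    rw [hρ, div_pow]; ring
  set m := (s ^ 2) ^ (n - 1) * s with hm
  have m0 : 0 < m := by positivity
  have m1 : m ≤ (s ^ 2) ^ (n - 2) := by
    have : (s ^ 2) ^ (n - 1) = (s ^ 2) ^ (n - 2) * s ^ 2 := by rw [← pow_succ]; congr 1; omega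
    rw [hm, this, mul_assoc]
    refine mul_le_of_le_one_right (by positivity) ?_
    rw [← pow_succ]; exact pow_le_one₀ s0.le (by linarith)
  refine ⟨Ec / (m * (ρ ^ (n - 1) * √ρ)), by positivity, fun x hx r r0 hr => ?_⟩
  rw [mem_closedBall] at hx
  have hxs : closedBall x ρ ⊆ closedBall c R := cb_sub (by linarith)
  have it : ∀ k : ℕ, En g x ((s ^ 2) ^ k * ρ) ≤ m ^ k * Ec := by
    intro k
    induction k with
    | zero => simp only [pow_zero, one_mul]; exact a.En_mono hxs
    | succ k ih =>
      have hle : (s ^ 2) ^ k * ρ ≤ ρ := mul_le_of_le_one_left ρ0.le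
        (pow_le_one₀ (by positivity) (pow_le_one₀ s0.le (by linarith)))
      have h1 := hdec a (c := x) (R := (s ^ 2) ^ k * ρ) (by positivity)
        ((closedBall_subset_closedBall hle).trans (hxs.trans hcR)) (ih.trans ?_)
      · rw [pow_succ' (s ^ 2) k, mul_assoc, pow_succ' m k, mul_assoc]
        exact h1.trans (mul_le_mul_of_nonneg_left ih m0.le)
      · calc m ^ k * Ec ≤ ((s ^ 2) ^ (n - 2)) ^ k * (ε * ρ ^ (n - 2)) := by gcongr
          _ = _ := by rw [mul_pow, ← pow_mul, ← pow_mul, mul_comm (n - 2) k]; ring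
  obtain ⟨k, hk1, hk2⟩ := exists_nat_pow_near_of_lt_one (x := r / ρ) (y := s ^ 2) (by positivity)
    ((div_le_one ρ0).2 hr) (by positivity) (pow_lt_one₀ s0.le (by linarith) two_ne_zero)
  rw [lt_div_iff₀ ρ0] at hk1
  rw [div_le_iff₀ ρ0] at hk2
  have h1 : En g x r ≤ m ^ k * Ec := (a.En_mono (closedBall_subset_closedBall hk2)).trans (it k)
  refine h1.trans ?_
  rw [div_mul_eq_mul_div, le_div_iff₀ (by positivity)]
  have h2 : m ^ (k + 1) * (ρ ^ (n - 1) * √ρ) ≤ r ^ (n - 1) * √r := by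
    calc m ^ (k + 1) * (ρ ^ (n - 1) * √ρ) = ((s ^ 2) ^ (k + 1) * ρ) ^ (n - 1) * √((s ^ 2) ^ (k + 1) * ρ) := by
          rw [Real.sqrt_mul (by positivity), ← pow_mul, mul_comm 2 (k+1), pow_mul, Real.sqrt_sq (by positivity), hm]
          rw [mul_pow, mul_pow, ← pow_mul, ← pow_mul, ← pow_mul, ← pow_mul, show (k + 1) * (2 * (n - 1)) = 2 * ((n - 1) * (k + 1)) by ring]
          ring
      _ ≤ _ := by gcongr
  calc m ^ k * Ec * (m * (ρ ^ (n - 1) * √ρ)) = Ec * (m ^ (k + 1) * (ρ ^ (n - 1) * √ρ)) := by ring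
    _ ≤ _ := by gcongr

lemma LMin.C1 (hn : 2 ≤ n) {ψ Γ : E → ℝ} (K : KerPair n ψ Γ) : ∃ ε : ℝ, 0 < ε ∧
    ∀ {y : E} {R0 : ℝ} {u : E → F} {g : E → E →L[ℝ] F}, LMin y R0 u g →
    ∀ {c : E} {R : ℝ}, 0 < R → closedBall c R ⊆ ball y R0 → En g c R ≤ ε * R ^ (n - 2) →
    ∃ U : E → F, ContDiffOn ℝ 1 U (ball c (R / 2)) ∧ (∀ᵐ x, x ∈ ball c (R / 2) → u x = U x) ∧
      ∀ᵐ x, x ∈ ball c (R / 2) → g x = fderiv ℝ U x := by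
  obtain ⟨ε, ε0, hM⟩ := LMin.morrey (p := p) hn K
  have sΓ : ContDiff ℝ 1 Γ := K.sΓ.of_le (by simp)
  obtain ⟨b1, hb1, h1⟩ := gmol_bound' (ContinuousLinearMap.lsmul ℝ ℝ : ℝ →L[ℝ] F →L[ℝ] F)
    K.sΓ.continuous K.zΓ
  obtain ⟨b2, hb2, h2⟩ := gmol_bound' ((ContinuousLinearMap.lsmul ℝ ℝ : ℝ →L[ℝ] F →L[ℝ] F).precompL E)
    (sΓ.continuous_fderiv one_ne_zero) (fderiv_zero_of sΓ K.zΓ)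
  refine ⟨ε, ε0, fun {y R0 u g} a {c R} hR hcR hE => ?_⟩
  obtain ⟨C, C0, hC⟩ := hM a hR hcR hE
  set σ : ℕ → ℝ := fun j => R / 4 / 2 ^ j with hσ
  have σ0 : ∀ j, 0 < σ j := fun j => by simp only [hσ]; positivity
  have σ1 : ∀ j, σ j ≤ R / 4 := fun j => div_le_self (by positivity) (one_le_pow₀ (by norm_num))
  have σ2 : ∀ j, σ (j + 1) = σ j / 2 := fun j => by simp only [hσ, pow_succ, ← div_div]
  set q := √(1/2 : ℝ) with hq
  have q0 : 0 ≤ q := Real.sqrt_nonneg _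
  have q1 : q < 1 := by rw [hq, Real.sqrt_lt' one_pos]; norm_num
  have hsq : ∀ j, √(σ j) = √(R / 4) * q ^ j := fun j => by
    have : σ j = R / 4 * (q ^ j) ^ 2 := by
      rw [← pow_mul, mul_comm j 2, pow_mul, hq, Real.sq_sqrt (by norm_num)]
      simp only [hσ, div_eq_mul_inv, one_mul, inv_pow]
    rw [this, Real.sqrt_mul (by positivity), Real.sqrt_sq (by positivity)]
  have hb : ∀ j, ∀ x ∈ ball c (R / 2), σ j * ((σ j ^ n)⁻¹ * ∫ z in closedBall x (σ j), ‖-hs (g z) • u z‖) ≤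
      C * √(R / 4) * q ^ j := fun j x hx => by
    have h3 := (a.Q_le x (σ j)).trans (hC x (ball_subset_closedBall hx) (σ j) (σ0 j) (by linarith [σ1 j]))
    rw [hsq] at h3
    have hp : σ j ^ n = σ j * σ j ^ (n - 1) := by rw [← pow_succ']; congr 1; omega
    have := σ0 j
    calc _ ≤ σ j * ((σ j ^ n)⁻¹ * (C * (σ j ^ (n - 1) * (√(R / 4) * q ^ j)))) := by gcongr
      _ = _ := by rw [hp]; field_simp
  have hball : ∀ j, ∀ x ∈ ball c (R / 2), closedBall x (2 * σ j) ⊆ ball y R0 := fun j x hx => by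
    rw [mem_ball] at hx
    exact (cb_sub (by linarith [σ1 j])).trans hcR
  have hf : ∀ j, ∀ x ∈ ball c (R / 2), ‖mol ψ (σ (j + 1)) u x - mol ψ (σ j) u x‖ ≤
      (R / 4 * b1 * (C * √(R / 4))) * q ^ j := fun j x hx => by
    rw [σ2, kernel_id K a.w.iu (fun φ h1 h2 h3 => a.el h1 h2 h3) (σ0 j)
      ((closedBall_subset_closedBall (by linarith [σ0 j])).trans (hball j x hx)), norm_smul,
      Real.norm_of_nonneg (by positivity), mol_gmol]
    have h3 := h1 (σ0 j) x a.iQ.integrableOn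
    have h4 := hb j x hx
    have := σ0 j
    calc _ ≤ σ j ^ 2 * (b1 * ((σ j ^ n)⁻¹ * ∫ z in closedBall x (σ j), ‖-hs (g z) • u z‖)) := by gcongr
      _ = σ j * b1 * (σ j * ((σ j ^ n)⁻¹ * ∫ z in closedBall x (σ j), ‖-hs (g z) • u z‖)) := by ring
      _ ≤ R / 4 * b1 * (C * √(R / 4) * q ^ j) := by
        have := σ1 j
        have := h4.trans' (mul_nonneg (σ0 j).le (mul_nonneg (by positivity) (integral_nonneg fun _ => norm_nonneg _)))
        gcongr
      _ = _ := by ring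
  have hf' : ∀ j, ∀ x ∈ ball c (R / 2), ‖mol ψ (σ (j + 1)) g x - mol ψ (σ j) g x‖ ≤
      (b2 * (C * √(R / 4))) * q ^ j := fun j x hx => by
    rw [σ2, a.grad_step K (σ0 j) (hball j x hx), norm_smul, Real.norm_of_nonneg (σ0 j).le]
    have h3 := h2 (σ0 j) x a.iQ.integrableOn
    have h4 := hb j x hx
    have := σ0 j
    calc _ ≤ σ j * (b2 * ((σ j ^ n)⁻¹ * ∫ z in closedBall x (σ j), ‖-hs (g z) • u z‖)) := by gcongr
      _ = b2 * (σ j * ((σ j ^ n)⁻¹ * ∫ z in closedBall x (σ j), ‖-hs (g z) • u z‖)) := by ring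
      _ ≤ b2 * (C * √(R / 4) * q ^ j) := by gcongr
      _ = _ := by ring
  obtain ⟨U, hU⟩ := unif_lim (f := fun j => mol ψ (σ j) u) q0 q1 hf
  have hU' : ∀ x ∈ ball c (R / 2), Tendsto (fun j => mol ψ (σ j) u x) atTop (nhds (U x)) :=
    fun x hx => hU.tendsto_at hx
  obtain ⟨r1, r2⟩ := lim_C1 (f := fun j => mol ψ (σ j) u) (f' := fun j => mol ψ (σ j) g) isOpen_ball q0 q1
    (fun j x _ => a.w.mol_hasFDerivAt K.sψ K.zψ (σ0 j) x)
    (fun j x _ => by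
      have := gmol_hasFDerivAt (ContinuousLinearMap.lsmul ℝ ℝ : ℝ →L[ℝ] (E →L[ℝ] F) →L[ℝ] (E →L[ℝ] F))
        (K.sψ.of_le (by simp)) K.zψ (σ0 j) a.w.ig.locallyIntegrable x
      rw [← mol_gmol] at this
      exact this.continuousAt.continuousWithinAt) hf' hU'
  exact ⟨U, r1, ae_lim K a.w.iu (by positivity) hU', ae_lim K a.w.ig (by positivity) r2⟩
end
end

noncomputable section
section
variable {n p : ℕ}
local notation "E" => EuclideanSpace ℝ (Fin n)
local notation "F" => EuclideanSpace ℝ (Fin p)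
variable {V W X : Type*} [NormedAddCommGroup V] [NormedSpace ℝ V] [NormedAddCommGroup W]
  [NormedSpace ℝ W] [NormedAddCommGroup X] [NormedSpace ℝ X]

lemma gmol_sup (B : W →L[ℝ] V →L[ℝ] X) {K : E → W} (hK : Continuous K)
    (hK0 : ∀ z, 1 ≤ ‖z‖ → K z = 0) : ∃ b, 0 ≤ b ∧ ∀ {s : ℝ}, 0 < s → ∀ {u : E → V} {x : E} {M : ℝ},
      (∀ y ∈ closedBall x s, ‖u y‖ ≤ M) → ‖gmol B K s u x‖ ≤ b * M := by
  refine ⟨‖B‖ * ∫ z, ‖K z‖, mul_nonneg (by positivity) (integral_nonneg fun _ => norm_nonneg _), ?_⟩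
  intro s hs u x M h
  have hi : Integrable (fun z => ‖B‖ * ‖K z‖ * M) :=
    ((hK.integrable_of_hasCompactSupport (hcs_of_zero hK0)).norm.const_mul _).mul_const _
  have := norm_integral_le_of_norm_le (f := fun z => B (K z) (u (x - s • z))) hi
    (Eventually.of_forall fun z => ?_)
  · rwa [integral_mul_const, integral_const_mul] at this
  · rcases le_or_gt 1 ‖z‖ with hz | hz
    · simp [hK0 z hz]
    · refine (ContinuousLinearMap.le_opNorm₂ _ _ _).trans ?_
      refine mul_le_mul_of_nonneg_left (h _ ?_) (by positivity)
      rw [mem_closedBall, dist_eq_norm, sub_sub_cancel_left, norm_neg, norm_smul, Real.norm_of_nonneg hs.le]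
      nlinarith

lemma gmol_congr (B : W →L[ℝ] V →L[ℝ] X) {K : E → W} (hK0 : ∀ z, 1 ≤ ‖z‖ → K z = 0) {s : ℝ} (hs : 0 < s)
    {u v : E → V} {x : E} (h : ∀ᵐ y, y ∈ closedBall x s → u y = v y) :
    gmol B K s u x = gmol B K s v x := by
  rw [gmol_eq B K hs, gmol_eq B K hs]
  congr 1
  refine integral_congr_ae ?_
  filter_upwards [h] with y hy
  by_cases hm : y ∈ closedBall x s
  · rw [hy hm]
  · rw [hK0]
    · simp
    · rw [norm_smul, Real.norm_of_nonneg (by positivity), ← div_eq_inv_mul, le_div_iff₀ hs]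
      rw [mem_closedBall, dist_comm, dist_eq_norm] at hm
      linarith

lemma ext_ball {x0 : E} {r r' : ℝ} (hr : 0 < r') (hr' : r' < r) {k : WithTop ℕ∞} (hk : k ≤ (⊤ : ℕ∞)) {U : E → V}
    (hU : ContDiffOn ℝ k U (ball x0 r)) : ∃ T : E → V, ContDiff ℝ k T ∧ HasCompactSupport T ∧
      ∀ x ∈ ball x0 r', T x = U x := by
  let f : ContDiffBump x0 := ⟨r', (r + r') / 2, hr, by linarith⟩
  have hts : tsupport (fun x => f x • U x) ⊆ closedBall x0 ((r + r') / 2) := by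
    rw [← f.tsupport_eq]
    exact closure_mono (Function.support_smul_subset_left _ _)
  refine ⟨fun x => f x • U x, ?_, ?_, fun x hx => ?_⟩
  · refine contDiff_iff_contDiffAt.2 fun x => ?_
    by_cases hx : x ∈ ball x0 r
    · exact ((f.contDiff (n := ⊤)).of_le hk).contDiffAt.smul (hU.contDiffAt (isOpen_ball.mem_nhds hx))
    · have : x ∉ tsupport (fun x => f x • U x) := fun h => hx
        (closedBall_subset_ball (by linarith) (hts h))
      exact contDiffAt_const.congr_of_eventuallyEq (notMem_tsupport_iff_eventuallyEq.1 this)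
  · exact (isCompact_closedBall _ _).of_isClosed_subset (isClosed_tsupport _) hts
  · simp only [f.one_of_mem_closedBall (ball_subset_closedBall hx), one_smul]

lemma ev_near {x0 x : E} {s r : ℝ} (h : dist x x0 + s < r) : ∀ᶠ y in nhds x, dist y x0 + s < r :=
  (isOpen_lt (by fun_prop) continuous_const).mem_nhds h

lemma cb_in {x0 x y : E} {s r : ℝ} (h : dist x x0 + s < r) (hy : y ∈ closedBall x s) : y ∈ ball x0 r := by
  rw [mem_ball]; rw [mem_closedBall] at hy
  linarith [dist_triangle y x x0]

lemma loc_gmol (B : W →L[ℝ] V →L[ℝ] X) {K : E → W} (hK : ContDiff ℝ 1 K)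
    (hK0 : ∀ z, 1 ≤ ‖z‖ → K z = 0) {x0 : E} {r : ℝ} {Q : E → V} (hQ : ContinuousOn Q (ball x0 r)) {x : E} {s : ℝ}
    (hs : 0 < s) (h : dist x x0 + s < r) :
    HasFDerivAt (gmol B K s Q) (s⁻¹ • gmol (B.precompL E) (fderiv ℝ K) s Q x) x := by
  obtain ⟨r', h1, h2⟩ := exists_between h
  have hd := dist_nonneg (x := x) (y := x0)
  obtain ⟨T, hT, hc, he⟩ := ext_ball (by linarith) h2 (k := 0) (by simp) (contDiffOn_zero.2 hQ)
  have a := gmol_hasFDerivAt B hK hK0 hs hT.continuous.locallyIntegrable x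
  have e : ∀ y, dist y x0 + s < r' → ∀ᵐ z, z ∈ closedBall y s → T z = Q z := fun y hy =>
    Eventually.of_forall fun z hz => he z (cb_in hy hz)
  rw [gmol_congr (B.precompL E) (fderiv_zero_of hK hK0) hs (e x h1)] at a
  refine a.congr_of_eventuallyEq ?_
  filter_upwards [ev_near h1] with y hy
  exact (gmol_congr B hK0 hs (e y hy)).symm

lemma loc_mol [CompleteSpace V] {K : E → ℝ} (hK : ContDiff ℝ (⊤ : ℕ∞) K)
    (hK0 : ∀ z, 1 ≤ ‖z‖ → K z = 0) {x0 : E} {r : ℝ} {U : E → V} (hU : ContDiffOn ℝ 1 U (ball x0 r)) {x : E} {s : ℝ}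
    (hs : 0 < s) (h : dist x x0 + s < r) :
    HasFDerivAt (mol K s U) (mol K s (fderiv ℝ U) x) x := by
  obtain ⟨r', h1, h2⟩ := exists_between h
  have hd := dist_nonneg (x := x) (y := x0)
  obtain ⟨T, hT, hc, he⟩ := ext_ball (by linarith) h2 (k := 1) (by simp) hU
  have w := W1.of_C1 hT (hT.continuous.integrable_of_hasCompactSupport hc)
    ((hT.continuous_fderiv one_ne_zero).integrable_of_hasCompactSupport (hc.fderiv ℝ))
  have a := w.mol_hasFDerivAt hK hK0 hs x
  have e : ∀ y, dist y x0 + s < r' → ∀ᵐ z, z ∈ closedBall y s → T z = U z := fun y hy =>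
    Eventually.of_forall fun z hz => he z (cb_in hy hz)
  have e' : mol K s (fderiv ℝ T) x = mol K s (fderiv ℝ U) x := by
    rw [mol_gmol, mol_gmol]
    refine gmol_congr _ hK0 hs (Eventually.of_forall fun z hz => ?_)
    refine Filter.EventuallyEq.fderiv_eq ?_
    filter_upwards [isOpen_ball.mem_nhds (cb_in h1 hz)] with y hy using he y hy
  rw [e'] at a
  refine a.congr_of_eventuallyEq ?_
  filter_upwards [ev_near h1] with y hy
  rw [mol_gmol, mol_gmol]
  exact (gmol_congr _ hK0 hs (e y hy)).symm

lemma loc_lim [CompleteSpace V] {ψ Γ : E → ℝ} (K : KerPair n ψ Γ) {x0 : E} {r : ℝ} {Q : E → V}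
    (hQ : ContinuousOn Q (ball x0 r)) {x : E} {s : ℝ}
    (hs : 0 < s) (h : dist x x0 + s < r) :
    Tendsto (fun j : ℕ => mol ψ (s / 2 ^ j) Q x) atTop (nhds (Q x)) := by
  obtain ⟨r', h1, h2⟩ := exists_between h
  have hd := dist_nonneg (x := x) (y := x0)
  obtain ⟨T, hT, hc, he⟩ := ext_ball (by linarith) h2 (k := 0) (by simp) (contDiffOn_zero.2 hQ)
  rw [tendsto_iff_norm_sub_tendsto_zero]
  rw [Metric.tendsto_atTop]
  intro ε hε
  obtain ⟨δ, δ0, hδ⟩ := Metric.continuous_iff.1 hT.continuous x (ε / 2) (by positivity)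
  have ht : Tendsto (fun j : ℕ => s / 2 ^ j) atTop (nhds 0) := by
    simpa [div_eq_mul_inv, inv_pow] using
      (tendsto_pow_atTop_nhds_zero_of_lt_one (r := (2 : ℝ)⁻¹) (by norm_num) (by norm_num)).const_mul s
  obtain ⟨N, hN⟩ := (ht.eventually (gt_mem_nhds δ0)).exists_forall_of_atTop
  refine ⟨N, fun j hj => ?_⟩
  have sj : s / 2 ^ j ≤ s := div_le_self hs.le (one_le_pow₀ (by norm_num))
  have e : mol ψ (s / 2 ^ j) Q x = mol ψ (s / 2 ^ j) T x := by
    rw [mol_gmol, mol_gmol]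
    exact gmol_congr _ K.zψ (by positivity) (Eventually.of_forall fun z hz =>
      (he z (cb_in (by linarith) hz)).symm)
  rw [e, ← he x (by rw [mem_ball]; linarith), Real.dist_eq, sub_zero, abs_norm]
  refine (mol_sub_le K x (by positivity) hT.continuous fun y hy => ?_).trans_lt (half_lt_self hε)
  rw [← dist_eq_norm]
  exact (hδ y (hy.trans_lt (hN j hj))).le

/-- local kernel identity -/
def KS (ψ Γ : E → ℝ) (x0 : E) (r : ℝ) (U Q : E → V) : Prop :=
  ∀ x s, 0 < s → dist x x0 + s < r → mol ψ (s / 2) U x - mol ψ s U x = s ^ 2 • mol Γ s Q x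

lemma KS.d1 [CompleteSpace V] {ψ Γ : E → ℝ} (K : KerPair n ψ Γ) {x0 : E} {r : ℝ} {U Q : E → V}
    (k : KS ψ Γ x0 r U Q) (hU : ContDiffOn ℝ 1 U (ball x0 r)) {A : E →L[ℝ] V} {x : E} {s : ℝ}
    (hs : 0 < s) (h : dist x x0 + s < r) (hA : HasFDerivAt (mol Γ s Q) A x) :
    mol ψ (s / 2) (fderiv ℝ U) x - mol ψ s (fderiv ℝ U) x = s ^ 2 • A := by
  have a := (loc_mol K.sψ K.zψ hU (half_pos hs) (by linarith)).sub (loc_mol K.sψ K.zψ hU hs h)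
  refine a.unique ((hA.const_smul (s ^ 2)).congr_of_eventuallyEq ?_)
  filter_upwards [ev_near h] with y hy using k y s hs hy

lemma KS.d2 [CompleteSpace V] {ψ Γ : E → ℝ} (K : KerPair n ψ Γ) {x0 : E} {r : ℝ} {U Q : E → V}
    (k : KS ψ Γ x0 r U Q) (hU : ContDiffOn ℝ 1 U (ball x0 r)) (hQ : ContDiffOn ℝ 1 Q (ball x0 r)) :
    KS ψ Γ x0 r (fderiv ℝ U) (fderiv ℝ Q) := fun _ _ hs h =>
  k.d1 K hU hs h (loc_mol K.sΓ K.zΓ hQ hs h)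

lemma KS.d3 [CompleteSpace V] {ψ Γ : E → ℝ} (K : KerPair n ψ Γ) {x0 : E} {r : ℝ} {U Q : E → V}
    (k : KS ψ Γ x0 r U Q) (hU : ContDiffOn ℝ 1 U (ball x0 r)) (hQ : ContinuousOn Q (ball x0 r)) {x : E} {s : ℝ}
    (hs : 0 < s) (h : dist x x0 + s < r) :
    mol ψ (s / 2) (fderiv ℝ U) x - mol ψ s (fderiv ℝ U) x =
      s • gmol ((ContinuousLinearMap.lsmul ℝ ℝ : ℝ →L[ℝ] V →L[ℝ] V).precompL E) (fderiv ℝ Γ) s Q x := by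
  have := loc_gmol (ContinuousLinearMap.lsmul ℝ ℝ : ℝ →L[ℝ] V →L[ℝ] V) (K.sΓ.of_le (by simp)) K.zΓ hQ hs h
  rw [← mol_gmol] at this
  rw [k.d1 K hU hs h this, smul_smul]
  congr 1; field_simp

end
end

noncomputable section
section
variable {n p : ℕ}
local notation "E" => EuclideanSpace ℝ (Fin n)
local notation "F" => EuclideanSpace ℝ (Fin p)
variable {V W X : Type*} [NormedAddCommGroup V] [NormedSpace ℝ V] [NormedAddCommGroup W]
  [NormedSpace ℝ W] [NormedAddCommGroup X] [NormedSpace ℝ X]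

lemma bdd_cb {x0 : E} {r : ℝ} (hr : 0 < r) {Q : E → V} (hQ : ContinuousOn Q (ball x0 r)) :
    ∃ M, 0 ≤ M ∧ ∀ x ∈ closedBall x0 (r / 2), ‖Q x‖ ≤ M := by
  obtain ⟨M, hM⟩ := (isCompact_closedBall x0 (r / 2)).exists_bound_of_continuousOn
    (hQ.mono (closedBall_subset_ball (by linarith)))
  exact ⟨M, (norm_nonneg _).trans (hM x0 (mem_closedBall_self (by linarith))), hM⟩

lemma gmol_sub_const (B : W →L[ℝ] V →L[ℝ] X) {K : E → W} (hK : Continuous K)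
    (hK0 : ∀ z, 1 ≤ ‖z‖ → K z = 0) (s : ℝ) {Q : E → V} (hQ : Continuous Q) (c : V) (x : E) :
    gmol B K s (fun y => Q y - c) x = gmol B K s Q x - gmol B K s (fun _ => c) x := by
  have h : ∀ {T : E → V}, Continuous T → Integrable (fun z => B (K z) (T (x - s • z))) := fun {T} hT => by
    refine Continuous.integrable_of_hasCompactSupport (by fun_prop) ?_
    exact hcs_of_zero fun z hz => by simp [hK0 z hz]
  unfold gmol
  rw [← integral_sub (h hQ) (h continuous_const)]
  simp

lemma gmol_d_const (B : W →L[ℝ] V →L[ℝ] X) {K : E → W} (hK : ContDiff ℝ 1 K)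
    (hK0 : ∀ z, 1 ≤ ‖z‖ → K z = 0) {s : ℝ} (hs : 0 < s) (c : V) (x : E) :
    gmol (B.precompL E) (fderiv ℝ K) s (fun _ => c) x = 0 := by
  have h := gmol_hasFDerivAt B hK hK0 hs (u := fun _ => c) continuous_const.locallyIntegrable x
  have h2 : HasFDerivAt (gmol B K s (fun _ => c)) (0 : E →L[ℝ] X) x :=
    hasFDerivAt_const (∫ z, B (K z) c) x
  have := h.unique h2
  rw [smul_eq_zero] at this
  exact this.resolve_left (inv_ne_zero hs.ne')

lemma gmol_holder (B : W →L[ℝ] V →L[ℝ] X) {K : E → W} (hK1 : ContDiff ℝ 1 K)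
    (hK0 : ∀ z, 1 ≤ ‖z‖ → K z = 0) : ∃ b, 0 ≤ b ∧ ∀ {s : ℝ}, 0 < s → ∀ {u : E → V} {x : E} {M : ℝ},
      Continuous u → (∀ y ∈ closedBall x s, ‖u y - u x‖ ≤ M) →
      ‖gmol (B.precompL E) (fderiv ℝ K) s u x‖ ≤ b * M := by
  obtain ⟨b, b0, hb⟩ := gmol_sup (B.precompL E) (hK1.continuous_fderiv one_ne_zero) (fderiv_zero_of hK1 hK0)
  refine ⟨b, b0, fun {s} hs {u x M} hu h => ?_⟩
  have := hb hs h
  rwa [gmol_sub_const _ (hK1.continuous_fderiv one_ne_zero) (fderiv_zero_of hK1 hK0) s hu,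
    gmol_d_const B hK1 hK0 hs, sub_zero] at this

/-- first derivative kernel -/
def gmol1 (K : E → ℝ) (s : ℝ) (u : E → V) (x : E) : E →L[ℝ] V :=
  gmol ((ContinuousLinearMap.lsmul ℝ ℝ : ℝ →L[ℝ] V →L[ℝ] V).precompL E) (fderiv ℝ K) s u x

/-- second derivative kernel -/
def gmol2 (K : E → ℝ) (s : ℝ) (u : E → V) (x : E) : E →L[ℝ] E →L[ℝ] V :=
  gmol (((ContinuousLinearMap.lsmul ℝ ℝ : ℝ →L[ℝ] V →L[ℝ] V).precompL E).precompL E)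
    (fderiv ℝ (fderiv ℝ K)) s u x

lemma g1_sup {K : E → ℝ} (hK : ContDiff ℝ (⊤ : ℕ∞) K) (hK0 : ∀ z, 1 ≤ ‖z‖ → K z = 0) :
    ∃ b, 0 ≤ b ∧ ∀ {s : ℝ}, 0 < s → ∀ {u : E → V} {x : E} {M : ℝ},
      (∀ y ∈ closedBall x s, ‖u y‖ ≤ M) → ‖gmol1 K s u x‖ ≤ b * M :=
  have h : ContDiff ℝ 1 K := hK.of_le (by simp)
  gmol_sup _ (h.continuous_fderiv one_ne_zero) (fderiv_zero_of h hK0)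

lemma sm_fd {K : E → ℝ} (hK : ContDiff ℝ (⊤ : ℕ∞) K) : ContDiff ℝ 1 (fderiv ℝ K) :=
  (hK.fderiv_right (m := (⊤ : ℕ∞)) (by simp)).of_le (by simp)

lemma g2_holder {K : E → ℝ} (hK : ContDiff ℝ (⊤ : ℕ∞) K) (hK0 : ∀ z, 1 ≤ ‖z‖ → K z = 0) :
    ∃ b, 0 ≤ b ∧ ∀ {s : ℝ}, 0 < s → ∀ {u : E → V} {x : E} {M : ℝ},
      Continuous u → (∀ y ∈ closedBall x s, ‖u y - u x‖ ≤ M) → ‖gmol2 K s u x‖ ≤ b * M :=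
  gmol_holder _ (sm_fd hK) (fderiv_zero_of (hK.of_le (by simp)) hK0)

lemma g1_d {K : E → ℝ} (hK : ContDiff ℝ (⊤ : ℕ∞) K) (hK0 : ∀ z, 1 ≤ ‖z‖ → K z = 0) {x0 : E} {r : ℝ} {Q : E → V}
    (hQ : ContinuousOn Q (ball x0 r)) {x : E} {s : ℝ} (hs : 0 < s) (h : dist x x0 + s < r) :
    HasFDerivAt (mol K s Q) (s⁻¹ • gmol1 K s Q x) x := by
  rw [mol_gmol]
  exact loc_gmol _ (hK.of_le (by simp)) hK0 hQ hs h

lemma g2_d {K : E → ℝ} (hK : ContDiff ℝ (⊤ : ℕ∞) K) (hK0 : ∀ z, 1 ≤ ‖z‖ → K z = 0) {x0 : E} {r : ℝ} {Q : E → V}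
    (hQ : ContinuousOn Q (ball x0 r)) {x : E} {s : ℝ} (hs : 0 < s) (h : dist x x0 + s < r) :
    HasFDerivAt (gmol1 K s Q) (s⁻¹ • gmol2 K s Q x) x :=
  loc_gmol _ (sm_fd hK) (fderiv_zero_of (hK.of_le (by simp)) hK0) hQ hs h

lemma KS.d4 [CompleteSpace V] {ψ Γ : E → ℝ} (K : KerPair n ψ Γ) {x0 : E} {r : ℝ} {U Q : E → V}
    (k : KS ψ Γ x0 r U Q) (hU : ContDiffOn ℝ 1 U (ball x0 r)) (hQ : ContinuousOn Q (ball x0 r)) {x : E} {s : ℝ}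
    (hs : 0 < s) (h : dist x x0 + s < r) :
    mol ψ (s / 2) (fderiv ℝ U) x - mol ψ s (fderiv ℝ U) x = s • gmol1 Γ s Q x := k.d3 K hU hQ hs h

lemma KS.appr [CompleteSpace V] {ψ Γ : E → ℝ} (K : KerPair n ψ Γ) {x0 : E} {r : ℝ} (hr : 0 < r) {U Q : E → V}
    (k : KS ψ Γ x0 r U Q) (hU : ContDiffOn ℝ 1 U (ball x0 r)) (hG : ContinuousOn (fderiv ℝ U) (ball x0 r))
    (hQ : ContinuousOn Q (ball x0 r)) :
    ∃ C, 0 ≤ C ∧ ∀ x ∈ ball x0 (r / 4), ∀ s, 0 < s → s ≤ r / 4 →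
      ‖mol ψ s (fderiv ℝ U) x - fderiv ℝ U x‖ ≤ C * s := by
  obtain ⟨M, M0, hM⟩ := bdd_cb hr hQ
  obtain ⟨b, b0, hb⟩ := g1_sup (V := V) K.sΓ K.zΓ
  refine ⟨2 * (b * M), by positivity, fun x hx s hs hs' => ?_⟩
  rw [mem_ball] at hx
  have ht := loc_lim K hG hs (x := x) (by linarith)
  have := dist_le_of_le_geometric_two_of_tendsto₀ (C := 2 * (b * M) * s) (fun j => ?_) ht
  · simpa [dist_eq_norm] using this
  · have sj : s / 2 ^ j ≤ s := div_le_self hs.le (one_le_pow₀ (by norm_num))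
    have sj0 : 0 < s / 2 ^ j := by positivity
    have e := k.d4 K hU hQ sj0 (x := x) (by linarith)
    rw [div_div, ← pow_succ] at e
    rw [dist_comm, dist_eq_norm, e, norm_smul, Real.norm_of_nonneg sj0.le]
    have := hb sj0 (u := Q) (x := x) (M := M) fun y hy => hM y (by
      rw [mem_closedBall] at hy ⊢; linarith [dist_triangle y x x0])
    calc _ ≤ s / 2 ^ j * (b * M) := by gcongr
      _ = _ := by ring

lemma KS.holder [CompleteSpace V] {ψ Γ : E → ℝ} (K : KerPair n ψ Γ) {x0 : E} {r : ℝ} (hr : 0 < r) {U Q : E → V}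
    (k : KS ψ Γ x0 r U Q) (hU : ContDiffOn ℝ 1 U (ball x0 r)) (hG : ContinuousOn (fderiv ℝ U) (ball x0 r))
    (hQ : ContinuousOn Q (ball x0 r)) :
    ∃ H, 0 ≤ H ∧ ∃ δ, 0 < δ ∧ ∀ x ∈ ball x0 δ, ∀ y ∈ ball x0 δ,
      ‖fderiv ℝ U x - fderiv ℝ U y‖ ≤ H * √‖x - y‖ := by
  obtain ⟨C, C0, hC⟩ := k.appr K hr hU hG hQ
  obtain ⟨M, M0, hM⟩ := bdd_cb hr hG
  obtain ⟨b, b0, hb⟩ := g1_sup (V := E →L[ℝ] V) K.sψ K.zψ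
  refine ⟨2 * C + b * M, by positivity, min (r / 4) ((r / 4) ^ 2 / 2), by positivity, fun x hx y hy => ?_⟩
  have hx1 := ball_subset_ball (min_le_left _ _) hx
  have hy1 := ball_subset_ball (min_le_left _ _) hy
  have hx2 := ball_subset_ball (min_le_right _ _) hx
  have hy2 := ball_subset_ball (min_le_right _ _) hy
  rw [mem_ball] at hx2 hy2
  rcases eq_or_ne x y with rfl | hne
  · simp
  have hd : 0 < ‖x - y‖ := norm_pos_iff.2 (sub_ne_zero.2 hne)
  have hs0 : 0 < √‖x - y‖ := Real.sqrt_pos.2 hd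
  have hsr : √‖x - y‖ ≤ r / 4 := by
    refine Real.sqrt_le_iff.2 ⟨by positivity, ?_⟩
    rw [← dist_eq_norm]
    linarith [dist_triangle_right x y x0]
  set s := √‖x - y‖ with hs
  have hss : ‖x - y‖ = s * s := (Real.mul_self_sqrt hd.le).symm
  have hL : ‖mol ψ s (fderiv ℝ U) x - mol ψ s (fderiv ℝ U) y‖ ≤ s⁻¹ * (b * M) * ‖x - y‖ := by
    refine (convex_ball x0 (r / 4)).norm_image_sub_le_of_norm_hasFDerivWithin_le (𝕜 := ℝ)
      (f' := fun z => s⁻¹ • gmol1 ψ s (fderiv ℝ U) z) (fun z hz => ?_) (fun z hz => ?_) hy1 hx1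
    · rw [mem_ball] at hz
      exact (g1_d K.sψ K.zψ hG hs0 (by linarith)).hasFDerivWithinAt
    · rw [mem_ball] at hz
      rw [norm_smul, Real.norm_of_nonneg (by positivity)]
      refine mul_le_mul_of_nonneg_left (hb hs0 fun w hw => hM w ?_) (by positivity)
      rw [mem_closedBall] at hw ⊢; linarith [dist_triangle w z x0]
  rw [hss, show s⁻¹ * (b * M) * (s * s) = b * M * s by field_simp] at hL
  have h1 := hC x hx1 s hs0 hsr
  have h2 := hC y hy1 s hs0 hsr
  rw [norm_sub_rev] at h1
  calc _ = ‖(fderiv ℝ U x - mol ψ s (fderiv ℝ U) x) + (mol ψ s (fderiv ℝ U) x - mol ψ s (fderiv ℝ U) y)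
        + (mol ψ s (fderiv ℝ U) y - fderiv ℝ U y)‖ := by congr 1; abel
    _ ≤ C * s + b * M * s + C * s := norm_add₃_le.trans (add_le_add (add_le_add h1 hL) h2)
    _ = _ := by ring

lemma sq_pow (j : ℕ) : √((2 : ℝ)⁻¹ ^ j) = √(2 : ℝ)⁻¹ ^ j := by
  induction j with
  | zero => simp
  | succ j ih => rw [pow_succ, Real.sqrt_mul (by positivity), ih, pow_succ]

lemma KS.C2 [CompleteSpace V] {ψ Γ : E → ℝ} (K : KerPair n ψ Γ) {x0 : E} {r : ℝ} (hr : 0 < r) {U Q : E → V}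
    (k : KS ψ Γ x0 r U Q) (hU : ContDiffOn ℝ 1 U (ball x0 r)) (hG : ContinuousOn (fderiv ℝ U) (ball x0 r))
    (hQ : Continuous Q) {H : ℝ}
    (hH : ∀ x ∈ ball x0 r, ∀ y ∈ ball x0 r, ‖Q x - Q y‖ ≤ H * √‖x - y‖) (H0 : 0 ≤ H) :
    ContDiffAt ℝ 1 (fderiv ℝ U) x0 := by
  obtain ⟨b, b0, hb⟩ := g2_holder (V := V) K.sΓ K.zΓ
  have sj0 : ∀ j : ℕ, 0 < r / 4 / 2 ^ j := fun j => by positivity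
  have sj : ∀ j : ℕ, r / 4 / 2 ^ j ≤ r / 4 := fun j => div_le_self (by positivity) (one_le_pow₀ (by norm_num))
  have hd : ∀ j : ℕ, ∀ x ∈ ball x0 (r / 4), HasFDerivAt (mol ψ (r / 4 / 2 ^ j) (fderiv ℝ U))
      ((r / 4 / 2 ^ j)⁻¹ • gmol1 ψ (r / 4 / 2 ^ j) (fderiv ℝ U) x) x := fun j x hx => by
    rw [mem_ball] at hx
    exact g1_d K.sψ K.zψ hG (sj0 j) (by linarith [sj j])
  refine (lim_C1 isOpen_ball (f := fun j => mol ψ (r / 4 / 2 ^ j) (fderiv ℝ U)) (U := fderiv ℝ U)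
    (C := b * (H * √(r / 4))) (q := √(2⁻¹)) (by positivity)
    (by rw [Real.sqrt_lt' one_pos]; norm_num) hd (fun j x hx => ?_) (fun j x hx => ?_) (fun x hx => ?_)).1.contDiffAt
    (isOpen_ball.mem_nhds (mem_ball_self (by positivity : 0 < r / 4)))
  · rw [mem_ball] at hx
    exact ((g2_d K.sψ K.zψ hG (sj0 j)
      (by linarith [sj j])).continuousAt.const_smul (r / 4 / 2 ^ j)⁻¹).continuousWithinAt
  · have h1 := (hd (j + 1) x hx).sub (hd j x hx)
    rw [mem_ball] at hx
    have hxj : dist x x0 + r / 4 / 2 ^ j < r := by linarith [sj j]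
    have h2 := (g2_d K.sΓ K.zΓ hQ.continuousOn (sj0 j) hxj).const_smul (r / 4 / 2 ^ j)
    have h3 := h1.unique (h2.congr_of_eventuallyEq ?_)
    · rw [h3, smul_smul, mul_inv_cancel₀ (sj0 j).ne', one_smul]
      have h4 := hb (sj0 j) (x := x) hQ (M := H * √(r / 4 / 2 ^ j)) fun y hy => ?_
      · refine h4.trans (le_of_eq ?_)
        rw [div_eq_mul_inv (r / 4), ← inv_pow, Real.sqrt_mul (by positivity), sq_pow]
        ring
      · refine (hH y (cb_in hxj hy) x (by rw [mem_ball]; linarith)).trans ?_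
        gcongr
        rwa [mem_closedBall, dist_eq_norm] at hy
    · filter_upwards [ev_near hxj] with y hy
      have := k.d4 K hU hQ.continuousOn (sj0 j) hy
      rw [div_div, ← pow_succ] at this
      exact this
  · rw [mem_ball] at hx
    exact loc_lim K hG (by positivity) (by linarith)

end
end

noncomputable section
section
variable {n p : ℕ}
local notation "E" => EuclideanSpace ℝ (Fin n)
local notation "F" => EuclideanSpace ℝ (Fin p)
variable {V W : Type*} [NormedAddCommGroup V] [NormedSpace ℝ V] [NormedAddCommGroup W]
  [NormedSpace ℝ W]

lemma loc_int {K : E → ℝ} (hK : Continuous K) (hK0 : ∀ z, 1 ≤ ‖z‖ → K z = 0) {x0 : E} {r : ℝ} {Q : E → V}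
    (hQ : ContinuousOn Q (ball x0 r)) {x : E} {s : ℝ} (hs : 0 < s) (h : dist x x0 + s < r) :
    Integrable (fun z => K z • Q (x - s • z)) := by
  obtain ⟨r', h1, h2⟩ := exists_between h
  have hd := dist_nonneg (x := x) (y := x0)
  obtain ⟨T, hT, hc, he⟩ := ext_ball (by linarith) h2 (k := 0) (by simp) (contDiffOn_zero.2 hQ)
  have e : (fun z => K z • Q (x - s • z)) = fun z => K z • T (x - s • z) := by
    funext z
    rcases le_or_gt 1 ‖z‖ with hz | hz
    · simp [hK0 z hz]
    · rw [he _ (cb_in h1 _)]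
      rw [mem_closedBall, dist_eq_norm, sub_sub_cancel_left, norm_neg, norm_smul, Real.norm_of_nonneg hs.le]
      nlinarith
  rw [e]
  have := hT.continuous
  exact Continuous.integrable_of_hasCompactSupport (by fun_prop)
    (hcs_of_zero fun z hz => by simp [hK0 z hz])

lemma mol_pair [CompleteSpace V] [CompleteSpace W] {K : E → ℝ} (hK : Continuous K)
    (hK0 : ∀ z, 1 ≤ ‖z‖ → K z = 0) {x0 : E} {r : ℝ} {Q : E → V} {T : E → W}
    (hQ : ContinuousOn Q (ball x0 r)) (hT : ContinuousOn T (ball x0 r)) {x : E} {s : ℝ} (hs : 0 < s)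
    (h : dist x x0 + s < r) : mol K s (fun y => (Q y, T y)) x = (mol K s Q x, mol K s T x) :=
  integral_pair (loc_int hK hK0 hQ hs h) (loc_int hK hK0 hT hs h)

lemma KS.pair [CompleteSpace V] [CompleteSpace W] {ψ Γ : E → ℝ} (K : KerPair n ψ Γ) {x0 : E} {r : ℝ} {U Q : E → V}
    {U' Q' : E → W} (k : KS ψ Γ x0 r U Q) (k' : KS ψ Γ x0 r U' Q') (hU : ContinuousOn U (ball x0 r))
    (hU' : ContinuousOn U' (ball x0 r)) (hQ : ContinuousOn Q (ball x0 r))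
    (hQ' : ContinuousOn Q' (ball x0 r)) :
    KS ψ Γ x0 r (fun y => (U y, U' y)) (fun y => (Q y, Q' y)) := fun x s hs h => by
  rw [mol_pair K.sψ.continuous K.zψ hU hU' (half_pos hs) (by linarith), mol_pair K.sψ.continuous K.zψ hU hU' hs h,
    mol_pair K.sΓ.continuous K.zΓ hQ hQ' hs h, Prod.mk_sub_mk, k x s hs h, k' x s hs h, Prod.smul_mk]

lemma mol_congr {K : E → ℝ} (hK0 : ∀ z, 1 ≤ ‖z‖ → K z = 0) {s : ℝ} (hs : 0 < s)
    {u v : E → V} {x : E} (h : ∀ᵐ y, y ∈ closedBall x s → u y = v y) : mol K s u x = mol K s v x := by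
  rw [mol_gmol, mol_gmol]
  exact gmol_congr _ hK0 hs h

lemma KS.congr {ψ Γ : E → ℝ} (K : KerPair n ψ Γ) {x0 : E} {r : ℝ} {U Q U' Q' : E → V}
    (k : KS ψ Γ x0 r U Q) (hU : ∀ᵐ y, y ∈ ball x0 r → U y = U' y) (hQ : ∀ᵐ y, y ∈ ball x0 r → Q y = Q' y) :
    KS ψ Γ x0 r U' Q' := fun x s hs h => by
  have := k x s hs h
  rwa [mol_congr K.zψ (half_pos hs) (hU.mono fun y hy hm => hy (cb_in (by linarith) hm)),
    mol_congr K.zψ hs (hU.mono fun y hy hm => hy (cb_in h hm)),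
    mol_congr K.zΓ hs (hQ.mono fun y hy hm => hy (cb_in h hm))] at this

lemma fd_contOn {x0 : E} {r : ℝ} {U : E → V} (hU : ContDiffOn ℝ 1 U (ball x0 r)) :
    ContinuousOn (fderiv ℝ U) (ball x0 r) := hU.continuousOn_fderiv_of_isOpen isOpen_ball le_rfl

lemma KS.up [CompleteSpace V] {ψ Γ : E → ℝ} (K : KerPair n ψ Γ) {x0 : E} {r : ℝ} {U : E → V}
    {P : V × (E →L[ℝ] V) → V} (hP : ContDiff ℝ (⊤ : ℕ∞) P) (k : KS ψ Γ x0 r U (fun x => P (U x, fderiv ℝ U x)))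
    (hU : ContDiffOn ℝ 1 U (ball x0 r)) : ContDiffOn ℝ 1 (fderiv ℝ U) (ball x0 r) := by
  intro x1 hx1
  refine ContDiffAt.contDiffWithinAt ?_
  rw [mem_ball] at hx1
  obtain ⟨r1, hr1⟩ : ∃ r1, r1 = r - dist x1 x0 := ⟨_, rfl⟩
  have r10 : 0 < r1 := by linarith
  have hsub : ball x1 r1 ⊆ ball x0 r := fun y hy => by
    rw [mem_ball] at hy ⊢; linarith [dist_triangle y x1 x0]
  replace hU := hU.mono hsub
  have k1 : KS ψ Γ x1 r1 U (fun x => P (U x, fderiv ℝ U x)) := fun x s hs h =>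
    k x s hs (by linarith [dist_triangle x x1 x0])
  have hG := fd_contOn hU
  have hQ : ContinuousOn (fun x => P (U x, fderiv ℝ U x)) (ball x1 r1) :=
    hP.continuous.comp_continuousOn (hU.continuousOn.prodMk hG)
  obtain ⟨H, H0, δ, δ0, hH⟩ := k1.holder K r10 hU hG hQ
  have hm := isOpen_ball.mem_nhds (mem_ball_self (x := x1) r10)
  obtain ⟨L, t, ht, hL⟩ := (hU.contDiffAt hm).exists_lipschitzOnWith
  obtain ⟨LP, tP, htP, hLP⟩ := ((hP.of_le (by simp) : ContDiff ℝ 1 P).contDiffAt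
    (x := (U x1, fderiv ℝ U x1))).exists_lipschitzOnWith
  have hcont : ContinuousAt (fun x => (U x, fderiv ℝ U x)) x1 :=
    (hU.continuousOn.prodMk hG).continuousAt hm
  obtain ⟨r3, r30, hr3⟩ := Metric.mem_nhds_iff.1 (inter_mem ht (inter_mem (hcont htP)
    (inter_mem (ball_mem_nhds x1 δ0) (ball_mem_nhds x1 (half_pos (lt_min one_pos r10))))))
  obtain ⟨r2, r20, hrr, hr2⟩ : ∃ r2 > 0, r2 ≤ r1 ∧ ball x1 r2 ⊆ _ :=
    ⟨min r3 r1, lt_min r30 r10, min_le_right _ _, (ball_subset_ball (min_le_left _ _)).trans hr3⟩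
  obtain ⟨T, hT, -, he⟩ := ext_ball (k := 0) (r := r1) (x0 := x1) (half_pos (lt_min one_pos r10))
    ((half_lt_self (lt_min one_pos r10)).trans_le (min_le_right _ _)) (by simp) (contDiffOn_zero.2 hQ)
  have hr21 : ball x1 r2 ⊆ ball x1 r1 := ball_subset_ball hrr
  refine KS.C2 K r20 (U := U) (Q := T) (H := LP * (L + H)) ?_ (hU.mono hr21) (hG.mono hr21) hT.continuous ?_
    (by positivity)
  · intro x s hs h
    have hb : closedBall x s ⊆ ball x1 r2 := fun y hy => cb_in h hy
    have hT' : mol Γ s T x = mol Γ s (fun x => P (U x, fderiv ℝ U x)) x := by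
      exact mol_congr K.zΓ hs (Eventually.of_forall fun y hy => he y (hr2 (hb hy)).2.2.2)
    rw [hT']
    exact k1 x s hs (h.trans_le hrr)
  · intro x hx y hy
    have hx' := hr2 hx
    have hy' := hr2 hy
    rw [he x hx'.2.2.2, he y hy'.2.2.2]
    have h1 := hLP.dist_le_mul _ hx'.2.1 _ hy'.2.1
    have h2 := hL.dist_le_mul _ hx'.1 _ hy'.1
    have h3 := hH x hx'.2.2.1 y hy'.2.2.1
    have h4 : dist x y ≤ √‖x - y‖ := by
      have h5 : dist x y ≤ 1 := by
        have a := hx'.2.2.2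
        have b := hy'.2.2.2
        rw [mem_ball] at a b
        have := min_le_left 1 r1
        linarith [dist_triangle_right x y x1]
      rw [← dist_eq_norm]
      exact Real.le_sqrt_of_sq_le (by nlinarith [dist_nonneg (x := x) (y := y)])
    rw [← dist_eq_norm]
    refine h1.trans ?_
    rw [mul_assoc]
    refine mul_le_mul_of_nonneg_left ?_ LP.2
    have s0 := Real.sqrt_nonneg ‖x - y‖
    have hL4 : (L : ℝ) * dist x y ≤ L * √‖x - y‖ := mul_le_mul_of_nonneg_left h4 L.2
    rw [Prod.dist_eq, add_mul]
    rw [← dist_eq_norm] at h3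
    have : 0 ≤ (L : ℝ) * √‖x - y‖ := by positivity
    have : 0 ≤ H * √‖x - y‖ := by positivity
    exact max_le (by linarith) (by linarith)

end
section
variable {n p : ℕ}
local notation "E" => EuclideanSpace ℝ (Fin n)
local notation "F" => EuclideanSpace ℝ (Fin p)

lemma KS.smooth {ψ Γ : E → ℝ} (K : KerPair n ψ Γ) {x0 : E} {r : ℝ} (k : ℕ) :
    ∀ {V : Type} [NormedAddCommGroup V] [NormedSpace ℝ V] [CompleteSpace V] {U : E → V}
    {P : V × (E →L[ℝ] V) → V}, ContDiff ℝ (⊤ : ℕ∞) P → KS ψ Γ x0 r U (fun x => P (U x, fderiv ℝ U x)) →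
    ContDiffOn ℝ 1 U (ball x0 r) → ContDiffOn ℝ (k + 1) U (ball x0 r) := by
  induction k with
  | zero => intro V _ _ _ U P _ _ h; simpa using h
  | succ k ih =>
    intro V _ _ _ U P hP hk hU
    have hG := hk.up K hP hU
    have hU1 : ContDiffOn ℝ 1 (fun x => (U x, fderiv ℝ U x)) (ball x0 r) := hU.prodMk hG
    have hP1 : ContDiff ℝ 1 P := hP.of_le (by simp)
    have hQ : ContDiffOn ℝ 1 (fun x => P (U x, fderiv ℝ U x)) (ball x0 r) := hP1.comp_contDiffOn hU1
    have k2 := hk.pair K (hk.d2 K hU hQ) hU.continuousOn hG.continuousOn hQ.continuousOn (fd_contOn hQ)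
    let P' : (V × (E →L[ℝ] V)) × (E →L[ℝ] (V × (E →L[ℝ] V))) → V × (E →L[ℝ] V) :=
      fun q => (P q.1, (fderiv ℝ P q.1).comp q.2)
    have hP' : ContDiff ℝ (⊤ : ℕ∞) P' := (hP.comp contDiff_fst).prodMk
      (((hP.fderiv_right (m := (⊤ : ℕ∞)) (by simp)).comp contDiff_fst).clm_comp contDiff_snd)
    have k3 : KS ψ Γ x0 r (fun x => (U x, fderiv ℝ U x))
        (fun x => P' ((U x, fderiv ℝ U x), fderiv ℝ (fun x => (U x, fderiv ℝ U x)) x)) := by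
      refine k2.congr K (Eventually.of_forall fun _ _ => rfl) (Eventually.of_forall fun y hy => ?_)
      refine Prod.ext rfl ?_
      have hd := (hU1.contDiffAt (isOpen_ball.mem_nhds hy)).differentiableAt one_ne_zero
      exact ((hP1.differentiable one_ne_zero _).hasFDerivAt.comp y hd.hasFDerivAt).fderiv
    have h := ih hP' k3 hU1
    push_cast
    rw [contDiffOn_succ_iff_fderiv_of_isOpen isOpen_ball]
    exact ⟨hU.differentiableOn one_ne_zero, by simp, contDiff_snd.comp_contDiffOn h⟩

end
end

noncomputable section
section
variable {n p : ℕ}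
local notation "E" => EuclideanSpace ℝ (Fin n)
local notation "F" => EuclideanSpace ℝ (Fin p)

lemma LMin.reg (hn : 2 ≤ n) {ψ Γ : E → ℝ} (K : KerPair n ψ Γ) : ∃ ε : ℝ, 0 < ε ∧
    ∀ {y : E} {R0 : ℝ} {u : E → F} {g : E → E →L[ℝ] F}, LMin y R0 u g →
    ∀ {c : E} {R : ℝ}, 0 < R → closedBall c R ⊆ ball y R0 → En g c R ≤ ε * R ^ (n - 2) →
    ∃ U : E → F, ContDiffOn ℝ (⊤ : ℕ∞) U (ball c (R / 2)) ∧ (∀ᵐ x, x ∈ ball c (R / 2) → u x = U x) := by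
  obtain ⟨ε, ε0, h⟩ := LMin.C1 (p := p) hn K
  refine ⟨ε, ε0, fun {y R0 u g} a {c R} hR hc hE => ?_⟩
  obtain ⟨U, hU, hu, hg⟩ := h a hR hc hE
  refine ⟨U, ?_, hu⟩
  let P : F × (E →L[ℝ] F) → F := fun q => -hs q.2 • q.1
  have hP : ContDiff ℝ (⊤ : ℕ∞) P := by
    have : ContDiff ℝ (⊤ : ℕ∞) (fun q : F × (E →L[ℝ] F) => hs q.2) := by
      unfold hs
      refine ContDiff.sum fun i _ => ContDiff.norm_sq ℝ ?_
      exact contDiff_snd.clm_apply contDiff_const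
    exact this.neg.smul contDiff_fst
  have k0 : KS ψ Γ c (R / 2) u (fun x => -hs (g x) • u x) := fun x s hs0 hx =>
    kernel_id K a.w.iu (fun φ h1 h2 h3 => a.el h1 h2 h3) hs0
      (fun z hz => hc (closedBall_subset_closedBall (by linarith) (ball_subset_closedBall (cb_in hx hz))))
  have k1 : KS ψ Γ c (R / 2) U (fun x => P (U x, fderiv ℝ U x)) := by
    refine k0.congr K hu ?_
    filter_upwards [hu, hg] with x h1 h2 hx
    simp only [P, ← h1 hx, ← h2 hx]
  rw [contDiffOn_infty]
  intro m
  exact (KS.smooth K m hP k1 hU).of_le (by exact_mod_cast Nat.le_succ m)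

lemma vol_null (hn : 2 ≤ n) {f : E → ℝ} (hf : Integrable f) {A : Set E} {ε R : ℝ} (hε : 0 < ε) (hR : 0 < R)
    (h : ∀ x ∈ A, ∀ r, 0 < r → r < R → ε * r ^ (n - 2) ≤ ∫ y in closedBall x r, f y) : volume A = 0 := by
  have hA := IsUnifLocDoublingMeasure.ae_tendsto_average (μ := (volume : Measure E)) hf.locallyIntegrable 1
  refine measure_mono_null (fun x hx => ?_) hA
  simp only [mem_compl_iff, mem_setOf_eq]
  intro hcon
  have hp := vball_pos (n := n)
  have d0 : ∀ j : ℕ, 0 < R / (j + 2) := fun j => by positivity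
  have dt : Tendsto (fun j : ℕ => R / ((j : ℝ) + 2)) atTop (nhds 0) :=
    tendsto_const_nhds.div_atTop (tendsto_atTop_add_const_right _ _ tendsto_natCast_atTop_atTop)
  have h1 := hcon (fun _ : ℕ => x) (fun j => R / (j + 2))
    (tendsto_nhdsWithin_iff.2 ⟨dt, Eventually.of_forall d0⟩)
    (Eventually.of_forall fun j => mem_closedBall_self (by rw [one_mul]; exact (d0 j).le))
  have h2 := h1.mul (dt.pow 2)
  rw [zero_pow two_ne_zero, mul_zero] at h2
  have h3 : ε / volume.real (ball (0 : E) 1) ≤ 0 := ge_of_tendsto' h2 fun j => by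
    have hj := h x hx _ (d0 j) (div_lt_self hR (by linarith [(Nat.cast_nonneg j : (0 : ℝ) ≤ j)]))
    have d0j := d0 j
    set r := R / ((j : ℝ) + 2)
    rw [setAverage_eq, vball x d0j.le, smul_eq_mul]
    obtain ⟨m, rfl⟩ := Nat.exists_eq_add_of_le' hn
    rw [Nat.add_sub_cancel] at hj
    rw [div_le_iff₀ hp]
    have : (r ^ (m + 2) * volume.real (ball (0 : EuclideanSpace ℝ (Fin (m + 2))) 1))⁻¹ *
      (∫ y in closedBall x r, f y) * r ^ 2 * volume.real (ball (0 : EuclideanSpace ℝ (Fin (m + 2))) 1) =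
      (r ^ m)⁻¹ * ∫ y in closedBall x r, f y := by field_simp; ring
    rw [this, ← div_eq_inv_mul, le_div_iff₀ (by positivity)]
    exact hj
  have := div_pos hε hp
  linarith

lemma cover0 (hn : 2 ≤ n) {f : E → ℝ} (hf : Integrable f) (f0 : ∀ x, 0 ≤ f x) {A : Set E} {ε R : ℝ} (hε : 0 < ε)
    (hR : 0 < R) (h : ∀ x ∈ A, ∀ r, 0 < r → r < R → ε * r ^ (n - 2) ≤ ∫ y in closedBall x r, f y) :
    μH[(n : ℝ) - 2] A = 0 := by
  have hv := vol_null hn hf hε hR h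
  set ν : Measure E := volume.withDensity (fun x => ENNReal.ofReal (f x)) with hν
  have : IsFiniteMeasure ν := isFiniteMeasure_withDensity_ofReal hf.2
  have hνA : ν A = 0 := withDensity_absolutelyContinuous _ _ hv
  have hb : ∀ x ∈ A, ∀ r, 0 < r → r < R → ENNReal.ofReal (ε * r ^ (n - 2)) ≤ ν (closedBall x r) :=
    fun x hx r hr hr' => by
      rw [hν, withDensity_apply _ measurableSet_closedBall,
        ← ofReal_integral_eq_lintegral_ofReal hf.integrableOn (Eventually.of_forall f0)]
      exact ENNReal.ofReal_le_ofReal (h x hx r hr hr')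
  have key : ∀ η : ℝ, 0 < η → ∃ (T : Set E) (ρ : E → ℝ), T.Countable ∧
      (∀ x : T, ediam (closedBall (x : E) (ρ x)) ≤ ENNReal.ofReal (8 * η)) ∧
      A ⊆ ⋃ x : T, closedBall (x : E) (ρ x) ∧
      ∑' x : T, ediam (closedBall (x : E) (ρ x)) ^ ((n : ℝ) - 2) ≤
        ENNReal.ofReal (8 ^ (n - 2) / ε) * ENNReal.ofReal η := by
    intro η hη
    obtain ⟨O, hAO, hO, hνO⟩ := A.exists_isOpen_lt_of_lt (μ := ν) (ENNReal.ofReal η)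
      (by rw [hνA]; exact ENNReal.ofReal_pos.2 hη)
    have hr : ∀ x ∈ A, ∃ r : ℝ, 0 < r ∧ r < R ∧ r ≤ η ∧ closedBall x r ⊆ O := fun x hx => by
      obtain ⟨t, t0, ht⟩ := Metric.isOpen_iff.1 hO x (hAO hx)
      refine ⟨min (t / 2) (min (R / 2) η), by positivity, ?_, ?_, ?_⟩
      · exact (min_le_right _ _).trans_lt ((min_le_left _ _).trans_lt (half_lt_self hR))
      · exact (min_le_right _ _).trans (min_le_right _ _)
      · exact (closedBall_subset_ball ((min_le_left _ _).trans_lt (half_lt_self t0))).trans ht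
    choose! r r0 rR rη rO using hr
    obtain ⟨T, hTA, hd, hc⟩ := Vitali.exists_disjoint_subfamily_covering_enlargement_closedBall A
      (fun x => x) r η rη 4 (by norm_num)
    have hTc : T.Countable := hd.countable_of_nonempty_interior fun x hx =>
      (nonempty_ball.2 (r0 x (hTA hx))).mono ball_subset_interior_closedBall
    have hdi : ∀ x ∈ T, ediam (closedBall x (4 * r x)) ≤ ENNReal.ofReal (8 * r x) := fun x hx => by
      have h4 := r0 x (hTA hx)
      refine ediam_le_of_forall_dist_le fun y hy z hz => ?_
      rw [mem_closedBall] at hy hz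
      linarith [dist_triangle_right y z x]
    refine ⟨T, fun x => 4 * r x, hTc, fun x => (hdi x x.2).trans (ENNReal.ofReal_le_ofReal ?_),
      fun x hx => ?_, ?_⟩
    · linarith [rη x (hTA x.2)]
    · obtain ⟨b, hb, hsub⟩ := hc x hx
      exact mem_iUnion.2 ⟨⟨b, hb⟩, hsub (mem_closedBall_self (r0 x hx).le)⟩
    · have : Countable T := hTc.to_subtype
      have hsum : ∑' x : T, ν (closedBall (x : E) (r x)) ≤ ENNReal.ofReal η := by
        rw [← measure_iUnion (f := fun x : T => closedBall (x : E) (r x))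
          (fun x y hxy => hd x.2 y.2 (fun h => hxy (Subtype.ext h))) fun _ => measurableSet_closedBall]
        exact (measure_mono (iUnion_subset fun x : T => rO x (hTA x.2))).trans hνO.le
      calc _ ≤ ∑' x : T, ENNReal.ofReal (8 ^ (n - 2) / ε) * ν (closedBall (x : E) (r x)) := by
            refine ENNReal.tsum_le_tsum fun x => ?_
            have hx := hTA x.2
            rw [show (n : ℝ) - 2 = ((n - 2 : ℕ) : ℝ) by push_cast [hn]; ring, ENNReal.rpow_natCast]
            refine (pow_le_pow_left' (hdi x x.2) _).trans ?_
            rw [← ENNReal.ofReal_pow (by linarith [r0 x hx])]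
            refine le_trans (le_of_eq ?_) (mul_le_mul_right (hb x hx _ (r0 x hx) (rR x hx)) _)
            rw [← ENNReal.ofReal_mul (by positivity), mul_pow]
            congr 1; field_simp
        _ = ENNReal.ofReal (8 ^ (n - 2) / ε) * ∑' x : T, ν (closedBall (x : E) (r x)) := ENNReal.tsum_mul_left
        _ ≤ _ := mul_le_mul_right hsum _
  choose! T ρ hT1 hT2 hT3 hT4 using key
  have η0 : ∀ j : ℕ, (0 : ℝ) < 1 / (j + 1) := fun j => by positivity
  have : ∀ j : ℕ, Countable (T (1 / (j + 1))) := fun j => (hT1 _ (η0 j)).to_subtype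
  have ht : ∀ c : ℝ, Tendsto (fun j : ℕ => ENNReal.ofReal (c * (1 / ((j : ℝ) + 1)))) atTop (nhds 0) := fun c => by
    have := (ENNReal.continuous_ofReal.tendsto 0).comp
      ((tendsto_one_div_add_atTop_nhds_zero_nat (𝕜 := ℝ)).const_mul c |>.trans (by simp))
    simpa [Function.comp_def] using this
  have hl := Measure.hausdorffMeasure_le_liminf_tsum (ι := fun j : ℕ => T (1 / (j + 1))) ((n : ℝ) - 2) A
    (fun j : ℕ => ENNReal.ofReal (8 * (1 / ((j : ℝ) + 1)))) (ht 8)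
    (fun j x => closedBall (x : E) (ρ (1 / (j + 1)) x))
    (Eventually.of_forall fun j => hT2 _ (η0 j)) (Eventually.of_forall fun j => hT3 _ (η0 j))
  refine le_antisymm (hl.trans ?_) bot_le
  have h0 : Tendsto (fun j : ℕ => ∑' x : T (1 / ((j : ℝ) + 1)),
      ediam (closedBall (x : E) (ρ (1 / (j + 1)) x)) ^ ((n : ℝ) - 2)) atTop (nhds 0) := by
    refine tendsto_of_tendsto_of_tendsto_of_le_of_le tendsto_const_nhds (ht (8 ^ (n - 2) / ε))
      (fun _ => bot_le) fun j => ?_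
    dsimp only
    rw [ENNReal.ofReal_mul (by positivity)]
    exact hT4 _ (η0 j)
  exact h0.liminf_eq.le

lemma cover (hn : 2 ≤ n) {Ω S : Set E} (hΩ : IsOpen Ω) (hS : S ⊆ Ω) {e : E → ℝ} (he0 : ∀ x, 0 ≤ e x)
    (hie : LocallyIntegrableOn e Ω) {ε : ℝ} (hε : 0 < ε)
    (h : ∀ x ∈ S, ∀ r, 0 < r → closedBall x (2 * r) ⊆ Ω → ε * r ^ (n - 2) ≤ ∫ y in closedBall x r, e y) :
    μH[(n : ℝ) - 2] S = 0 := by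
  refine measure_null_of_locally_null S fun x hx => ?_
  obtain ⟨t, t0, ht⟩ := Metric.isOpen_iff.1 hΩ x (hS hx)
  refine ⟨S ∩ ball x (t / 4), inter_mem_nhdsWithin _ (ball_mem_nhds _ (by positivity)), ?_⟩
  have hsub : closedBall x (t / 2) ⊆ Ω := (closedBall_subset_ball (by linarith)).trans ht
  have hi : Integrable ((closedBall x (t / 2)).indicator e) :=
    (integrable_indicator_iff measurableSet_closedBall).2
      (hie.integrableOn_compact_subset hsub (isCompact_closedBall _ _))
  refine cover0 hn hi (fun y => indicator_nonneg (fun z _ => he0 z) y) hε (R := t / 8) (by positivity)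
    fun y hy r hr hrt => ?_
  have hy2 := hy.2
  rw [mem_ball] at hy2
  have h1 : closedBall y (2 * r) ⊆ closedBall x (t / 2) := fun z hz => by
    rw [mem_closedBall] at hz ⊢; linarith [dist_triangle z y x]
  rw [setIntegral_congr_fun measurableSet_closedBall fun z hz =>
    indicator_of_mem (h1 (closedBall_subset_closedBall (by linarith) hz)) e]
  exact h y hy.1 r hr (h1.trans hsub)

lemma main_thm (n p : ℕ) (hn : 2 ≤ n)
    (Ω : Set (EuclideanSpace ℝ (Fin n))) (hΩ : IsOpen Ω)
    (u : EuclideanSpace ℝ (Fin n) → EuclideanSpace ℝ (Fin p))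
    (g : EuclideanSpace ℝ (Fin n) →
      (EuclideanSpace ℝ (Fin n) →L[ℝ] EuclideanSpace ℝ (Fin p)))
    (hu : IsEnergyMinimizingToSphere n p Ω u g) :
    μH[(n : ℝ) - 2] (Ω \ regSet n p Ω u) = 0 := by
  obtain ⟨ψ, Γ, s1, s2, s3, s4, s5, s6, s7⟩ := kernel_exists n (by omega)
  have K : KerPair n ψ Γ := ⟨s1, s2, s3, s4, s5, s6, s7⟩
  obtain ⟨ε, ε0, hreg⟩ := LMin.reg (p := p) hn K
  refine cover hn hΩ sdiff_subset (e := energyDensity n p g) (fun x => ?_) hu.2.1 ε0 fun x hx r hr hB => ?_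
  · rw [energy_eq]; exact hs_nonneg _
  by_contra hcon
  obtain ⟨u', g', a, h1, h2⟩ := lmin_of K hΩ hu (by positivity : 0 < 2 * r) hB
  have hsub : closedBall x r ⊆ ball x (2 * r) := closedBall_subset_ball (by linarith)
  have hE : En g' x r ≤ ε * r ^ (n - 2) := by
    refine le_trans (le_of_eq ?_) (le_of_not_ge hcon)
    refine setIntegral_congr_fun measurableSet_closedBall fun z hz => ?_
    simp only [energy_eq, h2 z (hsub hz)]
  obtain ⟨U, hU, hae⟩ := hreg a hr hsub hE
  have hb : ball x (r / 2) ⊆ closedBall x (2 * r) :=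
    (ball_subset_ball (by linarith)).trans ball_subset_closedBall
  refine hx.2 ⟨hx.1, ball x (r / 2), isOpen_ball, mem_ball_self (by positivity), hb.trans hB, U, hU, ?_⟩
  rw [ae_restrict_iff' measurableSet_ball]
  filter_upwards [hae] with z hz hm
  rw [← h1 z (hb hm), hz hm]

end
end

/-- Theorem 6 of the paper, for energy minimizing maps into the unit sphere: the
singular set `sing(u) = Ω ∖ reg(u)` has vanishing `(n-2)`-dimensional Hausdorff
measure; in particular it is empty when `n = 2`. -/
theorem singular_set_hausdorff_null
    (n p : ℕ) (hn : 2 ≤ n) (hp : 2 ≤ p)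
    (Ω : Set (EuclideanSpace ℝ (Fin n))) (hΩ : IsOpen Ω)
    (u : EuclideanSpace ℝ (Fin n) → EuclideanSpace ℝ (Fin p))
    (g : EuclideanSpace ℝ (Fin n) →
      (EuclideanSpace ℝ (Fin n) →L[ℝ] EuclideanSpace ℝ (Fin p)))
    (hu : IsEnergyMinimizingToSphere n p Ω u g) :
    μH[(n : ℝ) - 2] (Ω \ regSet n p Ω u) = 0 ∧
      (n = 2 → Ω \ regSet n p Ω u = ∅) := by
  have h := main_thm n p hn Ω hΩ u g hu
  refine ⟨h, fun h2 => ?_⟩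
  subst h2
  refine eq_empty_of_forall_notMem fun x hx => ?_
  have h1 : μH[(0 : ℝ)] ({x} : Set (EuclideanSpace ℝ (Fin 2))) = 1 :=
    Measure.hausdorffMeasure_zero_singleton x
  have h3 := measure_mono_null (singleton_subset_iff.2 hx) h
  rw [show ((2 : ℕ) : ℝ) - 2 = 0 by norm_num, h1] at h3
  exact one_ne_zero h3
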